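/- Let R be a regular local ring and let M and N be finitely generated R-modules with M nonzero. If Ext_R^n(M,N) = 0 for some n with 1 ≤ n ≤ grade(M), then Ext_R^{n−1}(M,R) ⊗_R N ≅ Ext_R^{n−1}(M,N); in particular, since n−1 < grade(M) gives Ext_R^{n−1}(M,R) = 0, it follows that Ext_R^{n−1}(M,N) = 0. -/

import Mathlib

open CategoryTheory IsLocalRing

universe u

/-- `extMod S n A B` is the `n`-th Ext module `Ext_S^n(A, B)` of `S`-modules `A` and `B`,
realized as an object of `ModuleCat S`. -/
noncomputable def extMod (S : Type u) [CommRing S] (n : ℕ)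
    (A : Type u) [AddCommGroup A] [Module S A] (B : Type u) [AddCommGroup B] [Module S B] :
    ModuleCat.{u} S :=
  ((Ext S (ModuleCat.{u} S) n).obj (Opposite.op (ModuleCat.of S A))).obj (ModuleCat.of S B)

/-- `moduleGrade S M = inf { n | Ext_S^n(M, S) ≠ 0 }`. -/
noncomputable def moduleGrade (S : Type u) [CommRing S]
    (M : Type u) [AddCommGroup M] [Module S M] : ℕ :=
  sInf {n : ℕ | ¬ Subsingleton (extMod S n M S)}

/-- A Noetherian local ring is regular if its maximal ideal can be generated by
`dim R` many elements. -/
def IsRegularLocal (R : Type u) [CommRing R] [IsLocalRing R] : Prop :=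
  IsNoetherianRing R ∧ ∃ s : Finset R, Ideal.span (s : Set R) = maximalIdeal R ∧
    ((s.card : ℕ∞) : WithBot ℕ∞) = ringKrullDim R

set_option linter.unusedSectionVars false

section MatrixMaps

variable {A : Type*} [CommRing A] {X Y : Type*} [AddCommGroup X] [Module A X]
  [AddCommGroup Y] [Module A Y] {m n p : Type*} [Fintype n] [Fintype p]

/-- The action of a matrix on vectors with entries in a module. -/
def smulVec (X : Type*) [AddCommGroup X] [Module A X] (M : Matrix m n A) :
    (n → X) →ₗ[A] (m → X) where
  toFun v i := ∑ k, M i k • v k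
  map_add' v w := by ext i; simp [Finset.sum_add_distrib]
  map_smul' a v := by
    ext i
    simp only [Pi.smul_apply, RingHom.id_apply, Finset.smul_sum]
    exact Finset.sum_congr rfl fun k _ => smul_comm _ _ _

theorem smulVec_apply (M : Matrix m n A) (v : n → X) (i : m) :
    smulVec X M v i = ∑ k, M i k • v k := rfl

theorem smulVec_mul (M : Matrix m n A) (N : Matrix n p A) (v : p → X) :
    smulVec X (M * N) v = smulVec X M (smulVec X N v) := by
  ext i
  simp only [smulVec_apply, Matrix.mul_apply, Finset.sum_smul, Finset.smul_sum, mul_smul]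
  exact Finset.sum_comm

theorem smulVec_zero (v : n → X) : smulVec X (0 : Matrix m n A) v = 0 := by
  ext i; simp [smulVec_apply]

theorem smulVec_smul (a : A) (M : Matrix m n A) (v : n → X) :
    smulVec X (a • M) v = a • smulVec X M v := by
  ext i; simp [smulVec_apply, Finset.smul_sum, mul_smul]

theorem smulVec_comp (f : X →ₗ[A] Y) (M : Matrix m n A) (v : n → X) :
    smulVec Y M (f ∘ v) = f ∘ smulVec X M v := by
  ext i; simp [smulVec_apply]

theorem smulVec_map {B : Type*} [CommRing B] {Y : Type*} [AddCommGroup Y] [Module B Y]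
    (φ : A →+* B) (f : X →+ Y)
    (h : ∀ a x, f (a • x) = φ a • f x) (M : Matrix m n A) (v : n → X) :
    smulVec Y (M.map φ) (f ∘ v) = f ∘ smulVec X M v := by
  ext i; simp [smulVec_apply, h]

theorem smulVec_ext_iff (M N : Matrix m n A) : M = N ↔ ∀ v, smulVec A M v = smulVec A N v := by
  classical
  refine ⟨fun h v => by rw [h], fun h => ?_⟩
  ext i j
  have := congrFun (h (Pi.single j 1)) i
  simpa [smulVec_apply, Pi.single_apply] using this

/-- Exactness over the module `X` of a pair of composable matrices. -/
def MatExact (X : Type*) [AddCommGroup X] [Module A X] (M : Matrix m n A) (N : Matrix n p A) :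
    Prop :=
  Function.Exact (smulVec X N) (smulVec X M)

theorem MatExact.mul_eq_zero {M : Matrix m n A} {N : Matrix n p A} (h : MatExact A M N) :
    M * N = 0 := by
  rw [smulVec_ext_iff]
  intro v
  rw [smulVec_mul, smulVec_zero]
  exact h.apply_apply_eq_zero v

theorem matExact_iff {M : Matrix m n A} {N : Matrix n p A} (h : M * N = 0) :
    MatExact X M N ↔ ∀ v : n → X, smulVec X M v = 0 → ∃ w, smulVec X N w = v := by
  refine ⟨fun H v hv => (H v).1 hv, fun H v => ⟨H v, ?_⟩⟩
  rintro ⟨w, rfl⟩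
  rw [← smulVec_mul, h, smulVec_zero]

theorem smulVec_addEquiv {B : Type*} [CommRing B] {Y : Type*} [AddCommGroup Y] [Module B Y]
    (φ : A →+* B) (e : X ≃+ Y) (h : ∀ a x, e (a • x) = φ a • e x) (M : Matrix m n A) (v : n → X) :
    smulVec Y (M.map φ) (e ∘ v) = e ∘ smulVec X M v :=
  smulVec_map φ e.toAddMonoidHom h M v

theorem matExact_congr {B : Type*} [CommRing B] {Y : Type*} [AddCommGroup Y] [Module B Y]
    (φ : A →+* B) (e : X ≃+ Y)
    (h : ∀ a x, e (a • x) = φ a • e x) {M : Matrix m n A} {N : Matrix n p A} :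
    MatExact Y (M.map φ) (N.map φ) ↔ MatExact X M N := by
  have hm : Function.Injective (fun v : m → X => e ∘ v) := e.injective.comp_left
  have hn : Function.Injective (fun v : n → X => e ∘ v) := e.injective.comp_left
  have hs : Function.Surjective (fun v : n → X => e ∘ v) := e.surjective.comp_left
  have hp : Function.Surjective (fun v : p → X => e ∘ v) := e.surjective.comp_left
  have h0 : e ∘ (0 : m → X) = 0 := by ext; simp
  have : ∀ v : n → X, (smulVec Y (M.map φ) (e ∘ v) = 0 ↔ smulVec X M v = 0) := fun v => by
    rw [smulVec_addEquiv φ e h, ← h0]; exact hm.eq_iff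
  have h2 : ∀ v : n → X, (e ∘ v ∈ Set.range (smulVec Y (N.map φ)) ↔
      v ∈ Set.range (smulVec X N)) := fun v => by
    constructor
    · rintro ⟨w, hw⟩
      obtain ⟨w, rfl⟩ := hp w
      refine ⟨w, hn ?_⟩
      exact (smulVec_addEquiv φ e h N w).symm.trans hw
    · rintro ⟨w, rfl⟩
      exact ⟨e ∘ w, smulVec_addEquiv φ e h N w⟩
  refine ⟨fun H v => ?_, fun H v => ?_⟩
  · rw [← this, ← h2]; exact H _
  · obtain ⟨v, rfl⟩ := hs v
    exact (this v).trans ((H v).trans (h2 v).symm)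

theorem MatExact.congr {Y : Type*} [AddCommGroup Y] [Module A Y] (e : X ≃ₗ[A] Y)
    {M : Matrix m n A} {N : Matrix n p A} (h : MatExact X M N) : MatExact Y M N := by
  have := (matExact_congr (RingHom.id A) e.toAddEquiv (fun a x => e.map_smul a x)).2 h
  simpa using this

theorem matExact_of_subsingleton [Subsingleton X] (M : Matrix m n A) (N : Matrix n p A) :
    MatExact X M N := fun _ =>
  ⟨fun _ => ⟨0, Subsingleton.elim _ _⟩, fun _ => Subsingleton.elim _ _⟩

theorem matExact_restrict {B : Type*} [CommRing B] [Algebra A B] [Module B X]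
    [IsScalarTower A B X] {M : Matrix m n A} {N : Matrix n p A} :
    MatExact X (M.map (algebraMap A B)) (N.map (algebraMap A B)) ↔ MatExact X M N :=
  matExact_congr (algebraMap A B) (AddEquiv.refl X) (fun a x => (algebraMap_smul B a x).symm)

/-- Exactness of matrices in the middle term of a short exact sequence of modules. -/
theorem MatExact.of_shortExact {X' X'' : Type*} [AddCommGroup X'] [Module A X']
    [AddCommGroup X''] [Module A X''] (f : X' →ₗ[A] X) (g : X →ₗ[A] X'')
    (hfg : Function.Exact f g) (hf : Function.Injective f) (hg : Function.Surjective g)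
    {M : Matrix m n A} {N : Matrix n p A} (hMN : M * N = 0)
    (h' : MatExact X' M N) (h'' : MatExact X'' M N) : MatExact X M N := by
  rw [matExact_iff hMN] at *
  intro v hv
  obtain ⟨w'', hw''⟩ := h'' (g ∘ v) (by rw [smulVec_comp, hv]; ext; simp)
  obtain ⟨w, rfl⟩ := hg.comp_left w''
  have hz : ∀ i, g ((v - smulVec X N w) i) = 0 := fun i => by
    have := congrFun hw'' i
    rw [smulVec_comp] at this
    simp only [Pi.sub_apply, map_sub, sub_eq_zero]
    exact this.symm
  choose v' hv' using fun i => (hfg _).1 (hz i)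
  have hfv : f ∘ v' = v - smulVec X N w := funext hv'
  obtain ⟨w', hw'⟩ := h' v' (hf.comp_left (by
    change f ∘ _ = f ∘ _
    rw [← smulVec_comp, hfv, map_sub, hv, ← smulVec_mul, hMN, smulVec_zero]
    ext; simp))
  refine ⟨w + f ∘ w', ?_⟩
  rw [map_add, smulVec_comp, hw', hfv, add_sub_cancel]

/-- Exactness modulo a regular element. -/
theorem MatExact.quotient {q : Type*} [Fintype q] (x : A) (hx : IsSMulRegular X x)
    {L : Matrix q m A} [Fintype m] {M : Matrix m n A} {N : Matrix n p A}
    (hLM : L * M = 0) (h₁ : MatExact X L M) (h₂ : MatExact X M N)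
    (hMN : M * N = 0) (Y : Type*) [AddCommGroup Y] [Module A Y] (g : X →ₗ[A] Y)
    (hg : Function.Surjective g) (hgx : ∀ v, g v = 0 ↔ ∃ w, x • w = v) : MatExact Y M N := by
  rw [matExact_iff hMN] at *
  rw [matExact_iff hLM] at h₁
  intro v hv
  obtain ⟨v, rfl⟩ := hg.comp_left v
  rw [smulVec_comp] at hv
  choose w hw using fun i => (hgx _).1 (congrFun hv i)
  have hw : x • w = smulVec X M v := funext hw
  obtain ⟨u, rfl⟩ := h₁ w (by
    have : x • smulVec X L w = x • 0 := by
      rw [← map_smul, hw, ← smulVec_mul, hLM, smulVec_zero, smul_zero]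
    exact funext fun i => hx (congrFun this i))
  obtain ⟨t, ht⟩ := h₂ (v - x • u) (by rw [map_sub, map_smul, hw, sub_self])
  refine ⟨g ∘ t, ?_⟩
  rw [smulVec_comp, ht]
  ext i
  have : g (x • u i) = 0 := (hgx _).2 ⟨_, rfl⟩
  simp only [Function.comp_apply, Pi.sub_apply, Pi.smul_apply, map_sub, this, sub_zero]

open TensorProduct in
theorem smulVec_baseChange [Finite m] {B : Type*} [CommRing B] [Algebra A B] (M : Matrix m n A)
    [DecidableEq m] [DecidableEq n] (t : B ⊗[A] (n → X)) :
    haveI := Fintype.ofFinite m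
    smulVec (B ⊗[A] X) (M.map (algebraMap A B)) (TensorProduct.piRight A B B (fun _ : n => X) t) =
      TensorProduct.piRight A B B (fun _ : m => X) ((smulVec X M).lTensor B t) := by
  induction t with
  | zero => simp
  | add x y hx hy => simp only [map_add, hx, hy]
  | tmul b v =>
    ext i
    simp [smulVec_apply, TensorProduct.tmul_sum]

open TensorProduct in
theorem matExact_baseChange_iff [Finite m] (B : Type*) [CommRing B] [Algebra A B]
    {M : Matrix m n A} {N : Matrix n p A} :
    MatExact (B ⊗[A] X) (M.map (algebraMap A B)) (N.map (algebraMap A B)) ↔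
      Function.Exact ((smulVec X N).lTensor B) ((smulVec X M).lTensor B) := by
  classical
  have := Fintype.ofFinite m
  refine (Function.Exact.iff_of_ladder_addEquiv
    (TensorProduct.piRight A B B (fun _ : p => X)).toAddEquiv
    (TensorProduct.piRight A B B (fun _ : n => X)).toAddEquiv
    (TensorProduct.piRight A B B (fun _ : m => X)).toAddEquiv
    (f₁₂ := ((smulVec X N).lTensor B).toAddMonoidHom)
    (f₂₃ := ((smulVec X M).lTensor B).toAddMonoidHom)
    (g₁₂ := (smulVec (B ⊗[A] X) (N.map (algebraMap A B))).toAddMonoidHom)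
    (g₂₃ := (smulVec (B ⊗[A] X) (M.map (algebraMap A B))).toAddMonoidHom) ?_ ?_)
  · exact DFunLike.ext _ _ fun t => smulVec_baseChange N t
  · exact DFunLike.ext _ _ fun t => smulVec_baseChange M t

open TensorProduct in
theorem MatExact.baseChange [Finite m] (B : Type*) [CommRing B] [Algebra A B] [Module.Flat A B]
    {M : Matrix m n A} {N : Matrix n p A} (h : MatExact X M N) :
    MatExact (B ⊗[A] X) (M.map (algebraMap A B)) (N.map (algebraMap A B)) :=
  (matExact_baseChange_iff B).2 (Module.Flat.lTensor_exact B h)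

open TensorProduct in
theorem matExact_faithfullyFlat_iff [Finite m] (B : Type*) [CommRing B] [Algebra A B]
    [Module.FaithfullyFlat A B] {M : Matrix m n A} {N : Matrix n p A} :
    MatExact (B ⊗[A] X) (M.map (algebraMap A B)) (N.map (algebraMap A B)) ↔ MatExact X M N :=
  (matExact_baseChange_iff B).trans (Module.FaithfullyFlat.lTensor_exact_iff_exact A B _ _)

end MatrixMaps

section Devissage

open TensorProduct IsLocalRing

variable {m n p : Type*} [Fintype n] [Fintype p]

/-- Nakayama's lemma for exactness modulo a regular element of the Jacobson radical. -/
theorem MatExact.of_quotient {A : Type*} [CommRing A] [IsNoetherianRing A] {X Y : Type*}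
    [AddCommGroup X] [Module A X] [Module.Finite A X] [AddCommGroup Y] [Module A Y]
    {M : Matrix m n A} {N : Matrix n p A} (hMN : M * N = 0)
    (x : A) (hx : x ∈ Ideal.jacobson (⊥ : Ideal A)) (hreg : IsSMulRegular X x)
    (g : X →ₗ[A] Y) (hg : Function.Surjective g)
    (hgx : ∀ v, g v = 0 ↔ ∃ w, x • w = v)
    (h : MatExact Y M N) : MatExact X M N := by
  rw [matExact_iff hMN] at h ⊢
  suffices LinearMap.ker (smulVec X M) ≤ LinearMap.range (smulVec X N) from
    fun v hv => this hv
  refine Submodule.le_of_le_smul_of_le_jacobson_bot (I := Ideal.span {x})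
    (IsNoetherian.noetherian _) ?_ ?_
  · rwa [Ideal.span_singleton_le_iff_mem]
  · intro v hv
    rw [LinearMap.mem_ker] at hv
    obtain ⟨w, hw⟩ := h (g ∘ v) (by rw [smulVec_comp, hv]; ext; simp)
    obtain ⟨w, rfl⟩ := hg.comp_left w
    rw [smulVec_comp] at hw
    have : ∀ i, ∃ z, x • z = (v - smulVec X N w) i := fun i => (hgx _).1 (by
      have := congrFun hw i
      simp only [Function.comp_apply] at this
      simp [this])
    choose z hz using this
    have hz : x • z = v - smulVec X N w := funext hz
    have hzk : smulVec X M z = 0 := by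
      have : x • smulVec X M z = x • 0 := by
        rw [← map_smul, hz, map_sub, hv, ← smulVec_mul, hMN, smulVec_zero, sub_zero, smul_zero]
      exact funext fun i => hreg (congrFun this i)
    rw [Submodule.mem_sup]
    refine ⟨smulVec X N w, ⟨w, rfl⟩, x • z, ?_, by rw [hz, add_sub_cancel]⟩
    exact Submodule.smul_mem_smul (Ideal.mem_span_singleton_self x) hzk

variable (R : Type u) [CommRing R] [IsLocalRing R] [IsNoetherianRing R]
  (U : Type*) [CommRing U] [Algebra R U] [Module.Flat R U]

theorem MatExact.tensor_of_shortExact {M : Matrix m n U} {N : Matrix n p U} (hMN : M * N = 0)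
    {Q Q' Q'' : Type*} [AddCommGroup Q] [Module R Q] [AddCommGroup Q'] [Module R Q']
    [AddCommGroup Q''] [Module R Q''] (f : Q' →ₗ[R] Q) (g : Q →ₗ[R] Q'')
    (hf : Function.Injective f) (hg : Function.Surjective g) (hfg : Function.Exact f g)
    (h' : MatExact (U ⊗[R] Q') M N) (h'' : MatExact (U ⊗[R] Q'') M N) :
    MatExact (U ⊗[R] Q) M N :=
  MatExact.of_shortExact (f.baseChange U) (g.baseChange U)
    (Module.Flat.lTensor_exact U hfg) (Module.Flat.lTensor_preserves_injective_linearMap f hf)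
    (LinearMap.lTensor_surjective U hg) hMN h' h''

variable [IsNoetherianRing U]
  (hU : ∀ r ∈ maximalIdeal R, algebraMap R U r ∈ Ideal.jacobson (⊥ : Ideal U))

include hU in
theorem MatExact.tensor_quotient {M : Matrix m n U} {N : Matrix n p U} (hMN : M * N = 0)
    (hk : MatExact (U ⊗[R] (R ⧸ maximalIdeal R)) M N) (I : Ideal R) :
    MatExact (U ⊗[R] (R ⧸ I)) M N := by
  induction I using IsNoetherian.induction with
  | hgt I ih =>
  rcases eq_or_ne I ⊤ with rfl | hI
  · have : Subsingleton (R ⧸ (⊤ : Ideal R)) := Ideal.Quotient.subsingleton_iff.2 rfl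
    exact matExact_of_subsingleton _ _
  rcases eq_or_ne I (maximalIdeal R) with rfl | hIm
  · exact hk
  obtain ⟨x, hxm, hxI⟩ := SetLike.exists_of_lt (lt_of_le_of_ne (le_maximalIdeal hI) hIm)
  let μ : R →ₗ[R] R ⧸ I := I.mkQ ∘ₗ LinearMap.mulLeft R x
  have hμ : ∀ r, μ r = 0 ↔ x * r ∈ I := fun r => Submodule.Quotient.mk_eq_zero I
  let J : Ideal R := LinearMap.ker μ
  have hIJ : I ≤ J := fun r hr => (hμ r).2 (Ideal.mul_mem_left I _ hr)
  let f : (R ⧸ J) →ₗ[R] R ⧸ I := J.liftQ μ le_rfl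
  have hf : Function.Injective f := LinearMap.ker_eq_bot.1 (Submodule.ker_liftQ_eq_bot _ _ _ le_rfl)
  let K : Ideal R := I ⊔ Ideal.span {x}
  have hIK : I < K := lt_of_le_of_ne le_sup_left fun h => hxI (by
    rw [h]; exact Ideal.mem_sup_right (Ideal.mem_span_singleton_self x))
  let g : (R ⧸ I) →ₗ[R] R ⧸ K := Submodule.factor hIK.le
  have hg : Function.Surjective g := Submodule.factor_surjective hIK.le
  have hfg : Function.Exact f g := by
    intro r
    obtain ⟨r, rfl⟩ := Submodule.mkQ_surjective _ r
    have h1 : g (I.mkQ r) = K.mkQ r := rfl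
    rw [h1, Submodule.mkQ_apply, Submodule.Quotient.mk_eq_zero, Submodule.mem_sup]
    constructor
    · rintro ⟨i, hi, z, hz, rfl⟩
      obtain ⟨a, rfl⟩ := Ideal.mem_span_singleton'.1 hz
      refine ⟨J.mkQ a, ?_⟩
      change I.mkQ (x * a) = _
      rw [eq_comm, Submodule.mkQ_apply, Submodule.mkQ_apply, Submodule.Quotient.eq]
      convert hi using 1; ring
    · rintro ⟨a, ha⟩
      obtain ⟨a, rfl⟩ := Submodule.mkQ_surjective _ a
      change I.mkQ (x * a) = _ at ha
      rw [eq_comm, Submodule.mkQ_apply, Submodule.mkQ_apply, Submodule.Quotient.eq] at ha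
      exact ⟨_, ha, x * a, Ideal.mem_span_singleton'.2 ⟨a, mul_comm _ _⟩, by ring⟩
  rcases hIJ.eq_or_lt with hJ | hJ
  · have h3 : ∀ a : U ⊗[R] (R ⧸ I),
        (LinearMap.lsmul R (R ⧸ I) x).lTensor U a = algebraMap R U x • a := fun a => by
      rw [algebraMap_smul]
      induction a with
      | zero => simp
      | add a b ha hb => rw [map_add, ha, hb, smul_add]
      | tmul a b => simp
    refine MatExact.of_quotient hMN (algebraMap R U x) (hU x hxm) ?_ (g.baseChange U)
      (LinearMap.lTensor_surjective U hg) ?_ (ih K hIK)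
    · have hinj : Function.Injective (LinearMap.lsmul R (R ⧸ I) x) := by
        rw [← LinearMap.ker_eq_bot, LinearMap.ker_eq_bot']
        intro r hr
        obtain ⟨r, rfl⟩ := Submodule.mkQ_surjective _ r
        have : r ∈ J := hr
        rw [← hJ] at this
        exact (Submodule.Quotient.mk_eq_zero _).2 this
      have h2 := Module.Flat.lTensor_preserves_injective_linearMap (M := U) _ hinj
      intro a b hab
      apply h2
      rw [h3, h3]; exact hab
    · have hex : Function.Exact (LinearMap.lsmul R (R ⧸ I) x) g := fun r => by
        rw [hfg r]
        constructor
        · rintro ⟨a, rfl⟩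
          obtain ⟨a, rfl⟩ := Submodule.mkQ_surjective _ a
          exact ⟨I.mkQ a, rfl⟩
        · rintro ⟨a, rfl⟩
          obtain ⟨a, rfl⟩ := Submodule.mkQ_surjective _ a
          exact ⟨J.mkQ a, rfl⟩
      intro v
      refine (Module.Flat.lTensor_exact U hex v).trans (exists_congr fun w => ?_)
      rw [h3]
  · exact MatExact.tensor_of_shortExact R U hMN f g hf hg hfg (ih J hJ) (ih K hIK)

include hU in
theorem MatExact.tensor_finite {M : Matrix m n U} {N : Matrix n p U} (hMN : M * N = 0)
    (hk : MatExact (U ⊗[R] (R ⧸ maximalIdeal R)) M N) (Q : Type u) [AddCommGroup Q] [Module R Q]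
    [hQ : Module.Finite R Q] : MatExact (U ⊗[R] Q) M N := by
  induction hQ using IsNoetherianRing.induction_on_isQuotientEquivQuotientPrime R with
  | subsingleton Q => 
    exact matExact_of_subsingleton _ _
  | quotient Q p e =>
    exact (MatExact.tensor_quotient R U hU hMN hk p.1).congr (e.symm.baseChange R U _ _)
  | exact Q' Q Q'' f g hf hg hfg h' h'' =>
    exact MatExact.tensor_of_shortExact R U hMN f g hf hg hfg h' h''

end Devissage

section MatrixComplex

open CategoryTheory

variable {A : Type u} [CommRing A]

/-- The chain complex obtained by letting a sequence of matrices act on a module on which the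
composites of consecutive matrices vanish. -/
noncomputable def matCpxOn (X : Type u) [AddCommGroup X] [Module A X] {ι : ℕ → Type}
    [∀ j, Fintype (ι j)] (M : ∀ j, Matrix (ι j) (ι (j + 1)) A)
    (hM : ∀ j v, smulVec X (M j) (smulVec X (M (j + 1)) v) = 0) :
    ChainComplex (ModuleCat.{u} A) ℕ :=
  ChainComplex.of (fun j => ModuleCat.of A (ι j → X)) (fun j => ModuleCat.ofHom (smulVec X (M j)))
    fun j => by
      ext1
      exact LinearMap.ext fun v => hM j v

theorem matCpxOn_d (X : Type u) [AddCommGroup X] [Module A X] {ι : ℕ → Type}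
    [∀ j, Fintype (ι j)] (M : ∀ j, Matrix (ι j) (ι (j + 1)) A)
    (hM : ∀ j v, smulVec X (M j) (smulVec X (M (j + 1)) v) = 0) (j : ℕ) :
    (matCpxOn X M hM).d (j + 1) j = ModuleCat.ofHom (smulVec X (M j)) :=
  ChainComplex.of_d (fun j => ModuleCat.of A (ι j → X))
    (fun j => ModuleCat.ofHom (smulVec X (M j))) j

theorem matCpxOn_d_hom (X : Type u) [AddCommGroup X] [Module A X] {ι : ℕ → Type}
    [∀ j, Fintype (ι j)] (M : ∀ j, Matrix (ι j) (ι (j + 1)) A)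
    (hM : ∀ j v, smulVec X (M j) (smulVec X (M (j + 1)) v) = 0) (j : ℕ) :
    ((matCpxOn X M hM).d (j + 1) j).hom = smulVec X (M j) := by
  rw [matCpxOn_d]; rfl

/-- The chain complex obtained by letting a complex of matrices act on a module. -/
noncomputable abbrev matCpx (X : Type u) [AddCommGroup X] [Module A X] {ι : ℕ → Type}
    [∀ j, Fintype (ι j)] (M : ∀ j, Matrix (ι j) (ι (j + 1)) A)
    (hM : ∀ j, M j * M (j + 1) = 0) : ChainComplex (ModuleCat.{u} A) ℕ :=
  matCpxOn X M fun j v => by rw [← smulVec_mul, hM, smulVec_zero]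

theorem exists_homology_proj_shortComplex (S : ShortComplex (ModuleCat.{u} A)) :
    ∃ π : LinearMap.ker S.g.hom →ₗ[A] S.homology, Function.Surjective π ∧
      ∀ z, π z = 0 ↔ ∃ w, S.f.hom w = z := by
  let f : S.moduleCatLeftHomologyData.H ≅ S.homology := S.moduleCatHomologyIso.symm
  let f' : (LinearMap.ker S.g.hom ⧸ LinearMap.range S.moduleCatToCycles) ≃ₗ[A] S.homology :=
    f.toLinearEquiv
  refine ⟨f'.toLinearMap ∘ₗ Submodule.mkQ _, ?_, fun z => ?_⟩
  · exact f'.surjective.comp (Submodule.mkQ_surjective _)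
  · rw [LinearMap.comp_apply, LinearEquiv.coe_coe, LinearEquiv.map_eq_zero_iff,
      Submodule.mkQ_apply, Submodule.Quotient.mk_eq_zero]
    exact exists_congr fun w => Subtype.ext_iff

/-- The homology of a chain complex of modules, as cycles modulo boundaries. -/
theorem exists_homology_proj (K : ChainComplex (ModuleCat.{u} A) ℕ) (j : ℕ) :
    ∃ π : LinearMap.ker (K.d (j + 1) j).hom →ₗ[A] K.homology (j + 1), Function.Surjective π ∧
      ∀ z, π z = 0 ↔ ∃ w, (K.d (j + 2) (j + 1)).hom w = z := by
  let e : (K.sc' (j + 2) (j + 1) j).homology ≅ K.homology (j + 1) :=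
    (ShortComplex.homologyMapIso (K.isoSc' (j + 2) (j + 1) j (by simp) (by simp))).symm
  obtain ⟨π, hπ, h⟩ := exists_homology_proj_shortComplex (K.sc' (j + 2) (j + 1) j)
  refine ⟨e.toLinearEquiv.toLinearMap ∘ₗ π, e.toLinearEquiv.surjective.comp hπ, fun z => ?_⟩
  exact (LinearEquiv.map_eq_zero_iff e.toLinearEquiv).trans (h z)

theorem subsingleton_homology_iff (K : ChainComplex (ModuleCat.{u} A) ℕ) (j : ℕ) :
    Subsingleton (K.homology (j + 1)) ↔
      Function.Exact (K.d (j + 2) (j + 1)).hom (K.d (j + 1) j).hom := by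
  obtain ⟨π, hπ, h⟩ := exists_homology_proj K j
  constructor
  · intro _ z
    refine ⟨fun hz => (h ⟨z, hz⟩).1 (Subsingleton.elim _ _), ?_⟩
    rintro ⟨w, rfl⟩
    rw [← LinearMap.comp_apply, ← ModuleCat.hom_comp, K.d_comp_d]; rfl
  · intro H
    refine subsingleton_of_forall_eq 0 fun y => ?_
    obtain ⟨z, rfl⟩ := hπ y
    exact (h z).2 ((H z).1 z.2)

theorem smul_homology_eq_zero_iff (K : ChainComplex (ModuleCat.{u} A) ℕ) (j : ℕ) (a : A) :
    (∀ x : K.homology (j + 1), a • x = 0) ↔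
      ∀ z, (K.d (j + 1) j).hom z = 0 → ∃ w, (K.d (j + 2) (j + 1)).hom w = a • z := by
  obtain ⟨π, hπ, h⟩ := exists_homology_proj K j
  constructor
  · intro H z hz
    exact (h (a • ⟨z, hz⟩)).1 (by rw [map_smul, H])
  · intro H x
    obtain ⟨z, rfl⟩ := hπ x
    rw [← map_smul, h]
    exact H z z.2

theorem finite_homology [IsNoetherianRing A] (K : ChainComplex (ModuleCat.{u} A) ℕ) (j : ℕ)
    [Module.Finite A (K.X (j + 1))] : Module.Finite A (K.homology (j + 1)) := by
  obtain ⟨π, hπ, -⟩ := exists_homology_proj K j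
  exact Module.Finite.of_surjective π hπ

theorem homology_les (S : ShortComplex (ChainComplex (ModuleCat.{u} A) ℕ)) (hS : S.ShortExact)
    (j : ℕ) : 
    Function.Exact (HomologicalComplex.homologyMap S.g (j + 1)).hom (hS.δ (j + 1) j rfl).hom ∧
    Function.Exact (hS.δ (j + 1) j rfl).hom (HomologicalComplex.homologyMap S.f j).hom ∧
    Function.Exact (HomologicalComplex.homologyMap S.f j).hom
      (HomologicalComplex.homologyMap S.g j).hom := by
  refine ⟨?_, ?_, ?_⟩
  · exact (ShortComplex.ShortExact.moduleCat_exact_iff_function_exact _).1 (hS.homology_exact₃ (j + 1) j rfl)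
  · exact (ShortComplex.ShortExact.moduleCat_exact_iff_function_exact _).1 (hS.homology_exact₁ (j + 1) j rfl)
  · exact (ShortComplex.ShortExact.moduleCat_exact_iff_function_exact _).1 (hS.homology_exact₂ j)

theorem homologyMap_smul_id (K : ChainComplex (ModuleCat.{u} A) ℕ) (j : ℕ) (a : A)
    (f : K ⟶ K) (hf : ∀ i x, (f.f i).hom x = a • x) (x : K.homology j) :
    (HomologicalComplex.homologyMap f j).hom x = a • x := by
  have : f = a • 𝟙 K := by
    ext i x
    exact hf i x
  rw [this]
  have h2 := ShortComplex.homologyMap_smul (𝟙 (K.sc j)) a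
  rw [ShortComplex.homologyMap_id] at h2
  exact congrArg (fun g => ModuleCat.Hom.hom g x) h2

end MatrixComplex

section MatrixComplexMaps

open CategoryTheory

variable {A : Type u} [CommRing A] {ι : ℕ → Type} [∀ j, Fintype (ι j)]
  (M : ∀ j, Matrix (ι j) (ι (j + 1)) A) (hM : ∀ j, M j * M (j + 1) = 0)

/-- The chain map induced by a linear map of coefficients. -/
noncomputable def matCpxMap {X Y : Type u} [AddCommGroup X] [Module A X] [AddCommGroup Y]
    [Module A Y] (f : X →ₗ[A] Y) : matCpx X M hM ⟶ matCpx Y M hM where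
  f j := ModuleCat.ofHom (f.compLeft (ι j))
  comm' i j hij := by
    obtain rfl : j + 1 = i := hij
    rw [matCpxOn_d, matCpxOn_d]
    ext1
    exact LinearMap.ext fun v => smulVec_comp f (M j) v

/-- Matrix homology with coefficients in `X`. -/
noncomputable abbrev matHom (X : Type u) [AddCommGroup X] [Module A X] (j : ℕ) : ModuleCat.{u} A :=
  (matCpx X M hM).homology j

theorem matHom_subsingleton_iff (X : Type u) [AddCommGroup X] [Module A X] (j : ℕ) :
    Subsingleton (matHom M hM X (j + 1)) ↔ MatExact X (M j) (M (j + 1)) := by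
  rw [subsingleton_homology_iff, matCpxOn_d_hom, matCpxOn_d_hom]; rfl

theorem matHom_finite [IsNoetherianRing A] (X : Type u) [AddCommGroup X] [Module A X]
    [Module.Finite A X] (j : ℕ) : Module.Finite A (matHom M hM X (j + 1)) := by
  have : Module.Finite A ((matCpx X M hM).X (j + 1)) :=
    inferInstanceAs (Module.Finite A (ι (j + 1) → X))
  exact finite_homology _ _

theorem exists_les_smul {W Y : Type u} [AddCommGroup W] [Module A W] [AddCommGroup Y]
    [Module A Y] (a : A) (ha : IsSMulRegular W a) (g : W →ₗ[A] Y) (hg : Function.Surjective g)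
    (hgx : ∀ v, g v = 0 ↔ ∃ w, a • w = v) :
    ∃ (p : ∀ j, matHom M hM W j →ₗ[A] matHom M hM Y j)
      (q : ∀ j, matHom M hM Y (j + 1) →ₗ[A] matHom M hM W j),
      (∀ j x, p j x = 0 ↔ ∃ y, a • y = x) ∧ (∀ j, Function.Exact (p (j + 1)) (q j)) ∧
      (∀ j x, a • x = 0 ↔ ∃ y, q j y = x) := by
  let f : W →ₗ[A] W := LinearMap.lsmul A W a
  let S : ShortComplex (ChainComplex (ModuleCat.{u} A) ℕ) :=
    ShortComplex.mk (matCpxMap M hM f) (matCpxMap M hM g) (by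
      ext j x
      exact funext fun i => (hgx _).2 ⟨_, rfl⟩)
  have hS : S.ShortExact := by
    refine HomologicalComplex.shortExact_of_degreewise_shortExact S fun j => ?_
    refine ModuleCat.shortComplex_shortExact _ ?_ ?_ ?_
    · intro v
      change g.compLeft (ι j) v = 0 ↔ ∃ w, f.compLeft (ι j) w = v
      constructor
      · intro hv
        choose w hw using fun i => (hgx (v i)).1 (congrFun hv i)
        exact ⟨w, funext hw⟩
      · rintro ⟨w, rfl⟩
        exact funext fun i => (hgx _).2 ⟨_, rfl⟩
    · exact Function.Injective.comp_left (g := f) ha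
    · exact Function.Surjective.comp_left hg
  have hf : ∀ j x, (HomologicalComplex.homologyMap S.f j).hom x = a • x := fun j x =>
    homologyMap_smul_id _ j a (matCpxMap M hM f) (fun i x => rfl) x
  refine ⟨fun j => (HomologicalComplex.homologyMap S.g j).hom,
    fun j => (hS.δ (j + 1) j rfl).hom, fun j x => ?_, fun j => ?_, fun j x => ?_⟩
  · refine ((homology_les S hS j).2.2 x).trans (exists_congr fun y => ?_)
    rw [hf]
  · exact (homology_les S hS j).1
  · rw [← hf]
    exact (homology_les S hS j).2.1 x

end MatrixComplexMaps

section Torsion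

variable {A : Type u} [CommRing A]

/-- Coset prime avoidance. -/
theorem exists_add_notMem_primes (s : Finset (Ideal A)) (hs : ∀ P ∈ s, P.IsPrime) (y : A)
    (I : Ideal A) (h : ∀ P ∈ s, y ∈ P → ¬ I ≤ P) : ∃ c ∈ I, ∀ P ∈ s, y + c ∉ P := by
  classical
  induction s using Finset.strongInduction with
  | H s ih =>
  rcases s.eq_empty_or_nonempty with rfl | hne
  · exact ⟨0, I.zero_mem, by simp⟩
  obtain ⟨P, hmin⟩ := s.exists_minimal hne
  have hP : P ∈ s := hmin.1
  obtain ⟨c, hc, hc'⟩ := ih (s.erase P) (Finset.erase_ssubset hP)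
    (fun Q hQ => hs Q (Finset.mem_of_mem_erase hQ)) (fun Q hQ => h Q (Finset.mem_of_mem_erase hQ))
  by_cases hcP : y + c ∈ P
  swap
  · refine ⟨c, hc, fun Q hQ => ?_⟩
    by_cases hQP : Q = P
    · rwa [hQP]
    · exact hc' Q (Finset.mem_erase.2 ⟨hQP, hQ⟩)
  have hprime := hs P hP
  have hIP : ¬ I ≤ P := fun hI => h P hP ((P.add_mem_iff_left (hI hc)).1 hcP) hI
  have hprod : ¬ (I * ∏ Q ∈ s.erase P, Q) ≤ P := by
    rw [hprime.mul_le, hprime.prod_le]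
    rintro (h1 | ⟨Q, hQ, h1⟩)
    · exact hIP h1
    · exact (Finset.mem_erase.1 hQ).1 (h1.antisymm (hmin.le_of_le (Finset.mem_of_mem_erase hQ) h1))
  obtain ⟨z, hz, hzP⟩ := SetLike.not_le_iff_exists.1 hprod
  have hz1 : z ∈ I := (Ideal.mul_le_inf hz).1
  have hz2 : z ∈ ∏ Q ∈ s.erase P, Q := (Ideal.mul_le_inf hz).2
  refine ⟨c + z, I.add_mem hc hz1, fun Q hQ hmem => ?_⟩
  rw [← add_assoc] at hmem
  by_cases hQP : Q = P
  · subst hQP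
    exact hzP ((Q.add_mem_iff_right hcP).1 hmem)
  · have hQ' := Finset.mem_erase.2 ⟨hQP, hQ⟩
    have hle : ∏ Q ∈ s.erase P, Q ≤ Q := Ideal.prod_le_inf.trans (Finset.inf_le (f := id) hQ')
    have hzQ : z ∈ Q := hle hz2
    exact hc' Q hQ' ((Q.add_mem_iff_left hzQ).1 hmem)

variable {H K : Type*} [AddCommGroup H] [Module A H] [AddCommGroup K] [Module A K]

/-- The submodule of elements killed by a power of each element of `I`. -/
def powTorsion (I : Ideal A) (H : Type*) [AddCommGroup H] [Module A H] : Submodule A H where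
  carrier := {x | ∀ a ∈ I, ∃ n, a ^ n • x = 0}
  zero_mem' a _ := ⟨0, smul_zero _⟩
  add_mem' {x y} hx hy a ha := by
    obtain ⟨n, hn⟩ := hx a ha
    obtain ⟨k, hk⟩ := hy a ha
    refine ⟨n + k, ?_⟩
    rw [smul_add, pow_add, mul_smul _ _ y, hk, mul_comm, mul_smul, hn, smul_zero, smul_zero,
      add_zero]
  smul_mem' c x hx a ha := by
    obtain ⟨n, hn⟩ := hx a ha
    exact ⟨n, by rw [smul_comm, hn, smul_zero]⟩

theorem powTorsion_mono {I J : Ideal A} (h : I ≤ J) : powTorsion J H ≤ powTorsion I H :=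
  fun _ hx a ha => hx a (h ha)

theorem map_mem_powTorsion {I : Ideal A} (f : H →ₗ[A] K) {x : H} (hx : x ∈ powTorsion I H) :
    f x ∈ powTorsion I K := fun a ha => by
  obtain ⟨n, hn⟩ := hx a ha
  exact ⟨n, by rw [← map_smul, hn, map_zero]⟩

theorem mem_powTorsion_of_injective {I : Ideal A} (f : H →ₗ[A] K) (hf : Function.Injective f)
    {x : H} (hx : f x ∈ powTorsion I K) : x ∈ powTorsion I H := fun a ha => by
  obtain ⟨n, hn⟩ := hx a ha
  exact ⟨n, hf (by rw [map_smul, hn, map_zero])⟩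

theorem mem_powTorsion_of_exact {L : Type*} [AddCommGroup L] [Module A L] {I : Ideal A}
    {f : H →ₗ[A] K} {g : K →ₗ[A] L} (hfg : Function.Exact f g) (hf : powTorsion I H = ⊤)
    {x : K} (hx : g x ∈ powTorsion I L) : x ∈ powTorsion I K := fun a ha => by
  obtain ⟨n, hn⟩ := hx a ha
  obtain ⟨z, hz⟩ := (hfg (a ^ n • x)).1 (by rw [map_smul, hn])
  obtain ⟨k, hk⟩ := (hf ▸ Submodule.mem_top : z ∈ powTorsion I H) a ha
  exact ⟨k + n, by rw [pow_add, mul_smul, ← hz, ← map_smul, hk, map_zero]⟩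

theorem mem_powTorsion_of_smul {I : Ideal A} {x : H}
    (h : ∀ a ∈ I, ∃ n, a ^ n • x ∈ powTorsion I H) : x ∈ powTorsion I H := fun a ha => by
  obtain ⟨n, hn⟩ := h a ha
  obtain ⟨k, hk⟩ := hn a ha
  exact ⟨k + n, by rw [pow_add, mul_smul, hk]⟩

/-- Uniform exponents for finitely generated modules. -/
theorem exists_uniform_pow [Module.Finite A H] (N : Submodule A H) (a : A)
    (h : ∀ x : H, ∃ n, a ^ n • x ∈ N) : ∃ n, ∀ x : H, a ^ n • x ∈ N := by
  classical
  obtain ⟨s, hs⟩ := Module.Finite.fg_top (R := A) (M := H)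
  choose f hf using h
  refine ⟨s.sup f, fun x => ?_⟩
  have hx : x ∈ Submodule.span A (s : Set H) := hs ▸ Submodule.mem_top
  induction hx using Submodule.span_induction with
  | mem x hx =>
    obtain ⟨k, hk⟩ := Nat.exists_eq_add_of_le (Finset.le_sup (f := f) hx)
    rw [hk, add_comm, pow_add, mul_smul]
    exact N.smul_mem _ (hf x)
  | zero => simp
  | add x y _ _ hx hy => rw [smul_add]; exact N.add_mem hx hy
  | smul b x _ hx => rw [smul_comm]; exact N.smul_mem _ hx

theorem mem_powTorsion_of_smul_eq_zero [IsNoetherianRing A] {I : Ideal A} {a : A}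
    (ha : ∀ P ∈ associatedPrimes A H, a ∈ P → I ≤ P) {x : H} (hx : a • x = 0) :
    x ∈ powTorsion I H := by
  intro b hb
  let S : Submodule A H := Submodule.span A {x}
  have hann : b ∈ (Module.annihilator A S).radical := by
    rw [Ideal.radical_eq_sInf, Ideal.mem_sInf]
    rintro J ⟨hJ, hJp⟩
    obtain ⟨P, hP, hPJ⟩ := Ideal.exists_minimalPrimes_le hJ
    refine hPJ (ha P ?_ ?_ hb)
    · refine associatedPrimes.subset_of_injective (f := S.subtype) S.injective_subtype ?_
      exact Module.associatedPrimes.minimalPrimes_annihilator_subset_associatedPrimes A S hP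
    · refine hP.1.2 (Module.mem_annihilator.2 ?_)
      rintro ⟨m, hm⟩
      obtain ⟨c, rfl⟩ := Submodule.mem_span_singleton.1 hm
      exact Subtype.ext (by simp [smul_comm a c, hx])
  obtain ⟨n, hn⟩ := hann
  refine ⟨n, ?_⟩
  have := Module.mem_annihilator.1 hn ⟨x, Submodule.mem_span_singleton_self x⟩
  exact congrArg Subtype.val this

end Torsion

section FiniteLength

open IsLocalRing

variable {A : Type u} [CommRing A] [IsLocalRing A] [IsNoetherianRing A]

theorem length_ne_top_of_powTorsion (H : Type u) [AddCommGroup H] [Module A H]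
    [hfin : Module.Finite A H] (h : powTorsion (maximalIdeal A) H = ⊤) :
    Module.length A H ≠ ⊤ := by
  induction hfin using IsNoetherianRing.induction_on_isQuotientEquivQuotientPrime A with
  | subsingleton Q => rw [Module.length_eq_zero]; exact ENat.zero_ne_top
  | quotient Q p e =>
    have h1 : (maximalIdeal A) ≤ p.1 := fun a ha => by
      obtain ⟨n, hn⟩ := (h ▸ Submodule.mem_top :
        e.symm (Ideal.Quotient.mk p.1 1) ∈ powTorsion (maximalIdeal A) Q) a ha
      rw [← map_smul, LinearEquiv.map_eq_zero_iff] at hn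
      have : Ideal.Quotient.mk p.1 (a ^ n) = 0 := by
        rw [← hn, Algebra.smul_def, map_one, mul_one]; rfl
      exact p.2.mem_of_pow_mem n (Ideal.Quotient.eq_zero_iff_mem.1 this)
    have h2 : p.1 = maximalIdeal A := (eq_maximalIdeal
      ((maximalIdeal.isMaximal A).eq_of_le p.2.ne_top h1 ▸ maximalIdeal.isMaximal A))
    have : IsSimpleModule A (A ⧸ p.1) := by
      rw [h2]; exact isSimpleModule_iff_isCoatom.2 (maximalIdeal.isMaximal A).out
    rw [e.length_eq, Module.length_eq_one]
    exact ENat.natCast_ne_top 1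
  | exact Q' Q Q'' f g hf hg hfg h' h'' =>
    rw [Module.length_eq_add_of_exact f g hf hg hfg]
    refine WithTop.add_ne_top.2 ⟨h' ?_, h'' ?_⟩
    · exact eq_top_iff.2 fun x _ => mem_powTorsion_of_injective f hf (h ▸ Submodule.mem_top)
    · refine eq_top_iff.2 fun x _ => ?_
      obtain ⟨x, rfl⟩ := hg x
      exact map_mem_powTorsion g (h ▸ Submodule.mem_top)

/-- The length of a module as a natural number. -/
noncomputable def natLength (A : Type*) [CommRing A] (H : Type*) [AddCommGroup H] [Module A H] : ℕ :=
  (Module.length A H).toNat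

theorem natLength_eq_ker_add_range {H K : Type*} [AddCommGroup H] [Module A H] [AddCommGroup K]
    [Module A K] (f : H →ₗ[A] K) (hH : Module.length A H ≠ ⊤) :
    natLength A H = natLength A (LinearMap.ker f) + natLength A (LinearMap.range f) := by
  have := Module.length_eq_add_of_exact (LinearMap.ker f).subtype f.rangeRestrict
    (Submodule.injective_subtype _) f.surjective_rangeRestrict (fun x => by
      simp [LinearMap.rangeRestrict, Subtype.ext_iff])
  rw [this] at hH
  obtain ⟨h1, h2⟩ := WithTop.add_ne_top.1 hH
  rw [natLength, this, ENat.toNat_add h1 h2]; rfl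

theorem natLength_eq_zero_iff {H : Type*} [AddCommGroup H] [Module A H] 
    (hH : Module.length A H ≠ ⊤) : natLength A H = 0 ↔ Subsingleton H := by
  rw [natLength, ENat.toNat_eq_zero, Module.length_eq_zero_iff]
  simp [hH]

end FiniteLength

section Core

open IsLocalRing RingTheory.Sequence Pointwise

variable {A : Type u} [CommRing A] [IsLocalRing A] [IsNoetherianRing A]

theorem exists_isWeaklyRegular_avoiding {W : Type u} [AddCommGroup W] [Module A W]
    [Module.Finite A W] (y : A) (ys : List A) (hm : ∀ a ∈ y :: ys, a ∈ maximalIdeal A)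
    (hreg : IsWeaklyRegular W (y :: ys)) (s : Finset (Ideal A)) (hs : ∀ P ∈ s, P.IsPrime) :
    ∃ a ∈ maximalIdeal A, Ideal.ofList (a :: ys) = Ideal.ofList (y :: ys) ∧
      IsWeaklyRegular W (a :: ys) ∧ ∀ P ∈ s, a ∈ P → Ideal.ofList (y :: ys) ≤ P := by
  classical
  obtain ⟨c, hc, hcP⟩ := exists_add_notMem_primes (s.filter fun P => ¬ Ideal.ofList (y :: ys) ≤ P)
    (fun P hP => hs P (Finset.mem_filter.1 hP).1) y (Ideal.ofList ys) (fun P hP hy hI =>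
      (Finset.mem_filter.1 hP).2 (by
        rw [Ideal.ofList_cons, sup_le_iff, Ideal.span_singleton_le_iff_mem]
        exact ⟨hy, hI⟩))
  have hym : y ∈ maximalIdeal A := hm y (by simp)
  have hysm : ∀ a ∈ ys, a ∈ maximalIdeal A := fun a ha => hm a (by simp [ha])
  have hcm : c ∈ maximalIdeal A := (Ideal.span_le.2 hysm : Ideal.ofList ys ≤ _) hc
  have ham : y + c ∈ maximalIdeal A := Ideal.add_mem _ hym hcm
  refine ⟨y + c, ham, ?_, ?_, fun P hP ha => ?_⟩
  · rw [Ideal.ofList_cons, Ideal.ofList_cons]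
    refine le_antisymm (sup_le ?_ le_sup_right) (sup_le ?_ le_sup_right)
    · rw [Ideal.span_singleton_le_iff_mem]
      exact Ideal.add_mem _ (Ideal.mem_sup_left (Ideal.mem_span_singleton_self y))
        (Ideal.mem_sup_right hc)
    · rw [Ideal.span_singleton_le_iff_mem]
      have h := Ideal.sub_mem (Ideal.span {y + c} ⊔ Ideal.ofList ys)
        (Ideal.mem_sup_left (Ideal.mem_span_singleton_self _)) (Ideal.mem_sup_right hc)
      rwa [add_sub_cancel_right] at h
  · have h1 : IsWeaklyRegular W (ys ++ [y]) :=
      IsLocalRing.isWeaklyRegular_of_perm_of_subset_maximalIdeal hreg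
        (List.perm_append_singleton y ys).symm hm
    rw [isWeaklyRegular_append_iff, isWeaklyRegular_singleton_iff] at h1
    have h2 : IsWeaklyRegular W (ys ++ [y + c]) := by
      rw [isWeaklyRegular_append_iff, isWeaklyRegular_singleton_iff]
      refine ⟨h1.1, ?_⟩
      have : ∀ x : W ⧸ (Ideal.ofList ys • ⊤ : Submodule A W), (y + c) • x = y • x := by
        intro x
        obtain ⟨x, rfl⟩ := Submodule.mkQ_surjective _ x
        have hz : c • Submodule.mkQ (Ideal.ofList ys • ⊤ : Submodule A W) x = 0 := by
          rw [← map_smul]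
          exact (Submodule.Quotient.mk_eq_zero _).2 (Submodule.smul_mem_smul hc trivial)
        rw [add_smul, hz, add_zero]
      intro x x' hx
      have hx' : (y + c) • x = (y + c) • x' := hx
      rw [this, this] at hx'
      exact h1.2 hx'
    refine IsLocalRing.isWeaklyRegular_of_perm_of_subset_maximalIdeal h2
        (List.perm_append_singleton _ ys) ?_
    intro a ha
    rcases List.mem_append.1 ha with h | h
    · exact hysm a h
    · rw [List.mem_singleton.1 h]; exact ham
  · by_contra hn
    exact hcP P (Finset.mem_filter.2 ⟨hP, hn⟩) ha

theorem sum_telescope (b : ℕ → ℤ) (J : ℕ) :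
    ∑ i ∈ Finset.range J, (-1) ^ i * (b (i + 1) + b i) = b 0 - (-1) ^ J * b J := by
  induction J with
  | zero => simp
  | succ J ih => rw [Finset.sum_range_succ, ih, pow_succ]; ring

variable {ι : ℕ → Type} [∀ j, Fintype (ι j)]
  (M : ∀ j, Matrix (ι j) (ι (j + 1)) A) (hM : ∀ j, M j * M (j + 1) = 0)

/-- The alternating sum of the lengths of the homology modules in degrees at least two. -/
noncomputable def partialEuler (X : Type u) [AddCommGroup X] [Module A X] (J : ℕ) : ℤ :=
  ∑ i ∈ Finset.range J, (-1) ^ i * (natLength A (matHom M hM X (i + 2)) : ℤ)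

theorem partialEuler_single {W X : Type u} [AddCommGroup W] [Module A W] [Module.Finite A W]
    [AddCommGroup X] [Module A X] [Module.Finite A X]
    (y : A) (hreg : IsSMulRegular W y) (g : W →ₗ[A] X)
    (hg : Function.Surjective g) (hgx : ∀ v, g v = 0 ↔ ∃ w, y • w = v)
    (htors : ∀ i, powTorsion (Ideal.span {y}) (matHom M hM W (i + 2)) = ⊤)
    (hfin : ∀ i, powTorsion (maximalIdeal A) (matHom M hM X (i + 2)) = ⊤)
    (J : ℕ) (hJ : ∀ i ≥ J, Subsingleton (matHom M hM X (i + 2))) :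
    0 ≤ partialEuler M hM X J ∧ (partialEuler M hM X J ≤ 0 →
      powTorsion (Ideal.span {y}) (matHom M hM W 1) = ⊥ ∧
      ((∀ i, Subsingleton (matHom M hM W (i + 2))) →
        ∀ i, Subsingleton (matHom M hM X (i + 2)))) := by
  obtain ⟨p, q, hp, hpq, hq⟩ := exists_les_smul M hM y hreg g hg hgx
  have hWf : ∀ j, Module.Finite A (matHom M hM W (j + 1)) := fun j => matHom_finite M hM W j
  have hXf : ∀ j, Module.Finite A (matHom M hM X (j + 1)) := fun j => matHom_finite M hM X j
  have hXl : ∀ i, Module.length A (matHom M hM X (i + 2)) ≠ ⊤ := fun i =>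
    length_ne_top_of_powTorsion _ (hfin i)
  have hWfin : ∀ i, powTorsion (maximalIdeal A) (matHom M hM W (i + 2)) = ⊤ := by
    intro i
    refine eq_top_iff.2 fun x _ a ha => ?_
    obtain ⟨n, hn⟩ := exists_uniform_pow (H := matHom M hM W (i + 2)) (⊥ : Submodule A _) y
      (fun x => (htors i ▸ Submodule.mem_top : x ∈ powTorsion (Ideal.span {y}) _) y
        (Ideal.mem_span_singleton_self y))
    obtain ⟨k, hk⟩ := exists_uniform_pow (LinearMap.ker (p (i + 2))) a (fun x => by
      obtain ⟨n, hn⟩ := (hfin i ▸ Submodule.mem_top : p (i + 2) x ∈ powTorsion (maximalIdeal A) _) a ha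
      exact ⟨n, by rw [LinearMap.mem_ker, map_smul, hn]⟩)
    have : ∀ l x, ∃ z : matHom M hM W (i + 2), (a ^ k) ^ l • x = y ^ l • z := by
      intro l
      induction l with
      | zero => intro x; exact ⟨x, by simp⟩
      | succ l ih =>
        intro x
        obtain ⟨z, hz⟩ := ih x
        obtain ⟨w, hw⟩ := (hp _ _).1 (hk z)
        exact ⟨w, by rw [pow_succ', mul_smul, hz, smul_comm, ← hw, ← mul_smul, pow_succ]⟩
    obtain ⟨z, hz⟩ := this n x
    refine ⟨k * n, ?_⟩
    rw [pow_mul, hz]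
    exact hn z
  have hWl : ∀ i, Module.length A (matHom M hM W (i + 2)) ≠ ⊤ := fun i =>
    length_ne_top_of_powTorsion _ (hWfin i)
  let b : ℕ → ℕ := fun i => natLength A (LinearMap.ker (LinearMap.lsmul A (matHom M hM W (i + 1)) y))
  have hrange : ∀ j, LinearMap.range (q j) = LinearMap.ker (LinearMap.lsmul A (matHom M hM W j) y) := by
    intro j; ext x
    exact (hq j x).symm
  have hlen : ∀ i, natLength A (matHom M hM X (i + 2)) = b (i + 1) + b i := by
    intro i
    rw [natLength_eq_ker_add_range (q (i + 1)) (hXl i), hrange]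
    congr 1
    have h1 := natLength_eq_ker_add_range (p (i + 2)) (hWl i)
    have h2 := natLength_eq_ker_add_range (LinearMap.lsmul A (matHom M hM W (i + 2)) y) (hWl i)
    have h3 : LinearMap.ker (p (i + 2)) = LinearMap.range (LinearMap.lsmul A (matHom M hM W (i + 2)) y) := by
      ext x; exact hp (i + 2) x
    have h4 : LinearMap.ker (q (i + 1)) = LinearMap.range (p (i + 2)) := by
      ext x; exact hpq (i + 1) x
    rw [h4]
    rw [h3] at h1
    change _ = natLength A (LinearMap.ker (LinearMap.lsmul A (matHom M hM W (i + 2)) y))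
    exact Nat.add_left_cancel (h1.symm.trans (h2.trans (add_comm _ _)))
  have hbJ : b J = 0 := by
    have := hJ J le_rfl
    have := hlen J
    rw [(natLength_eq_zero_iff (hXl J)).2 (hJ J le_rfl)] at this
    omega
  have hchi : partialEuler M hM X J = b 0 := by
    unfold partialEuler
    rw [← sub_zero (b 0 : ℤ)]
    have := sum_telescope (fun i => (b i : ℤ)) J
    rw [hbJ] at this
    simp only [hlen]
    push_cast at this ⊢
    rw [this]; simp
  rw [hchi]
  refine ⟨by positivity, fun h0 => ?_⟩
  have hb0 : b 0 = 0 := by omega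
  have hker0 : LinearMap.ker (LinearMap.lsmul A (matHom M hM W 1) y) = ⊥ := by
    have hl : Module.length A (LinearMap.range (q 1)) ≠ ⊤ := by
      have h := Module.length_le_of_surjective (q 1).rangeRestrict (q 1).surjective_rangeRestrict
      exact ne_top_of_le_ne_top (hXl 0) h
    rw [hrange] at hl
    exact (Submodule.subsingleton_iff_eq_bot).1 ((natLength_eq_zero_iff hl).1 hb0)
  refine ⟨?_, fun hsub i => ?_⟩
  · refine eq_bot_iff.2 fun x hx => ?_
    obtain ⟨n, hn⟩ := hx y (Ideal.mem_span_singleton_self y)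
    rw [Submodule.mem_bot]
    induction n with
    | zero => simpa using hn
    | succ n ih =>
      refine ih ?_
      rw [pow_succ', mul_smul] at hn
      have : y ^ n • x ∈ LinearMap.ker (LinearMap.lsmul A (matHom M hM W 1) y) := hn
      rwa [hker0] at this
  · rw [← natLength_eq_zero_iff (hXl i), hlen]
    have hb : ∀ i, b (i + 1) = 0 := fun i => by
      have := hsub i
      have hl : Module.length A (LinearMap.ker (LinearMap.lsmul A (matHom M hM W (i + 2)) y)) ≠ ⊤ := by
        rw [Module.length_eq_zero]; exact ENat.zero_ne_top
      exact (natLength_eq_zero_iff hl).2 inferInstance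
    rw [hb, zero_add]
    rcases i with _ | i
    · exact hb0
    · exact hb i

end Core

section CoreInduction

open IsLocalRing RingTheory.Sequence Pointwise

variable {A : Type u} [CommRing A] [IsLocalRing A] [IsNoetherianRing A]

variable {ι : ℕ → Type} [∀ j, Fintype (ι j)]
  (M : ∀ j, Matrix (ι j) (ι (j + 1)) A) (hM : ∀ j, M j * M (j + 1) = 0)

/-- Nonnegativity of the second partial Euler characteristic modulo a regular sequence, and the
consequences of its vanishing. -/
theorem partialEuler_nonneg {X : Type u} [AddCommGroup X] [Module A X] [Module.Finite A X]
    (hfin : ∀ i, powTorsion (maximalIdeal A) (matHom M hM X (i + 2)) = ⊤)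
    (J : ℕ) (hJ : ∀ i ≥ J, Subsingleton (matHom M hM X (i + 2))) (ys : List A) :
    ∀ (y : A) (W : Type u) [AddCommGroup W] [Module A W] [Module.Finite A W]
    (_ : ∀ a ∈ y :: ys, a ∈ maximalIdeal A) (_ : IsWeaklyRegular W (y :: ys)) (g : W →ₗ[A] X)
    (_ : Function.Surjective g) (_ : LinearMap.ker g = Ideal.ofList (y :: ys) • ⊤)
    (_ : ∀ i, powTorsion (Ideal.ofList (y :: ys)) (matHom M hM W (i + 2)) = ⊤),
    0 ≤ partialEuler M hM X J ∧ (partialEuler M hM X J ≤ 0 →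
      powTorsion (Ideal.ofList (y :: ys)) (matHom M hM W 1) = ⊥ ∧
      ((∀ i, Subsingleton (matHom M hM W (i + 2))) →
        ∀ i, Subsingleton (matHom M hM X (i + 2)))) := by
  induction ys with
  | nil =>
    intro y W _ _ _ hm hreg g hg hgx htors
    rw [Ideal.ofList_singleton] at *
    refine partialEuler_single M hM y ((isWeaklyRegular_singleton_iff W y).1 hreg) g hg
      (fun v => ?_) htors hfin J hJ
    rw [← LinearMap.mem_ker, hgx, Submodule.ideal_span_singleton_smul,
      Submodule.mem_smul_pointwise_iff_exists]
    simp
  | cons y' ys ih =>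
    intro y W _ _ _ hm hreg g hg hgx htors
    have hWf : ∀ j, Module.Finite A (matHom M hM W (j + 1)) := fun j => matHom_finite M hM W j
    have hass : (associatedPrimes A (matHom M hM W 1)).Finite :=
      have := hWf 0
      associatedPrimes.finite A _
    obtain ⟨a, ham, hay, hareg, haP⟩ := exists_isWeaklyRegular_avoiding y (y' :: ys) hm hreg
      hass.toFinset (fun P hP => (hass.mem_toFinset.1 hP).isPrime)
    rw [← hay] at hgx htors haP ⊢
    rw [isWeaklyRegular_cons_iff] at hareg
    let π : W →ₗ[A] QuotSMulTop a W := Submodule.mkQ _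
    have hπ : Function.Surjective π := Submodule.mkQ_surjective _
    have hπk : ∀ v, π v = 0 ↔ ∃ w, a • w = v := fun v => by
      rw [← LinearMap.mem_ker, Submodule.ker_mkQ, Submodule.mem_smul_pointwise_iff_exists]
      simp
    have hle : a • (⊤ : Submodule A W) ≤ LinearMap.ker g := by
      rw [hgx, Ideal.ofList_cons_smul]
      exact le_sup_left
    let g' : QuotSMulTop a W →ₗ[A] X := Submodule.liftQ _ g hle
    have hg' : Function.Surjective g' := fun x => by
      obtain ⟨w, rfl⟩ := hg x
      exact ⟨π w, rfl⟩
    have hker : LinearMap.ker g' = Ideal.ofList (y' :: ys) • ⊤ := by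
      rw [Submodule.ker_liftQ, hgx, Ideal.ofList_cons_smul, Submodule.map_sup, Submodule.map_smul'',
        Submodule.map_top, Submodule.range_mkQ]
      refine sup_eq_right.2 ?_
      rintro _ ⟨w, hw, rfl⟩
      have : (Submodule.mkQ (a • (⊤ : Submodule A W))) w = 0 :=
        (Submodule.Quotient.mk_eq_zero _).2 hw
      rw [this]; exact zero_mem _
    obtain ⟨p, q, hp, hpq, hq⟩ := exists_les_smul M hM a hareg.1 π hπ hπk
    have hI : Ideal.ofList (y' :: ys) ≤ Ideal.ofList (a :: y' :: ys) := by
      rw [Ideal.ofList_cons a]; exact le_sup_right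
    have haI : a ∈ Ideal.ofList (a :: y' :: ys) := by
      rw [Ideal.ofList_cons a]
      exact Ideal.mem_sup_left (Ideal.mem_span_singleton_self a)
    have hker1 : ∀ x : matHom M hM W 1, a • x = 0 →
        x ∈ powTorsion (Ideal.ofList (a :: y' :: ys)) (matHom M hM W 1) := fun x hx =>
      mem_powTorsion_of_smul_eq_zero (fun P hP => haP P (hass.mem_toFinset.2 hP)) hx
    have hpt : ∀ i x, q (i + 1) x ∈ powTorsion (Ideal.ofList (a :: y' :: ys)) (matHom M hM W (i + 1)) := by
      rintro (_ | i) x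
      · exact hker1 _ ((hq _ _).2 ⟨x, rfl⟩)
      · rw [htors]; trivial
    have htors' : ∀ i, powTorsion (Ideal.ofList (y' :: ys))
        (matHom M hM (QuotSMulTop a W) (i + 2)) = ⊤ := fun i =>
      eq_top_iff.2 fun x _ => powTorsion_mono hI
        (mem_powTorsion_of_exact (hpq (i + 1)) (htors i) (hpt i x))
    obtain ⟨h1, h2⟩ := ih y' (QuotSMulTop a W) (fun b hb => hm b (List.mem_cons_of_mem _ hb)) hareg.2 g' hg' hker
      htors'
    refine ⟨h1, fun h0 => ?_⟩
    obtain ⟨h3, h4⟩ := h2 h0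
    have hT : powTorsion (Ideal.ofList (a :: y' :: ys)) (matHom M hM W 1) = ⊥ := by
      have := hWf 0
      refine Submodule.eq_bot_of_le_smul_of_le_jacobson_bot (maximalIdeal A) _
        (IsNoetherian.noetherian _) ?_ (maximalIdeal_le_jacobson _)
      intro x hx
      have hpx : p 1 x ∈ powTorsion (Ideal.ofList (y' :: ys)) _ :=
        map_mem_powTorsion (p 1) (powTorsion_mono hI hx)
      rw [h3, Submodule.mem_bot, hp] at hpx
      obtain ⟨z, rfl⟩ := hpx
      refine Submodule.smul_mem_smul ham (mem_powTorsion_of_smul fun b hb => ?_)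
      obtain ⟨n, hn⟩ := hx b hb
      exact ⟨n, hker1 _ (by rw [smul_comm, hn])⟩
    refine ⟨hT, fun hsub => h4 fun i => ?_⟩
    refine subsingleton_of_forall_eq 0 fun x => ?_
    have hqx : q (i + 1) x = 0 := by
      rcases i with _ | i
      · have := hker1 _ ((hq _ _).2 ⟨x, rfl⟩)
        rwa [hT] at this
      · have := hsub i
        exact Subsingleton.elim _ _
    obtain ⟨z, rfl⟩ := (hpq (i + 1) x).1 hqx
    have := hsub i
    rw [Subsingleton.elim z 0, map_zero]

end CoreInduction

section ConeComplex

open CategoryTheory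

variable {A : Type u} [CommRing A]

section On

variable {ι : ℕ → Type} [∀ j, Fintype (ι j)] (M : ∀ j, Matrix (ι j) (ι (j + 1)) A)
  (X : Type u) [AddCommGroup X] [Module A X]
  (hM : ∀ j v, smulVec X (M j) (smulVec X (M (j + 1)) v) = 0)

theorem exists_matCpxOn_proj (j : ℕ) :
    ∃ π : LinearMap.ker (smulVec X (M j)) →ₗ[A] (matCpxOn X M hM).homology (j + 1),
      Function.Surjective π ∧ ∀ z, π z = 0 ↔ ∃ w, smulVec X (M (j + 1)) w = z := by
  have := exists_homology_proj (matCpxOn X M hM) j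
  rw [matCpxOn_d_hom, matCpxOn_d_hom] at this
  exact this

theorem matCpxOn_subsingleton_iff (j : ℕ) :
    Subsingleton ((matCpxOn X M hM).homology (j + 1)) ↔ MatExact X (M j) (M (j + 1)) := by
  rw [subsingleton_homology_iff, matCpxOn_d_hom, matCpxOn_d_hom]; rfl

theorem matCpxOn_finite [IsNoetherianRing A] [Module.Finite A X] (j : ℕ) :
    Module.Finite A ((matCpxOn X M hM).homology (j + 1)) := by
  have : Module.Finite A ((matCpxOn X M hM).X (j + 1)) :=
    inferInstanceAs (Module.Finite A (ι (j + 1) → X))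
  exact finite_homology _ _

theorem matCpxOn_powTorsion (j : ℕ) (I : Ideal A)
    (h : ∀ a ∈ I, ∀ v, smulVec X (M j) v = 0 → ∃ n w, smulVec X (M (j + 1)) w = a ^ n • v) :
    powTorsion I ((matCpxOn X M hM).homology (j + 1)) = ⊤ := by
  obtain ⟨π, hπ, hπ'⟩ := exists_matCpxOn_proj M X hM j
  refine eq_top_iff.2 fun x _ a ha => ?_
  obtain ⟨z, rfl⟩ := hπ x
  obtain ⟨n, w, hw⟩ := h a ha z z.2
  exact ⟨n, by rw [← map_smul, hπ']; exact ⟨w, hw⟩⟩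

theorem exists_matCpxOn_shift (j : ℕ) :
    Nonempty ((matCpxOn X (fun j => M (j + 1)) fun j => hM (j + 1)).homology (j + 1) ≃ₗ[A]
      (matCpxOn X M hM).homology (j + 2)) := by
  obtain ⟨π, hπ, hπ'⟩ := exists_matCpxOn_proj M X hM (j + 1)
  obtain ⟨ρ, hρ, hρ'⟩ := exists_matCpxOn_proj (fun j => M (j + 1)) X (fun j => hM (j + 1)) j
  have : LinearMap.ker ρ = LinearMap.ker π := by
    ext z
    exact (hρ' z).trans (hπ' z).symm
  exact ⟨(ρ.quotKerEquivOfSurjective hρ).symm ≪≫ₗ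
    (Submodule.quotEquivOfEq _ _ this) ≪≫ₗ π.quotKerEquivOfSurjective hπ⟩

end On

variable {ι : ℕ → Type} [∀ j, Fintype (ι j)] [∀ j, DecidableEq (ι j)]
  (d : ∀ j, Matrix (ι j) (ι (j + 1)) A) (h : ∀ j, Matrix (ι j) (ι (j + 2)) A) (F : A)

/-- The matrices of the periodic-type complex associated to matrices whose consecutive products
are multiples of `F`. -/
def coneMat (j : ℕ) : Matrix (ι (j + 1) ⊕ ι j) (ι (j + 2) ⊕ ι (j + 1)) A :=
  Matrix.fromBlocks (d (j + 1)) (F • 1) (-h j) (-d j)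

variable (hd : ∀ j, d j * d (j + 1) = F • h j) (hdh : ∀ j, d j * h (j + 1) = h j * d (j + 2))

include hd hdh in
theorem coneMat_mul (j : ℕ) : coneMat d h F j * coneMat d h F (j + 1) = 0 := by
  rw [coneMat, coneMat, Matrix.fromBlocks_multiply, ← Matrix.fromBlocks_zero, Matrix.fromBlocks_inj]
  refine ⟨?_, ?_, ?_, ?_⟩
  · rw [hd]; simp
  · simp
  · simp [hdh]
  · simp [hd]

theorem smulVec_coneMat (X : Type*) [AddCommGroup X] [Module A X] (j : ℕ) (a : ι (j + 2) → X)
    (b : ι (j + 1) → X) : smulVec X (coneMat d h F j) (Sum.elim a b) =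
      Sum.elim (smulVec X (d (j + 1)) a + F • b) (-smulVec X (h j) a - smulVec X (d j) b) := by
  ext (i | i)
  · simp [smulVec_apply, coneMat, Matrix.smul_apply, Matrix.one_apply, Finset.sum_ite_eq]
  · simp [smulVec_apply, coneMat, sub_eq_add_neg]

include hd hdh in
theorem coneMat_exact (hF : IsSMulRegular A F) {R : Type*} [CommRing R] (ψ : A →+* R)
    (hψ : Function.Surjective ψ) (hker : ∀ a, ψ a = 0 ↔ ∃ b, F * b = a)
    (hδ : ∀ j, MatExact R ((d (j + 1)).map ψ) ((d (j + 2)).map ψ)) (j : ℕ) :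
    MatExact A (coneMat d h F j) (coneMat d h F (j + 1)) := by
  rw [matExact_iff (coneMat_mul d h F hd hdh j)]
  intro v hv
  obtain ⟨a, b, rfl⟩ : ∃ a b, v = Sum.elim a b := ⟨v ∘ Sum.inl, v ∘ Sum.inr, by simp⟩
  rw [smulVec_coneMat] at hv
  have h1 : smulVec A (d (j + 1)) a + F • b = 0 := funext fun i => congrFun hv (Sum.inl i)
  have hmap : ∀ {m n : Type} [Fintype n] (M : Matrix m n A) (v : n → A),
      smulVec R (M.map ψ) (ψ ∘ v) = ψ ∘ smulVec A M v := fun M v =>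
    smulVec_map ψ ψ.toAddMonoidHom (fun a x => map_mul ψ a x) M v
  have hψF : ∀ x, ψ (F * x) = 0 := fun x => (hker _).2 ⟨x, rfl⟩
  obtain ⟨c, hc⟩ := (hδ j (ψ ∘ a)).1 (by
    rw [hmap, eq_neg_of_add_eq_zero_left h1]
    ext i
    simp [hψF])
  obtain ⟨a', rfl⟩ := hψ.comp_left c
  rw [hmap] at hc
  choose b' hb' using fun i => (hker ((a - smulVec A (d (j + 2)) a') i)).1 (by
    have := congrFun hc i
    simp only [Function.comp_apply] at this
    simp [this])
  have ha : a = smulVec A (d (j + 2)) a' + F • b' := by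
    rw [← sub_eq_iff_eq_add']
    exact (funext hb').symm
  refine ⟨Sum.elim a' b', ?_⟩
  rw [smulVec_coneMat, ← ha]
  congr 1
  have : F • b = F • (-smulVec A (h (j + 1)) a' - smulVec A (d (j + 1)) b') := by
    rw [eq_neg_of_add_eq_zero_right h1, ha, map_add, ← smulVec_mul, hd, map_smul, smulVec_smul,
      smul_sub, smul_neg]
    abel
  exact funext fun i => hF (congrFun this.symm i)

end ConeComplex

section ConeHomology

open CategoryTheory

variable {A : Type u} [CommRing A] {ι : ℕ → Type} [∀ j, Fintype (ι j)] [∀ j, DecidableEq (ι j)]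
  (d : ∀ j, Matrix (ι j) (ι (j + 1)) A) (h : ∀ j, Matrix (ι j) (ι (j + 2)) A) (F : A)
  (hd : ∀ j, d j * d (j + 1) = F • h j) (hdh : ∀ j, d j * h (j + 1) = h j * d (j + 2))
  (X : Type u) [AddCommGroup X] [Module A X] (hFX : ∀ x : X, F • x = 0)

include hd hFX in
theorem smulVec_comp_eq_zero_of_smul (j : ℕ) (v : ι (j + 2) → X) :
    smulVec X (d j) (smulVec X (d (j + 1)) v) = 0 := by
  rw [← smulVec_mul, hd, smulVec_smul]
  exact funext fun i => hFX _

theorem exists_cone_les :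
    ∃ (f : ∀ j, (matCpxOn X d (smulVec_comp_eq_zero_of_smul d h F hd X hFX)).homology (j + 1) →ₗ[A]
        matHom (coneMat d h F) (coneMat_mul d h F hd hdh) X (j + 1))
      (g : ∀ j, matHom (coneMat d h F) (coneMat_mul d h F hd hdh) X (j + 1) →ₗ[A]
        (matCpxOn X d (smulVec_comp_eq_zero_of_smul d h F hd X hFX)).homology (j + 2))
      (δ : ∀ j, (matCpxOn X d (smulVec_comp_eq_zero_of_smul d h F hd X hFX)).homology (j + 3) →ₗ[A]
        (matCpxOn X d (smulVec_comp_eq_zero_of_smul d h F hd X hFX)).homology (j + 1)),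
      (∀ j, Function.Exact (g (j + 1)) (δ j)) ∧ (∀ j, Function.Exact (δ j) (f j)) ∧
        ∀ j, Function.Exact (f j) (g j) := by
  let hC := smulVec_comp_eq_zero_of_smul d h F hd X hFX
  let f : matCpxOn X d hC ⟶ matCpx X (coneMat d h F) (coneMat_mul d h F hd hdh) :=
    { f := fun j => ModuleCat.ofHom
        { toFun := fun b => (Sum.elim (0 : ι (j + 1) → X) ((-1 : A) ^ j • b) : ι (j + 1) ⊕ ι j → X)
          map_add' := fun a b => by ext (i | i) <;> simp
          map_smul' := fun a b => by ext (i | i) <;> simp [smul_comm a] }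
      comm' := fun i j hij => by
        obtain rfl : j + 1 = i := hij
        rw [matCpxOn_d, matCpxOn_d]
        ext1
        refine LinearMap.ext fun (v : ι (j + 1) → X) => ?_
        change smulVec X (coneMat d h F j) (Sum.elim (0 : ι (j + 2) → X) ((-1 : A) ^ (j + 1) • v)) =
          Sum.elim (0 : ι (j + 1) → X) ((-1 : A) ^ j • smulVec X (d j) v)
        rw [smulVec_coneMat]
        congr 1
        · rw [map_zero, zero_add]
          exact funext fun i => hFX _
        · rw [map_zero, map_smul, pow_succ, neg_zero, zero_sub, mul_neg, mul_one, neg_smul, neg_neg] }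
  let g : matCpx X (coneMat d h F) (coneMat_mul d h F hd hdh) ⟶
      matCpxOn X (fun j => d (j + 1)) (fun j => hC (j + 1)) :=
    { f := fun j => ModuleCat.ofHom
        { toFun := fun b => ((b : ι (j + 1) ⊕ ι j → X) ∘ Sum.inl)
          map_add' := fun a b => rfl
          map_smul' := fun a b => rfl }
      comm' := fun i j hij => by
        obtain rfl : j + 1 = i := hij
        rw [matCpxOn_d, matCpxOn_d]
        ext1
        refine LinearMap.ext fun (v : ι (j + 2) ⊕ ι (j + 1) → X) => ?_
        obtain ⟨a, b, rfl⟩ : ∃ a b, v = Sum.elim a b := ⟨v ∘ Sum.inl, v ∘ Sum.inr, by simp⟩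
        change smulVec X (d (j + 1)) a = smulVec X (coneMat d h F j) (Sum.elim a b) ∘ Sum.inl
        rw [smulVec_coneMat, Sum.elim_comp_inl, left_eq_add]
        exact funext fun i => hFX _ }
  let S : ShortComplex (ChainComplex (ModuleCat.{u} A) ℕ) :=
    ShortComplex.mk f g (by ext j x; rfl)
  have hS : S.ShortExact := by
    refine HomologicalComplex.shortExact_of_degreewise_shortExact S fun j => ?_
    refine ModuleCat.shortComplex_shortExact _ ?_ ?_ ?_
    · intro (v : ι (j + 1) ⊕ ι j → X)
      change v ∘ Sum.inl = 0 ↔ ∃ w : ι j → X, Sum.elim (0 : ι (j + 1) → X) ((-1 : A) ^ j • w) = v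
      constructor
      · intro hv
        refine ⟨(-1 : A) ^ j • (v ∘ Sum.inr), ?_⟩
        rw [smul_smul, ← mul_pow, neg_one_mul, neg_neg, one_pow, one_smul, ← hv]
        exact Sum.elim_comp_inl_inr v
      · rintro ⟨w, rfl⟩
        rfl
    · intro (v : ι j → X) (w : ι j → X) hvw
      change Sum.elim (0 : ι (j + 1) → X) ((-1 : A) ^ j • v) = Sum.elim (0 : ι (j + 1) → X) ((-1 : A) ^ j • w) at hvw
      have := congrArg (fun t => (-1 : A) ^ j • (t ∘ Sum.inr)) hvw
      change v = w
      simpa only [Sum.elim_comp_inr, smul_smul, ← mul_pow, neg_one_mul, neg_neg, one_pow,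
        one_smul] using this
    · intro (v : ι (j + 1) → X)
      exact ⟨(Sum.elim v (0 : ι j → X) : ι (j + 1) ⊕ ι j → X), rfl⟩
  have e := fun j => (exists_matCpxOn_shift d X hC j).some
  have hles := homology_les S hS
  refine ⟨fun j => (HomologicalComplex.homologyMap S.f (j + 1)).hom,
    fun j => (e j).toLinearMap ∘ₗ (HomologicalComplex.homologyMap S.g (j + 1)).hom,
    fun j => (hS.δ (j + 2) (j + 1) rfl).hom ∘ₗ (e (j + 1)).symm.toLinearMap,
    fun j => ?_, fun j => ?_, fun j => ?_⟩
  · intro x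
    refine ((hles (j + 1)).1 ((e (j + 1)).symm x)).trans (exists_congr fun y => ?_)
    exact LinearEquiv.eq_symm_apply (e (j + 1))
  · intro x
    refine ((hles (j + 1)).2.1 x).trans ?_
    exact ((e (j + 1)).symm.surjective.exists (p := fun y => (hS.δ (j + 2) (j + 1) rfl).hom y = x))
  · intro x
    exact (LinearEquiv.map_eq_zero_iff (e j)).trans ((hles (j + 1)).2.2 x)

open IsLocalRing RingTheory.Sequence in
include hd hdh hFX in
theorem matExact_of_cone_exact [IsLocalRing A] [IsNoetherianRing A] [Module.Finite A X]
    (W : Type u) [AddCommGroup W] [Module A W] [Module.Finite A W] (y : A) (ys : List A)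
    (hm : ∀ a ∈ y :: ys, a ∈ maximalIdeal A) (hreg : IsWeaklyRegular W (y :: ys)) (g : W →ₗ[A] X)
    (hg : Function.Surjective g) (hker : LinearMap.ker g = Ideal.ofList (y :: ys) • ⊤)
    (hW : ∀ i, MatExact W (coneMat d h F (i + 1)) (coneMat d h F (i + 2)))
    (htors : ∀ i, ∀ a ∈ maximalIdeal A, ∀ v, smulVec X (d (i + 1)) v = 0 →
      ∃ n w, smulVec X (d (i + 2)) w = a ^ n • v)
    (J : ℕ) (hJ : ∀ i ≥ J, MatExact X (d (i + 1)) (d (i + 2)))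
    (h2 : MatExact X (d 1) (d 2)) (i : ℕ) : MatExact X (d (i + 1)) (d (i + 2)) := by
  have hC := smulVec_comp_eq_zero_of_smul d h F hd X hFX
  obtain ⟨f, k, δ, hkδ, hδf, hfk⟩ := exists_cone_les d h F hd hdh X hFX
  set C : ℕ → ModuleCat A := fun j => (matCpxOn X d hC).homology j with hCdef
  set E : ℕ → ModuleCat A := fun j => matHom (coneMat d h F) (coneMat_mul d h F hd hdh) X j
    with hEdef
  change ∀ j, C (j + 1) →ₗ[A] E (j + 1) at f
  change ∀ j, E (j + 1) →ₗ[A] C (j + 2) at k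
  change ∀ j, C (j + 3) →ₗ[A] C (j + 1) at δ
  have hCE : ∀ i, Subsingleton (C (i + 2)) ↔ MatExact X (d (i + 1)) (d (i + 2)) := fun i =>
    matCpxOn_subsingleton_iff d X hC (i + 1)
  have hCt : ∀ i, powTorsion (maximalIdeal A) (C (i + 2)) = ⊤ := fun i =>
    matCpxOn_powTorsion d X hC (i + 1) _ (htors i)
  have hEt : ∀ i, powTorsion (maximalIdeal A) (E (i + 2)) = ⊤ := fun i => by
    refine eq_top_iff.2 fun x _ => ?_
    refine mem_powTorsion_of_exact (hfk (i + 1)) (hCt i) ?_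
    rw [hCt (i + 1)]; trivial
  have hCl : ∀ i, Module.length A (C (i + 2)) ≠ ⊤ := fun i =>
    have : Module.Finite A (C (i + 2)) := matCpxOn_finite d X hC (i + 1)
    length_ne_top_of_powTorsion _ (hCt i)
  have hEl : ∀ i, Module.length A (E (i + 2)) ≠ ⊤ := fun i =>
    have : Module.Finite A (E (i + 2)) := matHom_finite _ _ X (i + 1)
    length_ne_top_of_powTorsion _ (hEt i)
  have hEJ : ∀ i ≥ J, Subsingleton (E (i + 2)) := fun i hi => by
    have h1 := (hCE i).2 (hJ i hi)
    have h2 := (hCE (i + 1)).2 (hJ (i + 1) (by omega))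
    refine subsingleton_of_forall_eq 0 fun x => ?_
    obtain ⟨z, rfl⟩ := (hfk (i + 1) x).1 (Subsingleton.elim (α := C (i + 3)) _ _)
    exact (congrArg (f (i + 1)) (Subsingleton.elim (α := C (i + 2)) z 0)).trans (map_zero _)
  let b : ℕ → ℤ := fun i => natLength A (C (i + 2)) - natLength A (LinearMap.range (δ i))
  have hE : ∀ i, (natLength A (E (i + 2)) : ℤ) = b (i + 1) + b i := by
    intro i
    have h1 := natLength_eq_ker_add_range (k (i + 1)) (hEl i)
    have h2 := natLength_eq_ker_add_range (f (i + 1)) (hCl i)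
    have h3 := natLength_eq_ker_add_range (δ i) (hCl (i + 1))
    rw [(hfk (i + 1)).linearMap_ker_eq, ← (hkδ i).linearMap_ker_eq] at h1
    rw [(hδf (i + 1)).linearMap_ker_eq] at h2
    change natLength A (C (i + 2)) = natLength A (LinearMap.range (δ (i + 1))) +
      natLength A (LinearMap.range (f (i + 1))) at h2
    change natLength A (C (i + 3)) = natLength A (LinearMap.ker (δ i)) +
      natLength A (LinearMap.range (δ i)) at h3
    change natLength A (E (i + 2)) = natLength A (LinearMap.range (f (i + 1))) +
      natLength A (LinearMap.ker (δ i)) at h1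
    change (natLength A (E (i + 2)) : ℤ) = (natLength A (C (i + 3)) -
      natLength A (LinearMap.range (δ (i + 1)))) + (natLength A (C (i + 2)) -
      natLength A (LinearMap.range (δ i)))
    omega
  have hχ : partialEuler (coneMat d h F) (coneMat_mul d h F hd hdh) X J ≤ 0 := by
    have : partialEuler (coneMat d h F) (coneMat_mul d h F hd hdh) X J =
        ∑ i ∈ Finset.range J, (-1) ^ i * (b (i + 1) + b i) :=
      Finset.sum_congr rfl fun i _ => by rw [← hE]
    rw [this, sum_telescope]
    have h0 : natLength A (C 2) = 0 := (natLength_eq_zero_iff (hCl 0)).2 ((hCE 0).2 h2)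
    have h1 : natLength A (C (J + 2)) = 0 :=
      (natLength_eq_zero_iff (hCl J)).2 ((hCE J).2 (hJ J le_rfl))
    have h3 : natLength A (LinearMap.range (δ J)) = 0 := by
      have := natLength_eq_ker_add_range (δ J) (hCl (J + 1))
      rw [(natLength_eq_zero_iff (hCl (J + 1))).2 ((hCE (J + 1)).2 (hJ _ (by omega)))] at this
      omega
    simp only [b, h0, h1, h3]
    simp
  have hEW : ∀ i, Subsingleton (matHom (coneMat d h F) (coneMat_mul d h F hd hdh) W (i + 2)) :=
    fun i => (matHom_subsingleton_iff _ _ W (i + 1)).2 (hW i)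
  have hE0 := ((partialEuler_nonneg (coneMat d h F) (coneMat_mul d h F hd hdh) hEt J hEJ ys y W hm
    hreg g hg hker (fun i => by
      have := hEW i
      exact eq_top_iff.2 fun x _ => by
        have h0 : x = 0 := Subsingleton.elim _ _
        rw [h0]; exact zero_mem _)).2 hχ).2 hEW
  have key : ∀ n i, J ≤ i + n → Subsingleton (C (i + 2)) := by
    intro n
    induction n with
    | zero => intro i hi; exact (hCE i).2 (hJ i hi)
    | succ n ih =>
      intro i hi
      have h1 : Subsingleton (C (i + 4)) := ih (i + 2) (by omega)
      have h2 : Subsingleton (E (i + 2)) := hE0 i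
      refine subsingleton_of_forall_eq 0 fun x => ?_
      obtain ⟨z, rfl⟩ := (hδf (i + 1) x).1 (Subsingleton.elim _ _)
      rw [Subsingleton.elim z 0, map_zero]
  exact (hCE i).1 (key J i (by omega))

end ConeHomology

section LocalizedMatrices

theorem smulVec_map_algebraMap {A B X : Type*} [CommRing A] [CommRing B] [Algebra A B]
    [AddCommGroup X] [Module A X] [Module B X] [IsScalarTower A B X] {m n : Type*} [Fintype n]
    (M : Matrix m n A) (v : n → X) :
    smulVec X (M.map (algebraMap A B)) v = smulVec X M v := by
  ext i; simp [smulVec_apply]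

open TensorProduct

theorem exists_mul_pow_mem_of_mem_minimalPrimes {U : Type*} [CommRing U] {I P : Ideal U}
    (hP : P ∈ I.minimalPrimes) {x : U} (hx : x ∈ P) : ∃ y ∉ P, ∃ n : ℕ, y * x ^ n ∈ I := by
  have hPp : P.IsPrime := hP.1.1
  by_contra! H
  have hdisj : Disjoint (I : Set U) (P.primeCompl ⊔ Submonoid.powers x : Submonoid U) := by
    rw [Set.disjoint_left]
    intro z hz hz'
    obtain ⟨y, hy, w, ⟨n, rfl⟩, rfl⟩ := Submonoid.mem_sup.1 hz'
    exact H y hy n hz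
  obtain ⟨Q, hQ, hIQ, hQd⟩ := Ideal.exists_le_prime_disjoint I _ hdisj
  rw [Set.disjoint_left] at hQd
  have hQP : Q ≤ P := fun z hz => by
    by_contra hzP
    exact hQd hz (Submonoid.mem_sup_left hzP)
  exact hQd (hP.2 ⟨hQ, hIQ⟩ hQP hx) (Submonoid.mem_sup_right (Submonoid.mem_powers x))

variable {U : Type*} [CommRing U] {N X : Type*} [AddCommGroup N] [Module U N] [AddCommGroup X]
  [Module U X] (T : Submonoid U) (f : N →ₗ[U] X) [IsLocalizedModule T f]
  {m n p : Type*} [Fintype n] [Fintype p]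

theorem exists_smul_eq_comp (v : n → X) : ∃ s ∈ T, ∃ w : n → N, f ∘ w = s • v := by
  obtain ⟨s, hs⟩ := IsLocalizedModule.exist_integer_multiples_of_finite T f v
  choose w hw using hs
  exact ⟨s, s.2, w, funext hw⟩

theorem exists_smul_eq_zero_of_comp [Finite m] (v : m → N) (hv : f ∘ v = 0) :
    ∃ s ∈ T, s • v = 0 := by
  have := Fintype.ofFinite m
  classical
  choose s hs using fun i => (IsLocalizedModule.eq_zero_iff T f).1 (congrFun hv i)
  refine ⟨∏ i, (s i : U), prod_mem fun i _ => (s i).2, funext fun i => ?_⟩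
  change (∏ i, (s i : U)) • v i = 0
  rw [← Finset.prod_erase_mul _ _ (Finset.mem_univ i), mul_smul]
  have h0 : (s i : U) • v i = 0 := hs i
  rw [h0, smul_zero]

theorem exists_comp_boundary [Finite m] {M : Matrix m n U}
    (v : n → X) (hv : smulVec X M v = 0) :
    ∃ s ∈ T, ∃ w : n → N, f ∘ w = s • v ∧ smulVec N M w = 0 := by
  obtain ⟨s, hs, w, hw⟩ := exists_smul_eq_comp T f v
  obtain ⟨t, ht, h0⟩ := exists_smul_eq_zero_of_comp T f (smulVec N M w) (by
    rw [← smulVec_comp, hw, map_smul, hv, smul_zero])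
  refine ⟨t * s, mul_mem ht hs, t • w, ?_, by rw [map_smul, h0]⟩
  rw [mul_smul, ← hw]
  ext i
  simp

theorem exists_smul_boundary [Finite n] {K : Matrix n p U} (z : n → N) (v : p → X)
    (hv : smulVec X K v = f ∘ z) : ∃ s ∈ T, ∃ w, smulVec N K w = s • z := by
  obtain ⟨s, hs, w, hw⟩ := exists_smul_eq_comp T f v
  obtain ⟨t, ht, h0⟩ := exists_smul_eq_zero_of_comp T f (smulVec N K w - s • z) (by
    have : f ∘ (smulVec N K w - s • z) = f ∘ (smulVec N K w) - s • (f ∘ z) := by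
      ext i; simp
    rw [this, ← smulVec_comp, hw, map_smul, hv, sub_self])
  refine ⟨t * s, mul_mem ht hs, t • w, ?_⟩
  rw [smul_sub, sub_eq_zero] at h0
  rw [map_smul, h0, mul_smul]

end LocalizedMatrices

section BaseChangeKernel

open TensorProduct

theorem ker_baseChange_eq_ideal_smul {U : Type*} [CommRing U] {W N : Type*} [AddCommGroup W]
    [Module U W] [AddCommGroup N] [Module U N] (g : W →ₗ[U] N) (hg : Function.Surjective g)
    (I : Ideal U) (hker : LinearMap.ker g = I • ⊤) (A : Type*) [CommRing A] [Algebra U A] :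
    LinearMap.ker (g.baseChange A) = I.map (algebraMap U A) • ⊤ := by
  apply le_antisymm
  · intro x hx
    have hex : Function.Exact (LinearMap.ker g).subtype g := g.exact_subtype_ker_map
    obtain ⟨y, rfl⟩ := (lTensor_exact A hex hg x).1 hx
    clear hx
    induction y with
    | zero => simp
    | add x y hx hy => rw [map_add]; exact add_mem hx hy
    | tmul a w =>
      rw [LinearMap.lTensor_tmul, Submodule.subtype_apply]
      have hw : (w : W) ∈ I • (⊤ : Submodule U W) := hker ▸ w.2
      generalize (w : W) = w at hw
      induction hw using Submodule.smul_induction_on' with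
      | smul r hr z _ =>
        rw [← TensorProduct.smul_tmul, Algebra.smul_def, ← smul_eq_mul, ← TensorProduct.smul_tmul']
        exact Submodule.smul_mem_smul (Ideal.mem_map_of_mem _ hr) trivial
      | add x _ y _ hx hy => rw [TensorProduct.tmul_add]; exact add_mem hx hy
  · have hI : ∀ r ∈ I, ∀ x : N, r • x = 0 := fun r hr x => by
      obtain ⟨w, rfl⟩ := hg x
      rw [← map_smul, ← LinearMap.mem_ker, hker]
      exact Submodule.smul_mem_smul hr trivial
    rw [Submodule.smul_le]
    intro r hr z _
    rw [LinearMap.mem_ker, map_smul]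
    generalize g.baseChange A z = t
    revert t
    refine Submodule.span_induction (fun r hr t => ?_) (fun t => zero_smul _ t)
      (fun x y _ _ hx hy t => by rw [add_smul, hx, hy, add_zero])
      (fun a x _ hx t => by rw [smul_assoc, hx, smul_zero]) hr
    obtain ⟨r, hr, rfl⟩ := hr
    induction t with
    | zero => simp
    | add x y hx hy => rw [smul_add, hx, hy, add_zero]
    | tmul a x =>
      rw [algebraMap_smul, ← TensorProduct.tmul_smul, hI r hr, TensorProduct.tmul_zero]

end BaseChangeKernel

section GlobalRigidity

open TensorProduct RingTheory.Sequence IsLocalRing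

variable {A : Type u} [CommRing A] {ι : ℕ → Type} [∀ j, Fintype (ι j)] [∀ j, DecidableEq (ι j)]
  (d : ∀ j, Matrix (ι j) (ι (j + 1)) A) (h : ∀ j, Matrix (ι j) (ι (j + 2)) A) (F : A)
  (hd : ∀ j, d j * d (j + 1) = F • h j) (hdh : ∀ j, d j * h (j + 1) = h j * d (j + 2))
  (X : Type u) [AddCommGroup X] [Module A X] (hFX : ∀ x : X, F • x = 0)

theorem coneMat_map {B : Type*} [CommRing B] (φ : A →+* B) (j : ℕ) :
    (coneMat d h F j).map φ =
      coneMat (fun j => (d j).map φ) (fun j => (h j).map φ) (φ F) j := by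
  ext (i | i) (k | k) <;> simp [coneMat, Matrix.one_apply, apply_ite φ]

include hd hdh hFX in
theorem matExact_of_cone_exact_of_finite [IsNoetherianRing A] [Module.Finite A X]
    (W : Type u) [AddCommGroup W] [Module A W] [Module.Finite A W] (y : A) (ys : List A)
    (hreg : IsWeaklyRegular W (y :: ys)) (g : W →ₗ[A] X)
    (hg : Function.Surjective g) (hker : LinearMap.ker g = Ideal.ofList (y :: ys) • ⊤)
    (hW : ∀ i, MatExact W (coneMat d h F (i + 1)) (coneMat d h F (i + 2)))
    (J : ℕ) (hJ : ∀ i ≥ J, MatExact X (d (i + 1)) (d (i + 2)))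
    (h2 : MatExact X (d 1) (d 2)) (i : ℕ) : MatExact X (d (i + 1)) (d (i + 2)) := by
  have hC := smulVec_comp_eq_zero_of_smul d h F hd X hFX
  let C : ℕ → ModuleCat A := fun i => (matCpxOn X d hC).homology (i + 2)
  have hCf : ∀ i, Module.Finite A (C i) := fun i => matCpxOn_finite d X hC (i + 1)
  have hCE : ∀ i, Subsingleton (C i) ↔ MatExact X (d (i + 1)) (d (i + 2)) := fun i =>
    matCpxOn_subsingleton_iff d X hC (i + 1)
  have hCa : ∀ i a, a ∈ Module.annihilator A (C i) ↔
      ∀ z, smulVec X (d (i + 1)) z = 0 → ∃ w, smulVec X (d (i + 2)) w = a • z := fun i a => by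
    rw [Module.mem_annihilator]
    have := smul_homology_eq_zero_iff (matCpxOn X d hC) (i + 1) a
    rw [matCpxOn_d_hom, matCpxOn_d_hom] at this
    exact this
  let I : Ideal A := ⨅ i ∈ Finset.range J, Module.annihilator A (C i)
  have hIC : ∀ i, I ≤ Module.annihilator A (C i) := fun i => by
    by_cases hi : i < J
    · exact iInf₂_le i (Finset.mem_range.2 hi)
    · have := (hCE i).2 (hJ i (not_lt.1 hi))
      rw [Module.annihilator_eq_top_iff.2 this]
      exact le_top
  by_cases hI : I = ⊤
  · rw [← hCE, ← Module.annihilator_eq_top_iff (R := A), eq_top_iff, ← hI]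
    exact hIC i
  exfalso
  obtain ⟨P, hP⟩ := Ideal.nonempty_minimalPrimes hI
  have hPp : P.IsPrime := hP.1.1
  have hXI : Module.annihilator A X ≤ I := by
    refine le_iInf₂ fun i _ a ha => (hCa i a).2 fun z _ => ⟨0, ?_⟩
    rw [map_zero]
    exact funext fun k => (Module.mem_annihilator.1 ha (z k)).symm
  have hyX : Ideal.ofList (y :: ys) ≤ P := by
    refine le_trans (fun a ha => ?_) (hXI.trans hP.1.2)
    rw [Module.mem_annihilator]
    intro x
    obtain ⟨w, rfl⟩ := hg x
    rw [← map_smul, ← LinearMap.mem_ker, hker]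
    exact Submodule.smul_mem_smul ha trivial
  let B := Localization.AtPrime P
  have : Module.Flat A B := IsLocalization.flat B P.primeCompl
  let f : X →ₗ[A] B ⊗[A] X := TensorProduct.mk A B X 1
  have hf : IsLocalizedModule P.primeCompl f :=
    (isLocalizedModule_iff_isBaseChange P.primeCompl B f).2 (TensorProduct.isBaseChange A X B)
  have hmap : ∀ i, MatExact (B ⊗[A] X) ((d (i + 1)).map (algebraMap A B))
      ((d (i + 2)).map (algebraMap A B)) ↔ MatExact (B ⊗[A] X) (d (i + 1)) (d (i + 2)) :=
    fun i => matExact_restrict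
  have hall := matExact_of_cone_exact (fun j => (d j).map (algebraMap A B))
    (fun j => (h j).map (algebraMap A B)) (algebraMap A B F)
    (fun j => by
      rw [← Matrix.map_mul, hd]
      ext; simp)
    (fun j => by rw [← Matrix.map_mul, hdh, Matrix.map_mul])
    (B ⊗[A] X) (fun x => by
      rw [algebraMap_smul]
      induction x with
      | zero => simp
      | add x y hx hy => rw [smul_add, hx, hy, add_zero]
      | tmul b x => rw [← TensorProduct.tmul_smul, hFX, TensorProduct.tmul_zero])
    (B ⊗[A] W) (algebraMap A B y) (ys.map (algebraMap A B))
    (by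
      intro a ha
      rw [← List.map_cons, List.mem_map] at ha
      obtain ⟨b, hb, rfl⟩ := ha
      rw [IsLocalization.AtPrime.to_map_mem_maximal_iff B P]
      exact hyX (Ideal.subset_span hb))
    (by
      rw [← List.map_cons]
      exact hreg.of_flat_of_isBaseChange (TensorProduct.isBaseChange A W B))
    (g.baseChange B) (LinearMap.lTensor_surjective B hg)
    (by rw [ker_baseChange_eq_ideal_smul g hg _ hker, Ideal.map_ofList, List.map_cons])
    (fun i => by
      rw [← coneMat_map, ← coneMat_map]
      exact (hW i).baseChange B)
    (fun i b hb v hv => by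
      obtain ⟨p, s, rfl⟩ := IsLocalization.exists_mk'_eq P.primeCompl b
      rw [IsLocalization.AtPrime.mk'_mem_maximal_iff B P] at hb
      rw [smulVec_map_algebraMap] at hv
      obtain ⟨t, ht, z, hz, hz0⟩ := exists_comp_boundary P.primeCompl f v hv
      obtain ⟨c, hc, n, hn⟩ := exists_mul_pow_mem_of_mem_minimalPrimes hP hb
      obtain ⟨w, hw⟩ := (hCa i _).1 (hIC i hn) z hz0
      let e : P.primeCompl := ⟨c * t * s ^ n, mul_mem (mul_mem hc ht) (pow_mem s.2 n)⟩
      refine ⟨n, IsLocalization.mk' B 1 e • (f ∘ w), ?_⟩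
      have hcomp : f ∘ ((c * p ^ n) • z) = (c * p ^ n) • (f ∘ z) := by ext k; simp
      rw [map_smul, smulVec_map_algebraMap, smulVec_comp, hw, hcomp, hz, smul_smul,
        ← algebraMap_smul B (c * p ^ n * t), smul_smul]
      congr 1
      have h1 : IsLocalization.mk' B p s * algebraMap A B s = algebraMap A B p :=
        IsLocalization.mk'_spec B p s
      have h2 : IsLocalization.mk' B 1 e * algebraMap A B (c * t * s ^ n) = 1 := by
        have := IsLocalization.mk'_spec B 1 e
        rwa [map_one] at this
      simp only [map_mul, map_pow] at h2 ⊢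
      rw [← h1, mul_pow]
      linear_combination IsLocalization.mk' B p s ^ n * h2)
    J (fun i hi => (hJ i hi).baseChange B) (h2.baseChange B)
  have hIP : (Finset.range J).inf (fun i => Module.annihilator A (C i)) ≤ P := by
    rw [Finset.inf_eq_iInf]
    exact hP.1.2
  obtain ⟨i, -, hi⟩ := (Ideal.IsPrime.inf_le' hPp).1 hIP
  have hsupp : (⟨P, hPp⟩ : PrimeSpectrum A) ∈ Module.support A (C i) :=
    Module.mem_support_iff_of_finite.2 hi
  rw [Module.mem_support_iff'] at hsupp
  obtain ⟨m, hm⟩ := hsupp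
  obtain ⟨π, hπ, hπ'⟩ := exists_matCpxOn_proj d X hC (i + 1)
  obtain ⟨z, rfl⟩ := hπ m
  obtain ⟨v, hv⟩ := ((hmap i).1 (hall i) (f ∘ z)).1 (by
    rw [smulVec_comp, LinearMap.mem_ker.1 z.2]
    ext; simp)
  obtain ⟨r, hr, w, hw⟩ := exists_smul_boundary P.primeCompl f _ v hv
  refine hm r hr ?_
  rw [← map_smul, hπ']
  exact ⟨w, hw⟩

end GlobalRigidity

section LargeSpots

open TensorProduct RingTheory.Sequence IsLocalRing Pointwise

theorem matExact_quotient_list {A : Type*} [CommRing A] {ι : ℕ → Type} [∀ j, Fintype (ι j)]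
    (M : ∀ j, Matrix (ι j) (ι (j + 1)) A) (hM : ∀ j, M j * M (j + 1) = 0) (xs : List A) :
    ∀ (W : Type u) [AddCommGroup W] [Module A W] (_ : IsWeaklyRegular W xs) (J : ℕ)
      (_ : ∀ j ≥ J, MatExact W (M j) (M (j + 1))),
      ∀ j ≥ J + xs.length, MatExact (W ⧸ (Ideal.ofList xs • ⊤ : Submodule A W)) (M j) (M (j + 1)) := by
  induction xs with
  | nil =>
    intro W _ _ _ J hJ j hj
    refine (hJ j hj).congr (Submodule.quotEquivOfEqBot _ ?_).symm
    simp
  | cons x xs ih =>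
    intro W _ _ hreg J hJ j hj
    rw [isWeaklyRegular_cons_iff] at hreg
    refine (ih (QuotSMulTop x W) hreg.2 (J + 1) (fun j hj => ?_) j
      (by rw [List.length_cons] at hj; omega)).congr
      (Submodule.quotOfListConsSMulTopEquivQuotSMulTopInner W x xs).symm
    obtain ⟨j, rfl⟩ : ∃ i, j = i + 1 := ⟨j - 1, by omega⟩
    refine MatExact.quotient x hreg.1 (hM j) (hJ j (by omega)) (hJ (j + 1) (by omega)) (hM (j + 1))
      _ (Submodule.mkQ _) (Submodule.mkQ_surjective _) fun v => ?_
    rw [← LinearMap.mem_ker, Submodule.ker_mkQ, Submodule.mem_smul_pointwise_iff_exists]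
    simp

theorem matExact_of_large {R : Type u} [CommRing R] [IsLocalRing R] [IsNoetherianRing R]
    {ι : ℕ → Type} [∀ j, Fintype (ι j)]
    (M : ∀ j, Matrix (ι j) (ι (j + 1)) R) (hM : ∀ j, M j * M (j + 1) = 0) (xs : List R)
    (hxs : IsWeaklyRegular R xs) (hxm : Ideal.ofList xs = maximalIdeal R) (J : ℕ)
    (hJ : ∀ j ≥ J, MatExact R (M j) (M (j + 1))) (N : Type u) [AddCommGroup N] [Module R N]
    [Module.Finite R N] (j : ℕ) (hj : j ≥ J + xs.length) : MatExact N (M j) (M (j + 1)) := by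
  refine (MatExact.tensor_finite R R (fun r hr => ?_) (hM j) ?_ N).congr (TensorProduct.lid R N)
  · rw [IsLocalRing.jacobson_eq_maximalIdeal ⊥ bot_ne_top]
    exact hr
  · refine MatExact.congr ?_ (matExact_quotient_list M hM xs R hxs J hJ j hj)
    refine (Submodule.quotEquivOfEq _ _ ?_) ≪≫ₗ (TensorProduct.lid R _).symm
    rw [hxm]; simp

end LargeSpots

section DeformedRigidity

open TensorProduct RingTheory.Sequence IsLocalRing

universe v

/-- Rigidity for an exact complex of matrices, given a presentation of the local ring `R` as a
hypersurface `S / F` over a domain together with a suitable ring `U` over `R` and `S`. -/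
theorem matExact_of_hypersurface {R : Type u} [CommRing R] [IsLocalRing R] [IsNoetherianRing R]
    (xs : List R) (hxs : IsWeaklyRegular R xs) (hxm : Ideal.ofList xs = maximalIdeal R)
    {S : Type v} [CommRing S] [IsDomain S] (U : Type u) [CommRing U] [IsNoetherianRing U]
    [Algebra R U] [Module.Flat R U]
    (hU : ∀ r ∈ maximalIdeal R, algebraMap R U r ∈ Ideal.jacobson (⊥ : Ideal U))
    (φ : S →+* U) (ε : U →+* R) (hε : ∀ r, ε (algebraMap R U r) = r)
    (hψ : Function.Surjective (ε.comp φ)) (F : S) (hF : F ≠ 0)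
    (hker : ∀ s, ε (φ s) = 0 ↔ ∃ t, F * t = s)
    (π : S) (hπ : π ≠ 0) (hφ : Function.Surjective fun s => φ s ⊗ₜ[R] (1 : R ⧸ maximalIdeal R))
    (hφπ : ∀ s, φ s ⊗ₜ[R] (1 : R ⧸ maximalIdeal R) = 0 ↔ ∃ t, π * t = s)
    (y : U) (ys : List U) (hεy : RingHom.ker ε = Ideal.ofList (y :: ys))
    (hreg : ∀ (N : Type u) [AddCommGroup N] [Module R N] [Module.Finite R N],
      IsWeaklyRegular (U ⊗[R] N) (y :: ys))
    {ι : ℕ → Type} [∀ j, Fintype (ι j)]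
    (δ : ∀ j, Matrix (ι j) (ι (j + 1)) R) (hδ0 : ∀ j, δ j * δ (j + 1) = 0)
    (hδ : ∀ j, MatExact R (δ (j + 1)) (δ (j + 2))) (N : Type u) [AddCommGroup N] [Module R N]
    [Module.Finite R N] (h2 : MatExact N (δ 1) (δ 2)) (i : ℕ) :
    MatExact N (δ (i + 1)) (δ (i + 2)) := by
  classical
  have hFr : IsSMulRegular S F := fun a b hab => mul_left_cancel₀ hF hab
  let ψ : S →+* R := ε.comp φ
  have hlift : ∀ j, ∃ D : Matrix (ι j) (ι (j + 1)) S, D.map ψ = δ j := fun j => by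
    choose D hD using fun a b => hψ (δ j a b)
    exact ⟨Matrix.of D, by ext a b; exact hD a b⟩
  choose d hd using hlift
  have hlift2 : ∀ j, ∃ D : Matrix (ι j) (ι (j + 2)) S, d j * d (j + 1) = F • D := fun j => by
    have : (d j * d (j + 1)).map ψ = 0 := by rw [Matrix.map_mul, hd, hd, hδ0]
    choose D hD using fun a b => (hker ((d j * d (j + 1)) a b)).1 (congrFun (congrFun this a) b)
    exact ⟨Matrix.of D, by ext a b; exact (hD a b).symm⟩
  choose h hh using hlift2
  have hdh : ∀ j, d j * h (j + 1) = h j * d (j + 2) := fun j => by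
    have h1 : F • (d j * h (j + 1)) = F • (h j * d (j + 2)) := by
      rw [← Matrix.mul_smul, ← hh, ← Matrix.smul_mul, ← hh, Matrix.mul_assoc]
    ext a b
    exact hFr (congrFun (congrFun h1 a) b)
  have hES := coneMat_exact d h F hh hdh hFr ψ hψ hker (fun j => by rw [hd, hd]; exact hδ j)
  have hEmul := coneMat_mul d h F hh hdh
  have hEmulU : ∀ j, (coneMat d h F j).map φ * (coneMat d h F (j + 1)).map φ = 0 := fun j => by
    rw [← Matrix.map_mul, hEmul]; ext; simp
  have hEk : ∀ j, MatExact (U ⊗[R] (R ⧸ maximalIdeal R)) ((coneMat d h F (j + 1)).map φ)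
      ((coneMat d h F (j + 2)).map φ) := fun j => by
    let _ : Module S (U ⊗[R] (R ⧸ maximalIdeal R)) := Module.compHom _ φ
    rw [matExact_congr φ (AddEquiv.refl (U ⊗[R] (R ⧸ maximalIdeal R))) (fun a x => rfl)]
    let q : S →ₗ[S] U ⊗[R] (R ⧸ maximalIdeal R) :=
      LinearMap.toSpanSingleton S _ ((1 : U) ⊗ₜ[R] (1 : R ⧸ maximalIdeal R))
    have hq : ∀ s, q s = φ s ⊗ₜ[R] 1 := fun s => by
      change φ s • ((1 : U) ⊗ₜ[R] (1 : R ⧸ maximalIdeal R)) = _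
      rw [TensorProduct.smul_tmul', smul_eq_mul, mul_one]
    refine MatExact.quotient π (fun a b hab => mul_left_cancel₀ hπ hab) (hEmul j) (hES j)
      (hES (j + 1)) (hEmul (j + 1)) _ q (fun x => ?_) (fun v => ?_)
    · obtain ⟨s, hs⟩ := hφ x
      exact ⟨s, (hq s).trans hs⟩
    · rw [hq]; exact hφπ v
  let _ : Module U N := Module.compHom N ε
  have hUN : ∀ (u : U) (x : N), u • x = ε u • x := fun u x => rfl
  have : IsScalarTower R U N := ⟨fun r u x => by
    rw [hUN, hUN, Algebra.smul_def, map_mul, hε, mul_smul]⟩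
  have : Module.Finite U N := Module.Finite.of_restrictScalars_finite R U N
  have hNU : ∀ j, MatExact N ((d (j + 1)).map φ) ((d (j + 2)).map φ) ↔
      MatExact N (δ (j + 1)) (δ (j + 2)) := fun j => by
    rw [← matExact_congr ε (AddEquiv.refl N) (fun a x => rfl), ← hd, ← hd]
    rfl
  let g : U ⊗[R] N →ₗ[U] N := TensorProduct.AlgebraTensorModule.lift
    ((LinearMap.toSpanSingleton U (N →ₗ[R] N) LinearMap.id))
  have hg : ∀ u x, g (u ⊗ₜ x) = u • x := fun u x => rfl
  have hgs : Function.Surjective g := fun x => ⟨1 ⊗ₜ x, by rw [hg, one_smul]⟩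
  have hgk : LinearMap.ker g = Ideal.ofList (y :: ys) • ⊤ := by
    rw [← hεy]
    have key : ∀ t, t - 1 ⊗ₜ g t ∈ (RingHom.ker ε • ⊤ : Submodule U (U ⊗[R] N)) := fun t => by
      induction t with
      | zero => simp
      | add a b ha hb =>
        rw [map_add, TensorProduct.tmul_add, add_sub_add_comm]
        exact add_mem ha hb
      | tmul u x =>
        have : u ⊗ₜ[R] x - 1 ⊗ₜ g (u ⊗ₜ x) =
            (u - algebraMap R U (ε u)) • ((1 : U) ⊗ₜ[R] x : U ⊗[R] N) := by
          rw [hg, hUN, TensorProduct.smul_tmul', smul_eq_mul, mul_one, TensorProduct.sub_tmul,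
            Algebra.algebraMap_eq_smul_one, TensorProduct.smul_tmul]
        rw [this]
        exact Submodule.smul_mem_smul (by rw [RingHom.mem_ker, map_sub, hε, sub_self]) trivial
    apply le_antisymm
    · intro t ht
      have := key t
      rwa [LinearMap.mem_ker.1 ht, TensorProduct.tmul_zero, sub_zero] at this
    · rw [Submodule.smul_le]
      intro r hr t _
      rw [LinearMap.mem_ker, map_smul, hUN, RingHom.mem_ker.1 hr, zero_smul]
  rw [← hNU]
  refine matExact_of_cone_exact_of_finite (fun j => (d j).map φ) (fun j => (h j).map φ) (φ F)
    (fun j => by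
      rw [← Matrix.map_mul, hh]
      ext; simp)
    (fun j => by rw [← Matrix.map_mul, hdh, Matrix.map_mul]) N (fun x => ?_) (U ⊗[R] N) y ys
    (hreg N) g hgs hgk (fun i => ?_) (1 + xs.length) (fun i hi => ?_) ?_ i
  · rw [hUN, (hker F).2 ⟨1, mul_one F⟩, zero_smul]
  · rw [← coneMat_map, ← coneMat_map]
    exact MatExact.tensor_finite R U hU (hEmulU (i + 1)) (hEk i) N
  · rw [hNU]
    exact matExact_of_large δ hδ0 xs hxs hxm 1 (fun j hj => by
      obtain ⟨j, rfl⟩ : ∃ i, j = i + 1 := ⟨j - 1, by omega⟩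
      exact hδ j) N (i + 1) (by omega)
  · exact (hNU 0).2 h2

end DeformedRigidity

section RegularLocal

open IsLocalRing RingTheory.Sequence

theorem withBot_le_of_add_one_le_add_one {a : WithBot ℕ∞} {n : ℕ}
    (h : (n : WithBot ℕ∞) + 1 ≤ a + 1) : (n : WithBot ℕ∞) ≤ a := by
  induction a with
  | bot => exact absurd h (by simp)
  | coe a =>
    induction a with
    | top => exact le_top
    | coe a =>
      have h1 : n + 1 ≤ a + 1 := by exact_mod_cast h
      exact_mod_cast Nat.le_of_succ_le_succ h1

theorem ringKrullDim_le_length_of_ofList_eq {A : Type*} [CommRing A] [IsLocalRing A]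
    [IsNoetherianRing A] (xs : List A) (hxs : Ideal.ofList xs = maximalIdeal A) :
    ringKrullDim A ≤ xs.length := by
  classical
  refine (ringKrullDim_le_spanFinrank_maximalIdeal A).trans ?_
  have h : (maximalIdeal A).spanFinrank ≤ xs.toFinset.card := by
    rw [← hxs, ← Set.ncard_coe_finset]
    have : Ideal.ofList xs = Submodule.span A (xs.toFinset : Set A) := by
      rw [Ideal.ofList]; congr 1; ext; simp
    rw [this]
    exact Submodule.spanFinrank_span_le_ncard_of_finite (Finset.finite_toSet _)
  exact_mod_cast h.trans (List.toFinset_card_le xs)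

theorem exists_isPrime_le_ringKrullDim_quotient {A : Type*} [CommRing A] (n : ℕ)
    (h : (n : WithBot ℕ∞) ≤ ringKrullDim A) :
    ∃ P : Ideal A, P.IsPrime ∧ (n : WithBot ℕ∞) ≤ ringKrullDim (A ⧸ P) := by
  obtain ⟨p, hp⟩ := Order.le_krullDim_iff.1 h
  refine ⟨p.head.asIdeal, p.head.2, ?_⟩
  rw [ringKrullDim_quotient]
  refine Order.le_krullDim_iff.2 ⟨⟨p.length, fun i => ⟨p i, ?_⟩, fun i => p.step i⟩, hp⟩
  rw [PrimeSpectrum.mem_zeroLocus]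
  exact p.strictMono.monotone (Fin.zero_le i)

theorem isDomain_and_isWeaklyRegular_of_le_ringKrullDim (n : ℕ) :
    ∀ (A : Type u) [CommRing A] [IsLocalRing A] [IsNoetherianRing A] (xs : List A)
      (_ : xs.length = n) (_ : Ideal.ofList xs = maximalIdeal A)
      (_ : (n : WithBot ℕ∞) ≤ ringKrullDim A), IsDomain A ∧ IsWeaklyRegular A xs := by
  induction n with
  | zero =>
    intro A _ _ _ xs hn hxs _
    obtain rfl := List.length_eq_zero_iff.1 hn
    rw [Ideal.ofList_nil, eq_comm, ← isField_iff_maximalIdeal_eq] at hxs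
    exact ⟨hxs.isDomain, IsWeaklyRegular.nil A A⟩
  | succ n ih =>
    intro A _ _ _ xs hn hxs hdim
    obtain ⟨x, xs, rfl⟩ := List.exists_of_length_succ xs hn
    have hlen : xs.length = n := by simpa using hn
    have hx : x ∈ maximalIdeal A := by
      rw [← hxs]; exact Ideal.subset_span (by simp)
    have hx' : Ideal.span {x} ≠ ⊤ := fun h =>
      (maximalIdeal.isMaximal A).ne_top (top_le_iff.1 (h ▸ (Ideal.span_singleton_le_iff_mem _).2 hx))
    let q := Ideal.Quotient.mk (Ideal.span {x})
    have hq : Function.Surjective q := Ideal.Quotient.mk_surjective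
    have : Nontrivial (A ⧸ Ideal.span {x}) := Ideal.Quotient.nontrivial_iff.2 hx'
    have : IsLocalRing (A ⧸ Ideal.span {x}) := IsLocalRing.of_surjective' q hq
    have hm : Ideal.ofList (xs.map q) = maximalIdeal (A ⧸ Ideal.span {x}) := by
      have := (IsLocalRing.map_maximalIdeal_of_surjective q hq)
      rw [← this, ← hxs, Ideal.ofList_cons, Ideal.map_sup, Ideal.map_ofList, Ideal.map_span]
      simp [q]
    have hd : (n : WithBot ℕ∞) ≤ ringKrullDim (A ⧸ Ideal.span {x}) := by
      have h := ringKrullDim_le_ringKrullDim_quotient_add_card {x} (by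
        simpa [IsLocalRing.ringJacobson_eq_maximalIdeal] using hx)
      rw [Finset.coe_singleton, Finset.card_singleton] at h
      have := hdim.trans h
      rw [Nat.cast_add, Nat.cast_one] at this
      exact withBot_le_of_add_one_le_add_one this
    obtain ⟨hdom, hreg⟩ := ih (A ⧸ Ideal.span {x}) (xs.map q) (by simpa) hm hd
    have hd' := ringKrullDim_le_length_of_ofList_eq (xs.map q) hm
    rw [List.length_map, hlen] at hd'
    obtain ⟨P, hP, hPd⟩ := exists_isPrime_le_ringKrullDim_quotient (n + 1) hdim
    have hxP : x ∉ P := fun h => by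
      have h1 := ringKrullDim_le_of_surjective (Ideal.Quotient.factor
        ((Ideal.span_singleton_le_iff_mem P).2 h)) (Ideal.Quotient.factor_surjective _)
      have := (hPd.trans h1).trans hd'
      have : n + 1 ≤ n := by exact_mod_cast this
      omega
    have hPx : P ≤ Ideal.span {x} := by
      intro f hf
      by_contra hfx
      have hf0 : q f ≠ 0 := fun h => hfx (Ideal.Quotient.eq_zero_iff_mem.1 h)
      have h1 := ringKrullDim_quotient_succ_le_of_nonZeroDivisor
        (mem_nonZeroDivisors_of_ne_zero hf0)
      let r := Ideal.Quotient.mk P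
      have : IsLocalRing (A ⧸ P) := IsLocalRing.of_surjective' r Ideal.Quotient.mk_surjective
      have h2 := ringKrullDim_le_ringKrullDim_quotient_add_card {r x} (by
        have := Ideal.mem_map_of_mem r hx
        rw [IsLocalRing.map_maximalIdeal_of_surjective r Ideal.Quotient.mk_surjective] at this
        simpa [IsLocalRing.ringJacobson_eq_maximalIdeal] using this)
      rw [Finset.coe_singleton, Finset.card_singleton] at h2
      let t : A ⧸ Ideal.span {x} →+* (A ⧸ P) ⧸ Ideal.span {r x} :=
        Ideal.Quotient.lift _ ((Ideal.Quotient.mk _).comp r) fun a ha => by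
          obtain ⟨c, rfl⟩ := Ideal.mem_span_singleton.1 ha
          rw [RingHom.comp_apply, Ideal.Quotient.eq_zero_iff_mem, map_mul]
          exact Ideal.mul_mem_right _ _ (Ideal.mem_span_singleton_self _)
      let s : (A ⧸ Ideal.span {x}) ⧸ Ideal.span {q f} →+* (A ⧸ P) ⧸ Ideal.span {r x} :=
        Ideal.Quotient.lift _ t fun a ha => by
          obtain ⟨c, rfl⟩ := Ideal.mem_span_singleton.1 ha
          have : t (q f) = 0 := by
            change Ideal.Quotient.mk _ (r f) = 0
            rw [Ideal.Quotient.eq_zero_iff_mem.2 hf, map_zero]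
          rw [map_mul, this, zero_mul]
      have hs : Function.Surjective s := by
        intro t
        obtain ⟨t, rfl⟩ := Ideal.Quotient.mk_surjective t
        obtain ⟨t, rfl⟩ := Ideal.Quotient.mk_surjective t
        exact ⟨Ideal.Quotient.mk _ (q t), rfl⟩
      have h3 := ringKrullDim_le_of_surjective s hs
      have h4 := ((hPd.trans h2).trans (add_le_add_left h3 1)).trans (h1.trans hd')
      have : n + 1 ≤ n := by exact_mod_cast h4
      omega
    have hP0 : P = ⊥ := by
      refine Submodule.eq_bot_of_le_smul_of_le_jacobson_bot (Ideal.span {x}) P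
        (IsNoetherian.noetherian P) ?_ ?_
      · intro f hf
        obtain ⟨t, rfl⟩ := Ideal.mem_span_singleton.1 (hPx hf)
        have ht := (hP.mem_or_mem hf).resolve_left hxP
        exact Submodule.smul_mem_smul (Ideal.mem_span_singleton_self x) ht
      · rw [IsLocalRing.jacobson_eq_maximalIdeal ⊥ bot_ne_top, Ideal.span_singleton_le_iff_mem]
        exact hx
    have hA : IsDomain A := by
      subst hP0
      exact (MulEquiv.isDomain_iff (RingEquiv.quotientBot A).toMulEquiv).1 inferInstance
    refine ⟨hA, ?_⟩
    rw [isWeaklyRegular_cons_iff]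
    have hx0 : x ≠ 0 := fun h => hxP (h ▸ zero_mem P)
    refine ⟨fun a b hab => mul_left_cancel₀ hx0 hab, ?_⟩
    refine (LinearEquiv.isWeaklyRegular_congr (Submodule.quotEquivOfEq _ _ ?_) xs).1
      ((isWeaklyRegular_map_algebraMap_iff (A ⧸ Ideal.span {x}) (A ⧸ Ideal.span {x}) xs).1 hreg)
    ext a
    rw [Ideal.mem_span_singleton', Submodule.mem_smul_pointwise_iff_exists]
    simp [mul_comm]

end RegularLocal

section Completion

open IsLocalRing RingTheory.Sequence

universe v

theorem exists_adicCompletion_lift {P A : Type*} [CommRing P] [CommRing A] (J : Ideal P)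
    (I : Ideal A) [IsAdicComplete I A] (f : P →+* A) (hf : J ≤ I.comap f) :
    ∃ F : AdicCompletion J P →+* A, ∀ p, F (algebraMap P _ p) = f p := by
  have hn : ∀ n, J ^ n ≤ (I ^ n).comap f := fun n =>
    (Ideal.pow_right_mono hf n).trans (Ideal.le_comap_pow f n)
  let g : ∀ n, AdicCompletion J P →+* A ⧸ I ^ n := fun n =>
    (Ideal.quotientMap (I ^ n) f (hn n)).comp (AdicCompletion.evalₐ J n : _ →+* _)
  have hg : ∀ {m n : ℕ} (hle : m ≤ n), (Ideal.Quotient.factorPow I hle).comp (g n) = g m := by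
    intro m n hle
    ext x
    obtain ⟨c, rfl⟩ := AdicCompletion.mk_surjective J P x
    have hc : Ideal.Quotient.mk (J ^ m) (c.val n) = Ideal.Quotient.mk (J ^ m) (c.val m) := by
      rw [Ideal.Quotient.eq]
      have := SModEq.sub_mem.1 (c.2 hle)
      rw [← neg_sub, smul_eq_mul, Ideal.mul_top] at this
      exact neg_mem_iff.1 this
    have hc' := congrArg (Ideal.quotientMap (I ^ m) f (hn m)) hc
    simpa [g, AdicCompletion.evalₐ_mk] using hc'
  refine ⟨IsAdicComplete.liftRingHom I g hg, fun p => ?_⟩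
  refine congrFun (IsHausdorff.funext' (f := fun p => IsAdicComplete.liftRingHom I g hg
    (algebraMap P _ p)) (g := f) I fun n p => ?_) p
  rw [IsAdicComplete.mk_liftRingHom]
  simp [g, AdicCompletion.algebraMap_apply]

theorem exists_mvPowerSeries_lift {σ : Type*} [Finite σ] {B A : Type*} [CommRing B] [CommRing A]
    (I : Ideal A) [IsAdicComplete I A] (f : B →+* A) (a : σ → A) (ha : ∀ i, a i ∈ I) :
    ∃ F : MvPowerSeries σ B →+* A, (∀ b, F (MvPowerSeries.C b) = f b) ∧
      ∀ i, F (MvPowerSeries.X i) = a i := by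
  obtain ⟨F, hF⟩ := exists_adicCompletion_lift (MvPolynomial.idealOfVars σ B) I
    (MvPolynomial.eval₂Hom f a) (by
      rw [MvPolynomial.idealOfVars, Ideal.span_le]
      rintro _ ⟨i, rfl⟩
      simpa using ha i)
  have h : ∀ p : MvPolynomial σ B, F (MvPowerSeries.toAdicCompletionAlgEquiv σ B p) =
      MvPolynomial.eval₂Hom f a p := fun p => by
    rw [← hF, MvPowerSeries.toAdicCompletionAlgEquiv_apply, MvPowerSeries.toAdicCompletion_coe]
    rfl
  refine ⟨F.comp (MvPowerSeries.toAdicCompletionAlgEquiv σ B : _ →+* _), fun b => ?_, fun i => ?_⟩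
  · have := h (MvPolynomial.C b)
    rw [MvPolynomial.coe_C] at this
    simpa using this
  · have := h (MvPolynomial.X i)
    rw [MvPolynomial.coe_X] at this
    simpa using this

/-- A power series ring surjects onto a ring whose ideal is generated by the images of the
variables as soon as the coefficient ring surjects modulo that ideal. -/
theorem mvPowerSeries_surjective {σ : Type*} [Finite σ] {B A : Type*} [CommRing B] [CommRing A]
    (F : MvPowerSeries σ B →+* A) (I : Ideal A) [IsHausdorff I A]
    (hI : I = Ideal.span (Set.range fun i => F (MvPowerSeries.X i)))
    (h : ∀ a, ∃ b, a - F (MvPowerSeries.C b) ∈ I) : Function.Surjective F := by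
  have hmap : (Ideal.span (Set.range MvPowerSeries.X) : Ideal (MvPowerSeries σ B)).map F = I := by
    rw [hI, Ideal.map_span, ← Set.range_comp]
    rfl
  subst hmap
  refine surjective_of_mk_map_comp_surjective F (I := Ideal.span (Set.range MvPowerSeries.X))
    fun t => ?_
  obtain ⟨a, rfl⟩ := Ideal.Quotient.mk_surjective t
  obtain ⟨b, hb⟩ := h a
  exact ⟨MvPowerSeries.C b, (Ideal.Quotient.eq.2 hb).symm⟩

theorem isNoetherianRing_adicCompletion {A : Type*} [CommRing A] [IsNoetherianRing A]
    (I : Ideal A) : IsNoetherianRing (AdicCompletion I A) := by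
  obtain ⟨s, hs⟩ := (IsNoetherian.noetherian I : I.FG)
  have := AdicCompletion.isAdicComplete_self I ⟨s, hs⟩
  obtain ⟨F, hC, hX⟩ := exists_mvPowerSeries_lift (I.map (algebraMap A (AdicCompletion I A)))
    (algebraMap A (AdicCompletion I A)) (fun i : s => algebraMap A _ (i : A))
    (fun i => Ideal.mem_map_of_mem _ (hs ▸ Ideal.subset_span i.2))
  have hF := mvPowerSeries_surjective F (I.map (algebraMap A (AdicCompletion I A))) (by
    simp only [hX]
    refine (congrArg (Ideal.map _) hs.symm).trans ((Ideal.map_span _ _).trans ?_)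
    congr 1
    ext; simp) fun a => ?_
  · exact isNoetherianRing_of_surjective _ _ F hF
  · obtain ⟨b, hb⟩ := Ideal.Quotient.mk_surjective (AdicCompletion.evalOneₐ I a)
    refine ⟨b, ?_⟩
    rw [hC, ← AdicCompletion.ker_evalOneₐ_eq_map I ⟨s, hs⟩, RingHom.mem_ker, map_sub, sub_eq_zero]
    exact hb.symm

end Completion

section ShiftRegular

open RingTheory.Sequence TensorProduct

theorem isWeaklyRegular_ofFn_of_shift {A W : Type*} [CommRing A] [AddCommGroup W] [Module A W]
    {g : ℕ} (y : Fin g → A) (D : Fin g → W →+ W) (h1 : ∀ i w, D i (y i • w) = w)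
    (h2 : ∀ i j w, j ≠ i → D i (y j • w) = y j • D i w) :
    IsWeaklyRegular W (List.ofFn y) := by
  rw [isWeaklyRegular_iff]
  intro i hi
  have hi' : i < g := by simpa using hi
  have hy : (List.ofFn y)[i] = y ⟨i, hi'⟩ := by simp
  have key : ∀ w ∈ (Ideal.ofList ((List.ofFn y).take i) • ⊤ : Submodule A W),
      D ⟨i, hi'⟩ w ∈ (Ideal.ofList ((List.ofFn y).take i) • ⊤ : Submodule A W) := by
    intro w hw
    induction hw using Submodule.smul_induction_on' with
    | add x _ y _ hx hy => rw [map_add]; exact add_mem hx hy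
    | smul r hr n hn =>
      clear hn
      induction hr using Submodule.span_induction generalizing n with
      | zero => simp
      | add a b _ _ ha hb => rw [add_smul, map_add]; exact add_mem (ha n) (hb n)
      | smul c a _ ha => rw [smul_eq_mul, mul_comm, mul_smul]; exact ha _
      | mem s hs =>
        obtain ⟨j, hj, rfl⟩ := List.mem_take_iff_getElem.1 hs
        have hj' : j < i := by omega
        rw [List.getElem_ofFn, h2 ⟨i, hi'⟩ ⟨j, by omega⟩ n (by simp; omega)]
        refine Submodule.smul_mem_smul (Ideal.subset_span ?_) trivial
        exact List.mem_take_iff_getElem.2 ⟨j, hj, by simp⟩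
  rw [hy, isSMulRegular_iff_right_eq_zero_of_smul]
  intro t ht
  obtain ⟨w, rfl⟩ := Submodule.Quotient.mk_surjective _ t
  rw [← Submodule.Quotient.mk_smul, Submodule.Quotient.mk_eq_zero] at ht
  rw [Submodule.Quotient.mk_eq_zero, ← h1 ⟨i, hi'⟩ w]
  exact key _ ht

theorem isWeaklyRegular_mvPolynomial_tensor {R N : Type*} [CommRing R] [AddCommGroup N]
    [Module R N] (g : ℕ) :
    IsWeaklyRegular (MvPolynomial (Fin g) R ⊗[R] N)
      (List.ofFn (MvPolynomial.X : Fin g → MvPolynomial (Fin g) R)) := by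
  let d : Fin g → MvPolynomial (Fin g) R →ₗ[R] MvPolynomial (Fin g) R := fun i =>
    { toFun := fun p => p.divMonomial (Finsupp.single i 1)
      map_add' := fun a b => MvPolynomial.add_divMonomial _ _ _
      map_smul' := fun r a => by
        ext s
        simp [MvPolynomial.coeff_divMonomial] }
  have hd : ∀ i j p, j ≠ i → d i (MvPolynomial.X j * p) = MvPolynomial.X j * d i p := by
    intro i j p hij
    ext s
    simp only [d, LinearMap.coe_mk, AddHom.coe_mk, MvPolynomial.coeff_divMonomial,
      MvPolynomial.coeff_X_mul']
    have : j ∈ (Finsupp.single i 1 + s).support ↔ j ∈ s.support := by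
      simp [Ne.symm hij]
    rw [if_congr this rfl rfl]
    split_ifs with hs
    · congr 1
      rw [add_tsub_assoc_of_le]
      rw [Finsupp.single_le_iff]
      have := Finsupp.mem_support_iff.1 hs
      omega
    · rfl
  refine isWeaklyRegular_ofFn_of_shift _ (fun i => ((d i).rTensor N).toAddMonoidHom)
    (fun i w => ?_) (fun i j w hij => ?_)
  · induction w with
    | zero => simp
    | add a b ha hb => rw [smul_add, map_add, ha, hb]
    | tmul p n =>
      simp [TensorProduct.smul_tmul', d, MvPolynomial.X_mul_divMonomial]
  · induction w with
    | zero => simp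
    | add a b ha hb => rw [smul_add, map_add, ha, hb, map_add, smul_add]
    | tmul p n =>
      simp [TensorProduct.smul_tmul', hd i j p hij]

/-- The variables form a weakly regular sequence on `U ⊗[R] N` when `U` is flat over the polynomial
ring. -/
theorem isWeaklyRegular_tensor_of_flat_mvPolynomial {R N U : Type*} [CommRing R] [AddCommGroup N]
    [Module R N] [CommRing U] [Algebra R U] (g : ℕ) [Algebra (MvPolynomial (Fin g) R) U]
    [IsScalarTower R (MvPolynomial (Fin g) R) U] [Module.Flat (MvPolynomial (Fin g) R) U] :
    IsWeaklyRegular (U ⊗[R] N)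
      (List.ofFn fun i : Fin g => algebraMap (MvPolynomial (Fin g) R) U (MvPolynomial.X i)) := by
  have h := (isWeaklyRegular_mvPolynomial_tensor (R := R) (N := N) g).of_flat_of_isBaseChange
    (TensorProduct.isBaseChange (MvPolynomial (Fin g) R) (MvPolynomial (Fin g) R ⊗[R] N) U)
  rw [List.map_ofFn] at h
  exact ((TensorProduct.AlgebraTensorModule.cancelBaseChange R (MvPolynomial (Fin g) R) U U
    N).isWeaklyRegular_congr _).1 h

end ShiftRegular

section Deformation

open RingTheory.Sequence TensorProduct IsLocalRing

theorem exists_deformation (R : Type u) [CommRing R] [IsNoetherianRing R] [IsLocalRing R]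
    [IsAdicComplete (maximalIdeal R) R] (g : ℕ) :
    ∃ (U : Type u) (_ : CommRing U) (_ : IsNoetherianRing U) (_ : Algebra R U)
      (_ : Module.Flat R U) (J : Ideal U) (_ : IsAdicComplete J U) (ε : U →+* R) (y : Fin g → U),
      (∀ r ∈ maximalIdeal R, algebraMap R U r ∈ J) ∧ (∀ i, y i ∈ J) ∧
      (∀ r, ε (algebraMap R U r) = r) ∧ RingHom.ker ε = Ideal.span (Set.range y) ∧
      ∀ (N : Type u) [AddCommGroup N] [Module R N], IsWeaklyRegular (U ⊗[R] N) (List.ofFn y) := by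
  let P := MvPolynomial (Fin g) R
  let J : Ideal P := (maximalIdeal R).comap MvPolynomial.constantCoeff
  have hJfg : J.FG := IsNoetherian.noetherian J
  let U := AdicCompletion J P
  have hU := isNoetherianRing_adicCompletion J
  have hcomp := AdicCompletion.isAdicComplete_self J hJfg
  have hfl : Module.Flat P U := AdicCompletion.flat_of_isNoetherian J
  have : IsScalarTower R P U := IsScalarTower.of_algebraMap_eq fun r => rfl
  have hflR : Module.Flat R U := Module.Flat.trans R P U
  obtain ⟨ε, hε⟩ := exists_adicCompletion_lift J (maximalIdeal R) MvPolynomial.constantCoeff le_rfl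
  let y : Fin g → U := fun i => algebraMap P U (MvPolynomial.X i)
  have hεR : ∀ r, ε (algebraMap R U r) = r := fun r => by
    rw [IsScalarTower.algebraMap_apply R P U, hε]
    simp [P]
  have hεy : ∀ i, ε (y i) = 0 := fun i =>
    (hε _).trans (MvPolynomial.constantCoeff_X R i)
  have hle : Ideal.span (Set.range y) ≤ RingHom.ker ε := by
    rw [Ideal.span_le]
    rintro _ ⟨i, rfl⟩
    exact hεy i
  have hX : ∀ i, (MvPolynomial.X i : P) ∈ J := fun i => by simp [J, P]
  have hC : ∀ r ∈ maximalIdeal R, algebraMap R P r ∈ J := fun r hr => by simpa [J, P] using hr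
  have hyJ : ∀ i, y i ∈ J.map (algebraMap P U) := fun i => Ideal.mem_map_of_mem _ (hX i)
  have hRJ : ∀ r ∈ maximalIdeal R, algebraMap R U r ∈ J.map (algebraMap P U) := fun r hr => by
    rw [IsScalarTower.algebraMap_apply R P U]
    exact Ideal.mem_map_of_mem _ (hC r hr)
  have hJU : J.map (algebraMap P U) ≤ (⊥ : Ideal U).jacobson := IsAdicComplete.le_jacobson_bot _
  have hsurj : Function.Surjective ((Ideal.Quotient.mk (Ideal.span (Set.range y))).comp
      (algebraMap R U)) := by
    set q := (Ideal.Quotient.mk (Ideal.span (Set.range y))).comp (algebraMap R U) with hq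
    have hHaus : IsHausdorff ((maximalIdeal R).map q) (U ⧸ Ideal.span (Set.range y)) := by
      apply IsHausdorff.of_le_jacobson
      rw [Ideal.map_le_iff_le_comap]
      intro r hr
      rw [Ideal.mem_comap, Ideal.mem_jacobson_bot]
      intro t
      obtain ⟨t, rfl⟩ := Ideal.Quotient.mk_surjective t
      have := (Ideal.mem_jacobson_bot.1 (hJU (hRJ r hr)) t).map
        (Ideal.Quotient.mk (Ideal.span (Set.range y)))
      simpa [hq] using this
    refine surjective_of_mk_map_comp_surjective q (I := maximalIdeal R) fun t => ?_
    obtain ⟨t, rfl⟩ := Ideal.Quotient.mk_surjective t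
    obtain ⟨t, rfl⟩ := Ideal.Quotient.mk_surjective t
    obtain ⟨p, hp⟩ := Ideal.Quotient.mk_surjective (AdicCompletion.evalOneₐ J t)
    have hmem : t - algebraMap P U p ∈ J.map (algebraMap P U) := by
      rw [← AdicCompletion.ker_evalOneₐ_eq_map J hJfg, RingHom.mem_ker, map_sub, sub_eq_zero]
      exact hp.symm
    refine ⟨MvPolynomial.constantCoeff p, ?_⟩
    rw [RingHom.comp_apply, Ideal.Quotient.eq, hq, RingHom.comp_apply, ← map_sub]
    have h1 : J.map (algebraMap P U) ≤ Ideal.comap (Ideal.Quotient.mk (Ideal.span (Set.range y)))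
        ((maximalIdeal R).map q) := by
      rw [Ideal.map_le_iff_le_comap]
      intro p hp
      have h2 : ∀ p : P, algebraMap P U p - algebraMap R U (MvPolynomial.constantCoeff p) ∈
          Ideal.span (Set.range y) := by
        intro p
        induction p using MvPolynomial.induction_on with
        | C a =>
          rw [MvPolynomial.constantCoeff_C, IsScalarTower.algebraMap_apply R P U]
          simp [P, MvPolynomial.algebraMap_eq]
        | add a b ha hb =>
          rw [map_add, map_add, map_add, add_sub_add_comm]
          exact add_mem ha hb
        | mul_X a i _ =>
          rw [map_mul, map_mul, MvPolynomial.constantCoeff_X, mul_zero, map_zero, sub_zero]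
          exact Ideal.mul_mem_left _ _ (Ideal.subset_span ⟨i, rfl⟩)
      rw [Ideal.mem_comap, Ideal.mem_comap, Ideal.Quotient.eq.2 (h2 p)]
      exact Ideal.mem_map_of_mem q hp
    have h3 : algebraMap R U (MvPolynomial.constantCoeff p) - t ∈ J.map (algebraMap P U) := by
      rw [← neg_sub, Ideal.neg_mem_iff]
      rw [show t - algebraMap R U (MvPolynomial.constantCoeff p) =
        (t - algebraMap P U p) + algebraMap P U (p - MvPolynomial.C (MvPolynomial.constantCoeff p))
        by
          rw [map_sub, IsScalarTower.algebraMap_apply R P U]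
          simp [P, MvPolynomial.algebraMap_eq]]
      refine add_mem hmem (Ideal.mem_map_of_mem _ ?_)
      simp [J, P]
    exact h1 h3
  refine ⟨U, inferInstance, hU, inferInstance, hflR, J.map (algebraMap P U), hcomp, ε, y, hRJ, hyJ,
    hεR, le_antisymm (fun u hu => ?_) hle, fun N _ _ => ?_⟩
  · obtain ⟨r, hr⟩ := hsurj (Ideal.Quotient.mk _ u)
    have h1 := Ideal.Quotient.eq.1 hr
    have h2 : ε (algebraMap R U r - u) = 0 := hle h1
    rw [map_sub, hεR, RingHom.mem_ker.1 hu, sub_zero] at h2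
    rw [h2, map_zero, zero_sub, Ideal.neg_mem_iff] at h1
    exact h1
  · exact isWeaklyRegular_tensor_of_flat_mvPolynomial g

end Deformation

section KernelPrincipal

open RingTheory.Sequence

theorem ker_inf_ofList_le {S T : Type*} [CommRing S] [CommRing T] (f : S →+* T)
    (hf : Function.Surjective f) (zs : List S) (hz : IsWeaklyRegular T (zs.map f)) :
    RingHom.ker f ⊓ Ideal.ofList zs ≤ Ideal.ofList zs * RingHom.ker f := by
  induction zs using List.reverseRecOn with
  | nil => simp
  | append_singleton zs z ih =>
    rw [List.map_append, isWeaklyRegular_append_iff, List.map_singleton,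
      isWeaklyRegular_singleton_iff] at hz
    intro s hs
    obtain ⟨hs1, hs2⟩ := hs
    rw [SetLike.mem_coe, Ideal.ofList_append, Submodule.mem_sup] at hs2
    obtain ⟨a, ha, t, ht, rfl⟩ := hs2
    rw [Ideal.ofList_singleton, Ideal.mem_span_singleton'] at ht
    obtain ⟨b, rfl⟩ := ht
    have hs1 : f a + f b * f z = 0 := by rw [← map_mul, ← map_add]; exact hs1
    have hfa : f a ∈ Ideal.ofList (zs.map f) := by
      rw [← Ideal.map_ofList]; exact Ideal.mem_map_of_mem f ha
    have hfb : f b ∈ Ideal.ofList (zs.map f) := by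
      have h0 : f z • (Submodule.Quotient.mk (f b) :
          T ⧸ (Ideal.ofList (zs.map f) • ⊤ : Submodule T T)) = 0 := by
        rw [← Submodule.Quotient.mk_smul, Submodule.Quotient.mk_eq_zero, smul_eq_mul,
          smul_eq_mul, mul_comm (f z), eq_neg_of_add_eq_zero_right hs1]
        simpa using hfa
      have := (isSMulRegular_iff_right_eq_zero_of_smul.1 hz.2) _ h0
      rw [Submodule.Quotient.mk_eq_zero] at this
      simpa using this
    rw [← Ideal.map_ofList, Ideal.mem_map_iff_of_surjective f hf] at hfb
    obtain ⟨b', hb', hbb⟩ := hfb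
    have h2 : a + z * b' ∈ Ideal.ofList zs * RingHom.ker f := by
      apply ih hz.1
      refine ⟨?_, add_mem ha (Ideal.mul_mem_left _ _ hb')⟩
      rw [SetLike.mem_coe, RingHom.mem_ker, map_add, map_mul, hbb, mul_comm, hs1]
    have h3 : z * (b - b') ∈ Ideal.ofList (zs ++ [z]) * RingHom.ker f := by
      apply Ideal.mul_mem_mul
      · exact Ideal.subset_span (by simp)
      · rw [RingHom.mem_ker, map_sub, hbb, sub_self]
    have h4 : Ideal.ofList zs ≤ Ideal.ofList (zs ++ [z]) := by
      rw [Ideal.ofList_append]; exact le_sup_left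
    have := add_mem (Ideal.mul_mono_left h4 h2) h3
    convert this using 1
    ring

theorem ker_eq_span_singleton {S T : Type*} [CommRing S] [IsNoetherianRing S] [CommRing T]
    (f : S →+* T) (hf : Function.Surjective f) (zs : List S)
    (hz : IsWeaklyRegular T (zs.map f)) (hJ : Ideal.ofList zs ≤ (⊥ : Ideal S).jacobson) (F : S)
    (hF : f F = 0) (h : ∀ s, f s = 0 → ∃ w, s - F * w ∈ Ideal.ofList zs) (s : S) :
    f s = 0 ↔ ∃ t, F * t = s := by
  constructor
  · intro hs
    have hle : RingHom.ker f ≤ Ideal.span {F} := by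
      refine Submodule.le_of_le_smul_of_le_jacobson_bot (IsNoetherian.noetherian _) hJ fun s hs => ?_
      obtain ⟨w, hw⟩ := h s hs
      have h1 : s - F * w ∈ Ideal.ofList zs • RingHom.ker f :=
        ker_inf_ofList_le f hf zs hz ⟨by
          rw [SetLike.mem_coe, RingHom.mem_ker, map_sub, map_mul, hF, zero_mul, sub_zero]
          exact hs, hw⟩
      rw [← add_sub_cancel (F * w) s]
      exact add_mem (Submodule.mem_sup_left (Ideal.mem_span_singleton.2 ⟨w, rfl⟩))
        (Submodule.mem_sup_right h1)
    obtain ⟨t, ht⟩ := Ideal.mem_span_singleton.1 (hle hs)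
    exact ⟨t, ht.symm⟩
  · rintro ⟨t, rfl⟩
    rw [map_mul, hF, zero_mul]

theorem exists_sub_C_mem_span_X {σ B : Type*} [Finite σ] [CommRing B] (s : MvPowerSeries σ B) :
    ∃ b, s - MvPowerSeries.C b ∈ Ideal.span (Set.range (MvPowerSeries.X : σ → MvPowerSeries σ B)) := by
  let e := (MvPowerSeries.toAdicCompletionAlgEquiv σ B)
  obtain ⟨p, hp⟩ := Ideal.Quotient.mk_surjective
    (AdicCompletion.evalOneₐ (MvPolynomial.idealOfVars σ B) (e s))
  have he : ∀ p : MvPolynomial σ B, e p = algebraMap _ _ p := fun p => by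
    rw [MvPowerSeries.toAdicCompletionAlgEquiv_apply, MvPowerSeries.toAdicCompletion_coe]
    rfl
  have hpoly : ∀ p : MvPolynomial σ B, (p : MvPowerSeries σ B) -
      MvPowerSeries.C (MvPolynomial.constantCoeff p) ∈
        Ideal.span (Set.range (MvPowerSeries.X : σ → MvPowerSeries σ B)) := fun p => by
    induction p using MvPolynomial.induction_on with
    | C a => simp
    | add a b ha hb =>
      rw [MvPolynomial.coe_add, map_add, map_add, add_sub_add_comm]
      exact add_mem ha hb
    | mul_X a i _ =>
      rw [MvPolynomial.coe_mul, map_mul, MvPolynomial.constantCoeff_X, mul_zero, map_zero,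
        sub_zero, MvPolynomial.coe_X]
      exact Ideal.mul_mem_left _ _ (Ideal.subset_span ⟨i, rfl⟩)
  refine ⟨MvPolynomial.constantCoeff p, ?_⟩
  rw [← sub_add_sub_cancel s (p : MvPowerSeries σ B)]
  refine add_mem ?_ (hpoly p)
  have h1 : e (s - p) ∈ (MvPolynomial.idealOfVars σ B).map (algebraMap _ (AdicCompletion
      (MvPolynomial.idealOfVars σ B) (MvPolynomial σ B))) := by
    rw [← AdicCompletion.ker_evalOneₐ_eq_map _ (MvPolynomial.idealOfVars_fg σ B), RingHom.mem_ker,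
      map_sub, map_sub, he, sub_eq_zero]
    exact hp.symm
  have h2 : (MvPolynomial.idealOfVars σ B).map (algebraMap _ (AdicCompletion
      (MvPolynomial.idealOfVars σ B) (MvPolynomial σ B))) ≤
      (Ideal.span (Set.range (MvPowerSeries.X : σ → MvPowerSeries σ B))).comap
        (e.symm : _ →+* MvPowerSeries σ B) := by
    rw [Ideal.map_le_iff_le_comap]
    refine Ideal.span_le.2 ?_
    rintro _ ⟨i, rfl⟩
    have : e.symm (algebraMap _ _ (MvPolynomial.X i : MvPolynomial σ B)) = MvPowerSeries.X i := by
      rw [← he]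
      simp [MvPolynomial.coe_X]
    rw [SetLike.mem_coe, Ideal.mem_comap]
    exact (Ideal.subset_span ⟨i, this.symm⟩ : e.symm (algebraMap _ _
      (MvPolynomial.X i : MvPolynomial σ B)) ∈
        Ideal.span (Set.range (MvPowerSeries.X : σ → MvPowerSeries σ B)))
  have := h2 h1
  simpa using this

theorem isNoetherianRing_mvPowerSeries (σ B : Type*) [Finite σ] [CommRing B] [IsNoetherianRing B] :
    IsNoetherianRing (MvPowerSeries σ B) := by
  have := isNoetherianRing_adicCompletion (MvPolynomial.idealOfVars σ B)
  exact isNoetherianRing_of_ringEquiv _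
    (MvPowerSeries.toAdicCompletionAlgEquiv σ B).symm.toRingEquiv

end KernelPrincipal

section CompleteRigidity

open RingTheory.Sequence TensorProduct IsLocalRing

theorem ofList_ofFn {A : Type*} [CommRing A] {n : ℕ} (x : Fin n → A) :
    Ideal.ofList (List.ofFn x) = Ideal.span (Set.range x) := by
  rw [Ideal.ofList]
  congr 1
  ext a
  exact List.mem_ofFn' x a

theorem matExact_of_coefficientRing {R : Type u} [CommRing R] [IsLocalRing R] [IsNoetherianRing R]
    [IsAdicComplete (maximalIdeal R) R] {g : ℕ} (x : Fin (g + 1) → R)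
    (hx : IsWeaklyRegular R (List.ofFn x)) (hxm : Ideal.span (Set.range x) = maximalIdeal R)
    {V : Type u} [CommRing V] [IsDomain V] [IsNoetherianRing V] (σ : V →+* R)
    (hσ : ∀ r, ∃ v, r - σ v ∈ maximalIdeal R) (π : V) (hπ : π ≠ 0)
    (hσπ : ∀ v, σ v ∈ maximalIdeal R ↔ ∃ w, π * w = v)
    {ι : ℕ → Type} [∀ j, Fintype (ι j)]
    (δ : ∀ j, Matrix (ι j) (ι (j + 1)) R) (hδ0 : ∀ j, δ j * δ (j + 1) = 0)
    (hδ : ∀ j, MatExact R (δ (j + 1)) (δ (j + 2))) (N : Type u) [AddCommGroup N] [Module R N]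
    [Module.Finite R N] (h2 : MatExact N (δ 1) (δ 2)) (i : ℕ) :
    MatExact N (δ (i + 1)) (δ (i + 2)) := by
  classical
  obtain ⟨U, _, _, _, _, J, _, ε, y, hRJ, hyJ, hε, hker, hreg⟩ := exists_deformation R (g + 1)
  have hJU : J ≤ (⊥ : Ideal U).jacobson := IsAdicComplete.le_jacobson_bot _
  have hxmem : ∀ i, x i ∈ maximalIdeal R := fun i => hxm ▸ Ideal.subset_span ⟨i, rfl⟩
  have hεy : ∀ i, ε (y i) = 0 := fun i => by
    rw [← RingHom.mem_ker, hker]; exact Ideal.subset_span ⟨i, rfl⟩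
  have hu : ∀ u, u - algebraMap R U (ε u) ∈ Ideal.span (Set.range y) := fun u => by
    rw [← hker, RingHom.mem_ker, map_sub, hε, sub_self]
  obtain ⟨φ, hφC, hφX⟩ := exists_mvPowerSeries_lift J ((algebraMap R U).comp σ)
    (fun i => algebraMap R U (x i) + y i) (fun i => add_mem (hRJ _ (hxmem i)) (hyJ i))
  let S := MvPowerSeries (Fin (g + 1)) V
  have hS : IsNoetherianRing S := isNoetherianRing_mvPowerSeries _ _
  have hlist : Ideal.ofList (List.ofFn (MvPowerSeries.X : Fin (g + 1) → S)) =
      Ideal.span (Set.range MvPowerSeries.X) := ofList_ofFn _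
  have hXJ : Ideal.ofList (List.ofFn (MvPowerSeries.X : Fin (g + 1) → S)) ≤
      (⊥ : Ideal S).jacobson := hlist ▸ IsAdicComplete.le_jacobson_bot _
  -- the map to `R`
  have hψC : ∀ v, (ε.comp φ) (MvPowerSeries.C v) = σ v := fun v => by
    rw [RingHom.comp_apply, hφC, RingHom.comp_apply, hε]
  have hψX : ∀ i, (ε.comp φ) (MvPowerSeries.X i) = x i := fun i => by
    rw [RingHom.comp_apply, hφX, map_add, hε, hεy, add_zero]
  have hψ : Function.Surjective (ε.comp φ) := mvPowerSeries_surjective _ (maximalIdeal R)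
    (by simp only [hψX]; exact hxm.symm) (fun a => by simpa only [hψC] using hσ a)
  have hψspan : ∀ s ∈ Ideal.span (Set.range (MvPowerSeries.X : Fin (g + 1) → S)),
      (ε.comp φ) s ∈ maximalIdeal R := fun s hs => by
    have : Ideal.span (Set.range (MvPowerSeries.X : Fin (g + 1) → S)) ≤
        (maximalIdeal R).comap (ε.comp φ) := by
      rw [Ideal.span_le]
      rintro _ ⟨i, rfl⟩
      rw [SetLike.mem_coe, Ideal.mem_comap, hψX]
      exact hxmem i
    exact this hs
  -- the map to the closed fibre
  let κ : U →+* U ⊗[R] (R ⧸ maximalIdeal R) := Algebra.TensorProduct.includeLeftRingHom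
  have hκ0 : ∀ r ∈ maximalIdeal R, κ (algebraMap R U r) = 0 := fun r hr => by
    change algebraMap R U r ⊗ₜ[R] (1 : R ⧸ maximalIdeal R) = 0
    rw [Algebra.algebraMap_eq_smul_one, TensorProduct.smul_tmul, Algebra.smul_def, mul_one,
      Ideal.Quotient.algebraMap_eq, Ideal.Quotient.eq_zero_iff_mem.2 hr, TensorProduct.tmul_zero]
  have hκs : Function.Surjective κ := fun t => by
    induction t with
    | zero => exact ⟨0, map_zero _⟩
    | add a b ha hb =>
      obtain ⟨a, rfl⟩ := ha
      obtain ⟨b, rfl⟩ := hb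
      exact ⟨a + b, map_add _ _ _⟩
    | tmul u r =>
      obtain ⟨r, rfl⟩ := Ideal.Quotient.mk_surjective r
      refine ⟨r • u, ?_⟩
      change (r • u) ⊗ₜ[R] (1 : R ⧸ maximalIdeal R) = _
      rw [TensorProduct.smul_tmul, Algebra.smul_def, mul_one, Ideal.Quotient.algebraMap_eq]
  let εk : U ⊗[R] (R ⧸ maximalIdeal R) →+* R ⧸ maximalIdeal R :=
    (Algebra.TensorProduct.productMap ((Ideal.Quotient.mkₐ R (maximalIdeal R)).comp
      (AlgHom.mk ε hε)) (AlgHom.id R (R ⧸ maximalIdeal R)) : _ →ₐ[R] _)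
  have hεk : ∀ u, εk (κ u) = Ideal.Quotient.mk _ (ε u) := fun u => by
    change (Algebra.TensorProduct.productMap ((Ideal.Quotient.mkₐ R (maximalIdeal R)).comp
      (AlgHom.mk ε hε)) (AlgHom.id R (R ⧸ maximalIdeal R))) (u ⊗ₜ 1) = _
    rw [Algebra.TensorProduct.productMap_apply_tmul, map_one, mul_one]
    rfl
  let χ : S →+* U ⊗[R] (R ⧸ maximalIdeal R) := κ.comp φ
  have hχX : ∀ i, χ (MvPowerSeries.X i) = κ (y i) := fun i => by
    rw [RingHom.comp_apply, hφX, map_add, hκ0 _ (hxmem i), zero_add]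
  have hNoeth : IsNoetherianRing (U ⊗[R] (R ⧸ maximalIdeal R)) :=
    isNoetherianRing_of_surjective _ _ κ hκs
  have hHaus : IsHausdorff (Ideal.span (Set.range fun i => χ (MvPowerSeries.X i)))
      (U ⊗[R] (R ⧸ maximalIdeal R)) := by
    apply IsHausdorff.of_le_jacobson
    rw [Ideal.span_le]
    rintro _ ⟨i, rfl⟩
    rw [SetLike.mem_coe, Ideal.mem_jacobson_bot]
    intro t
    obtain ⟨t, rfl⟩ := hκs t
    have := (Ideal.mem_jacobson_bot.1 (hJU (hyJ i)) t).map κ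
    simpa [hχX] using this
  have hχ : Function.Surjective χ := mvPowerSeries_surjective χ _ rfl fun a => by
    obtain ⟨u, rfl⟩ := hκs a
    obtain ⟨v, hv⟩ := hσ (ε u)
    refine ⟨v, ?_⟩
    have h1 : κ u - χ (MvPowerSeries.C v) = κ (u - algebraMap R U (ε u)) := by
      have := hκ0 _ hv
      rw [map_sub, map_sub, sub_eq_zero] at this
      rw [RingHom.comp_apply, hφC, RingHom.comp_apply, map_sub, this]
    rw [h1]
    have h2 : Ideal.span (Set.range y) ≤
        (Ideal.span (Set.range fun i => χ (MvPowerSeries.X i))).comap κ := by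
      rw [Ideal.span_le]
      rintro _ ⟨i, rfl⟩
      exact Ideal.subset_span ⟨i, hχX i⟩
    exact h2 (hu u)
  have hχker : ∀ s, χ s = 0 ↔ ∃ t, MvPowerSeries.C π * t = s := by
    refine ker_eq_span_singleton χ hχ (List.ofFn MvPowerSeries.X) ?_ hXJ _ ?_ fun s hs => ?_
    · have h1 : List.map χ (List.ofFn MvPowerSeries.X) =
          (List.ofFn y).map (algebraMap U (U ⊗[R] (R ⧸ maximalIdeal R))) := by
        rw [List.map_ofFn, List.map_ofFn]
        congr 1
        funext i
        exact hχX i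
      rw [h1, isWeaklyRegular_map_algebraMap_iff]
      exact hreg (R ⧸ maximalIdeal R)
    · rw [RingHom.comp_apply, hφC]
      exact hκ0 _ ((hσπ π).2 ⟨1, mul_one π⟩)
    · obtain ⟨b, hb⟩ := exists_sub_C_mem_span_X s
      have h1 : σ b ∈ maximalIdeal R := by
        have h2 : (ε.comp φ) s ∈ maximalIdeal R := by
          rw [← Ideal.Quotient.eq_zero_iff_mem, RingHom.comp_apply, ← hεk]
          exact (congrArg εk hs).trans (map_zero _)
        have h3 := hψspan _ hb
        rw [map_sub, hψC] at h3
        exact (Submodule.sub_mem_iff_right _ h2).1 h3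
      obtain ⟨w, rfl⟩ := (hσπ b).1 h1
      refine ⟨MvPowerSeries.C w, ?_⟩
      rw [hlist, ← map_mul]
      exact hb
  have hπm : σ π ∈ Ideal.span (Set.range x) := hxm ▸ (hσπ π).2 ⟨1, mul_one π⟩
  obtain ⟨c, hc⟩ := (Ideal.mem_span_range_iff_exists_fun).1 hπm
  choose c' hc' using fun i => hψ (c i)
  let F : S := MvPowerSeries.C π - ∑ i, c' i * MvPowerSeries.X i
  have hsumX : ∑ i, c' i * MvPowerSeries.X i ∈
      Ideal.span (Set.range (MvPowerSeries.X : Fin (g + 1) → S)) :=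
    sum_mem fun i _ => Ideal.mul_mem_left _ _ (Ideal.subset_span ⟨i, rfl⟩)
  have hF : F ≠ 0 := fun h => by
    have := congrArg MvPowerSeries.constantCoeff h
    simp only [F, map_sub, map_sum, map_mul, MvPowerSeries.constantCoeff_C,
      MvPowerSeries.constantCoeff_X, mul_zero, Finset.sum_const_zero, sub_zero, map_zero] at this
    exact hπ this
  have hψker : ∀ s, (ε.comp φ) s = 0 ↔ ∃ t, F * t = s := by
    refine ker_eq_span_singleton _ hψ (List.ofFn MvPowerSeries.X) ?_ hXJ F ?_ fun s hs => ?_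
    · rw [List.map_ofFn]
      convert hx using 2
      funext i
      exact hψX i
    · rw [map_sub, hψC, map_sum, ← hc, sub_eq_zero]
      refine Finset.sum_congr rfl fun i _ => ?_
      rw [map_mul, hψX, hc']
    · obtain ⟨b, hb⟩ := exists_sub_C_mem_span_X s
      have h1 : σ b ∈ maximalIdeal R := by
        have h3 := hψspan _ hb
        rwa [map_sub, hψC, hs, zero_sub, neg_mem_iff] at h3
      obtain ⟨w, rfl⟩ := (hσπ b).1 h1
      refine ⟨MvPowerSeries.C w, ?_⟩
      rw [hlist, sub_mul, ← map_mul, ← sub_add]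
      exact add_mem hb (Ideal.mul_mem_right _ _ hsumX)
  have hSd : IsDomain S := NoZeroDivisors.to_isDomain S
  refine matExact_of_hypersurface (List.ofFn x) hx ?_ (S := S) U (fun r hr => hJU (hRJ r hr)) φ ε hε
    hψ F hF hψker (MvPowerSeries.C π) ?_ hχ hχker (y 0) (List.ofFn fun i => y i.succ) ?_
    (fun N _ _ _ => ?_) δ hδ0 hδ N h2 i
  · rw [← hxm, ofList_ofFn]
  · intro h
    apply hπ
    have := congrArg MvPowerSeries.constantCoeff h
    simpa using this
  · rw [← List.ofFn_succ, hker, ofList_ofFn]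
  · rw [← List.ofFn_succ]
    exact hreg N

end CompleteRigidity

section CohenSubring

open IsLocalRing Polynomial

variable {W : Type u} [CommRing W] [IsDomain W] [IsLocalRing W]

/-- A subring of a local domain in which every nonzero element is a unit times a power of `p`,
with all residues in a prescribed subfield. -/
structure IsUnramifiedSubring (p : W) (F : Subfield (ResidueField W)) (V : Subring W) : Prop where
  residue_mem : ∀ x ∈ V, residue W x ∈ F
  exists_eq : ∀ x ∈ V, x ≠ 0 → ∃ n : ℕ, ∃ u ∈ V, ∃ u' ∈ V, u * u' = 1 ∧ x = p ^ n * u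

theorem exists_isUnramifiedSubring_ge (p : W) (F : Subfield (ResidueField W)) (B : Subring W)
    (h1 : ∀ x ∈ B, residue W x ∈ F)
    (h2 : ∀ x ∈ B, x ≠ 0 → ∃ n : ℕ, ∃ u ∈ B, residue W u ≠ 0 ∧ x = p ^ n * u) :
    ∃ V, IsUnramifiedSubring p F V ∧ B ≤ V := by
  have hunit : ∀ g, residue W g ≠ 0 → ∃ g', g * g' = 1 := fun g hg =>
    ((residue_ne_zero_iff_isUnit g).1 hg).exists_right_inv
  let V : Subring W :=
    { carrier := {w | ∃ f ∈ B, ∃ g ∈ B, residue W g ≠ 0 ∧ w * g = f}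
      mul_mem' := by
        rintro a b ⟨f, hf, g, hg, hg0, h⟩ ⟨f', hf', g', hg', hg0', h'⟩
        refine ⟨f * f', mul_mem hf hf', g * g', mul_mem hg hg', ?_, ?_⟩
        · rw [map_mul]; exact mul_ne_zero hg0 hg0'
        · rw [← h, ← h']; ring
      one_mem' := ⟨1, one_mem _, 1, one_mem _, by simp, one_mul 1⟩
      add_mem' := by
        rintro a b ⟨f, hf, g, hg, hg0, h⟩ ⟨f', hf', g', hg', hg0', h'⟩
        refine ⟨f * g' + f' * g, add_mem (mul_mem hf hg') (mul_mem hf' hg), g * g',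
          mul_mem hg hg', ?_, ?_⟩
        · rw [map_mul]; exact mul_ne_zero hg0 hg0'
        · rw [← h, ← h']; ring
      zero_mem' := ⟨0, zero_mem _, 1, one_mem _, by simp, zero_mul 1⟩
      neg_mem' := by
        rintro a ⟨f, hf, g, hg, hg0, h⟩
        exact ⟨-f, neg_mem hf, g, hg, hg0, by rw [← h, neg_mul]⟩ }
  have hBV : B ≤ V := fun b hb => ⟨b, hb, 1, one_mem _, by simp, mul_one b⟩
  have hinv : ∀ f ∈ B, ∀ g ∈ B, residue W g ≠ 0 → ∀ g', g * g' = 1 → f * g' ∈ V :=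
    fun f hf g hg hg0 g' h => ⟨f, hf, g, hg, hg0, by rw [mul_assoc, mul_comm g', h, mul_one]⟩
  refine ⟨V, ⟨?_, ?_⟩, hBV⟩
  · rintro w ⟨f, hf, g, hg, hg0, h⟩
    have : residue W w = residue W f / residue W g := by
      rw [eq_div_iff hg0, ← map_mul, h]
    rw [this]
    exact div_mem (h1 f hf) (h1 g hg)
  · rintro w ⟨f, hf, g, hg, hg0, h⟩ hw
    have hf0 : f ≠ 0 := by
      rw [← h]
      exact mul_ne_zero hw (fun h => hg0 (by rw [h, map_zero]))
    obtain ⟨n, f₀, hf₀, hf₀', rfl⟩ := h2 f hf hf0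
    obtain ⟨g', hg'⟩ := hunit g hg0
    obtain ⟨f', hf'⟩ := hunit f₀ hf₀'
    refine ⟨n, f₀ * g', hinv _ hf₀ _ hg hg0 _ hg', g * f', hinv _ hg _ hf₀ hf₀' _ hf', ?_, ?_⟩
    · calc f₀ * g' * (g * f') = (g * g') * (f₀ * f') := by ring
        _ = 1 := by rw [hg', hf', one_mul]
    · rw [← mul_assoc, ← h, mul_assoc, hg', mul_one]

variable {p : W} {F : Subfield (ResidueField W)} {V : Subring W}

theorem IsUnramifiedSubring.dvd_of_residue_eq_zero (hV : IsUnramifiedSubring p F V) (x : V)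
    (hx : residue W x = 0) (hp : p ∈ V) : (⟨p, hp⟩ : V) ∣ x := by
  by_cases hx0 : x = 0
  · exact hx0 ▸ dvd_zero _
  obtain ⟨n, u, hu, u', hu', huu, h⟩ := hV.exists_eq x x.2 (fun h => hx0 (Subtype.ext h))
  cases n with
  | zero =>
    rw [pow_zero, one_mul] at h
    rw [h] at hx
    have := congrArg (residue W) huu
    rw [map_mul, hx, zero_mul, map_one] at this
    exact absurd this zero_ne_one
  | succ n =>
    exact ⟨⟨p ^ n * u, mul_mem (pow_mem hp n) hu⟩, Subtype.ext (by rw [h, pow_succ']; simp [mul_assoc])⟩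

theorem IsUnramifiedSubring.exists_inv (hV : IsUnramifiedSubring p F V)
    (hp0 : residue W p = 0) (x : V)
    (hx : residue W x ≠ 0) : ∃ y : V, x * y = 1 := by
  obtain ⟨n, u, hu, u', hu', huu, h⟩ := hV.exists_eq x x.2 (fun h => hx (by rw [h, map_zero]))
  cases n with
  | zero => exact ⟨⟨u', hu'⟩, Subtype.ext (by simpa [h] using huu)⟩
  | succ n =>
    rw [h, map_mul, map_pow, hp0] at hx
    simp at hx

theorem IsUnramifiedSubring.exists_primitive (hV : IsUnramifiedSubring p F V)
    (hp : p ∈ V) (hpz : p ≠ 0) (r : V[X]) (hr : r ≠ 0) :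
    ∃ (n : ℕ) (r₀ : V[X]), r = C (⟨p, hp⟩ ^ n) * r₀ ∧
      r₀.map ((residue W).comp V.subtype) ≠ 0 := by
  have key : ∀ (N : ℕ) (r : V[X]) (j : ℕ) (u : V), r.coeff j = ⟨p, hp⟩ ^ N * u →
      residue W u ≠ 0 → ∃ (n : ℕ) (r₀ : V[X]), r = C (⟨p, hp⟩ ^ n) * r₀ ∧
      r₀.map ((residue W).comp V.subtype) ≠ 0 := by
    intro N
    induction N with
    | zero =>
      intro r j u hj hu
      refine ⟨0, r, by simp, fun h => hu ?_⟩
      have := congrArg (coeff · j) h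
      simpa [hj] using this
    | succ N ih =>
      intro r j u hj hu
      by_cases hmap : r.map ((residue W).comp V.subtype) = 0
      · have hdvd : C (⟨p, hp⟩ : V) ∣ r := by
          rw [C_dvd_iff_dvd_coeff]
          intro i
          refine hV.dvd_of_residue_eq_zero _ ?_ hp
          have := congrArg (coeff · i) hmap
          simpa using this
        obtain ⟨r₁, rfl⟩ := hdvd
        rw [coeff_C_mul, pow_succ', mul_assoc] at hj
        have hpV : (⟨p, hp⟩ : V) ≠ 0 := fun h => hpz (congrArg Subtype.val h)
        obtain ⟨n, r₀, rfl, h0⟩ := ih r₁ j u (mul_left_cancel₀ hpV hj) hu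
        exact ⟨n + 1, r₀, by rw [← mul_assoc, ← C_mul, pow_succ'], h0⟩
      · exact ⟨0, r, by simp, hmap⟩
  obtain ⟨n, u, hu, u', hu', huu, h⟩ := hV.exists_eq (r.coeff r.natDegree) (SetLike.coe_mem _)
    (fun h => hr (leadingCoeff_eq_zero.1 (Subtype.ext h)))
  refine key n r r.natDegree ⟨u, hu⟩ (Subtype.ext h) fun h0 => ?_
  have := congrArg (residue W) huu
  rw [map_mul, h0, zero_mul, map_one] at this
  exact zero_ne_one this

/-- Over an unramified subring a polynomial with a nonzero reduction vanishing at `a` yields a monic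
one whose reduction vanishes at `a`, of no larger degree. -/
theorem IsUnramifiedSubring.exists_monic (hV : IsUnramifiedSubring p F V)
    (hp0 : residue W p = 0) (a : ResidueField W) (r : V[X])
    (hr : r.map ((residue W).comp V.subtype) ≠ 0)
    (ha : (r.map ((residue W).comp V.subtype)).eval a = 0) :
    ∃ M : V[X], M.Monic ∧ M.natDegree ≤ r.natDegree ∧
      (M.map ((residue W).comp V.subtype)).eval a = 0 := by
  set ρ := (residue W).comp V.subtype with hρ
  set q := r.map ρ with hq
  have hlc : ρ (r.coeff q.natDegree) ≠ 0 := by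
    rw [← coeff_map]; exact leadingCoeff_ne_zero.2 hr
  obtain ⟨y, hy⟩ := hV.exists_inv hp0 _ hlc
  have hy' : ρ y * q.leadingCoeff = 1 := by
    rw [leadingCoeff, hq, coeff_map, ← map_mul, mul_comm, hy, map_one]
  have hmon : (C (ρ y) * q).Monic := by
    rw [Monic, leadingCoeff_C_mul_of_isUnit (isUnit_iff_ne_zero.2 (left_ne_zero_of_mul_eq_one hy')),
      hy']
  obtain ⟨M, hM, hdeg, hMm⟩ := lifts_and_natDegree_eq_and_monic (f := ρ)
    ((lifts_iff_coeff_lifts _).2 fun n => ⟨y * r.coeff n, by simp [hq]⟩) hmon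
  refine ⟨M, hMm, ?_, ?_⟩
  · rw [hdeg]
    exact (natDegree_C_mul_le _ _).trans natDegree_map_le
  · rw [hM, eval_mul, ha, mul_zero]

end CohenSubring

section CohenSubringMaximal

open IsLocalRing Polynomial

variable {W : Type u} [CommRing W] [IsDomain W] [IsLocalRing W]

variable {p : W} {F : Subfield (ResidueField W)} {V : Subring W}

theorem IsUnramifiedSubring.exists_extension (hV : IsUnramifiedSubring p F V)
    (hp : p ∈ V) (hp0 : residue W p = 0) (hpz : p ≠ 0)
    (hroot : ∀ (M : W[X]) (a : ResidueField W), M.Monic → (M.map (residue W)).eval a = 0 →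
      ∃ α, M.eval α = 0 ∧ residue W α = a) (a : ResidueField W) (haF : a ∈ F) :
    ∃ V', IsUnramifiedSubring p F V' ∧ V ≤ V' ∧ ∃ α ∈ V', residue W α = a := by
  set ρ := (residue W).comp V.subtype with hρ
  obtain ⟨α, hα, hgood⟩ : ∃ α, residue W α = a ∧ ∀ f : V[X], f.eval₂ V.subtype α ≠ 0 →
      ∃ r : V[X], r.eval₂ V.subtype α = f.eval₂ V.subtype α ∧ ∀ r₀ : V[X],
        r₀.natDegree ≤ r.natDegree → r₀.map ρ ≠ 0 → (r₀.map ρ).eval a ≠ 0 := by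
    by_cases hex : ∃ n, ∃ M : V[X], M.Monic ∧ (M.map ρ).eval a = 0 ∧ M.natDegree = n
    · classical
      obtain ⟨M, hM, hMa, hMn⟩ := Nat.find_spec hex
      obtain ⟨α, hα, hαa⟩ := hroot (M.map V.subtype) a (hM.map _) (by
        rw [Polynomial.map_map]; exact hMa)
      refine ⟨α, hαa, fun f hf => ⟨f %ₘ M, ?_, fun r₀ hdeg h0 h => ?_⟩⟩
      · conv_rhs => rw [← modByMonic_add_div f M]
        rw [eval₂_add, eval₂_mul, ← Polynomial.eval_map (p := M), hα, zero_mul, add_zero]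
      · obtain ⟨M', hM', hdeg', hMa'⟩ := hV.exists_monic hp0 a r₀ h0 h
        have h1 : M ≠ 1 := fun h => by
          rw [h, Polynomial.map_one, eval_one] at hMa
          exact one_ne_zero hMa
        have h2 := natDegree_modByMonic_lt f hM h1
        have h3 := Nat.find_min' hex ⟨M', hM', hMa', rfl⟩
        omega
    · obtain ⟨α, hα⟩ := residue_surjective a
      refine ⟨α, hα, fun f _ => ⟨f, rfl, fun r₀ _ h0 h => hex ?_⟩⟩
      obtain ⟨M', hM', _, hMa'⟩ := hV.exists_monic hp0 a r₀ h0 h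
      exact ⟨_, M', hM', hMa', rfl⟩
  have hres : ∀ f : V[X], residue W (f.eval₂ V.subtype α) = (f.map ρ).eval a := fun f => by
    rw [hom_eval₂, hα, Polynomial.eval_map]
  obtain ⟨V', hV', hBV⟩ := exists_isUnramifiedSubring_ge p F
    (eval₂RingHom V.subtype α).range (by
      rintro _ ⟨f, rfl⟩
      rw [coe_eval₂RingHom, hres, Polynomial.eval_map, eval₂_eq_sum_range]
      exact sum_mem fun i _ => mul_mem (hV.residue_mem _ (SetLike.coe_mem _)) (pow_mem haF i)) (by
      rintro _ ⟨f, rfl⟩ hf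
      rw [coe_eval₂RingHom] at hf
      obtain ⟨r, hr, hr'⟩ := hgood f hf
      have hr0 : r ≠ 0 := fun h => hf (by rw [← hr, h, eval₂_zero])
      obtain ⟨n, r₀, rfl, h0⟩ := hV.exists_primitive hp hpz r hr0
      refine ⟨n, r₀.eval₂ V.subtype α, ⟨r₀, rfl⟩, ?_, ?_⟩
      · rw [hres]
        refine hr' r₀ ?_ h0
        rw [natDegree_C_mul]
        exact pow_ne_zero _ fun h => hpz (congrArg Subtype.val h)
      · rw [coe_eval₂RingHom, ← hr, eval₂_mul, eval₂_C, map_pow]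
        rfl)
  exact ⟨V', hV', fun v hv => hBV ⟨C ⟨v, hv⟩, by simp⟩, α, hBV ⟨X, by simp⟩, hα⟩

/-- An unramified subring with prescribed residue field. -/
theorem exists_isUnramifiedSubring (p : ℕ) (hpp : p.Prime) (hp0 : residue W p = 0)
    (hpz : ∀ n : ℤ, n ≠ 0 → (n : W) ≠ 0) (F : Subfield (ResidueField W))
    (hroot : ∀ (M : W[X]) (a : ResidueField W), M.Monic → (M.map (residue W)).eval a = 0 →
      ∃ α, M.eval α = 0 ∧ residue W α = a) :
    ∃ V, IsUnramifiedSubring (p : W) F V ∧ ∀ a ∈ F, ∃ v ∈ V, residue W v = a := by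
  have hpz' : (p : W) ≠ 0 := by exact_mod_cast hpz p (by exact_mod_cast hpp.ne_zero)
  obtain ⟨V₀, hV₀, -⟩ := exists_isUnramifiedSubring_ge (p : W) F (Int.castRingHom W).range (by
      rintro _ ⟨n, rfl⟩
      simp) (by
      rintro _ ⟨n, rfl⟩ hn
      have hn0 : n ≠ 0 := fun h => hn (by rw [h]; simp)
      obtain ⟨m, hm, hpm⟩ := (Int.finiteMultiplicity_iff.2
        ⟨by simpa using hpp.ne_one, hn0⟩ : FiniteMultiplicity (p : ℤ) n).exists_eq_pow_mul_and_not_dvd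
      refine ⟨multiplicity (p : ℤ) n, (m : W), ⟨m, by simp⟩, fun h => ?_, ?_⟩
      · obtain ⟨b, c, hbc⟩ := (Nat.prime_iff_prime_int.1 hpp).coprime_iff_not_dvd.2 hpm
        have := congrArg (fun z : ℤ => residue W z) hbc
        simp only [Int.cast_add, Int.cast_mul, map_add, map_mul, h, mul_zero, Int.cast_natCast, hp0,
          add_zero, Int.cast_one, map_one] at this
        exact zero_ne_one this
      · rw [eq_intCast]
        conv_lhs => rw [hm]
        push_cast
        rfl)
  have hchain : ∀ c ⊆ {V | IsUnramifiedSubring (p : W) F V}, IsChain (· ≤ ·) c → ∀ y ∈ c,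
      ∃ ub ∈ {V | IsUnramifiedSubring (p : W) F V}, ∀ z ∈ c, z ≤ ub := by
    intro c hc hch y hy
    have hmem : ∀ {x}, x ∈ sSup c ↔ ∃ s ∈ c, x ∈ s := fun {x} =>
      Subring.mem_sSup_of_directedOn ⟨y, hy⟩ hch.directedOn
    refine ⟨sSup c, ⟨fun x hx => ?_, fun x hx hx0 => ?_⟩, fun z hz => le_sSup hz⟩
    · obtain ⟨s, hs, hxs⟩ := hmem.1 hx
      exact (hc hs).residue_mem x hxs
    · obtain ⟨s, hs, hxs⟩ := hmem.1 hx
      obtain ⟨n, u, hu, u', hu', h⟩ := (hc hs).exists_eq x hxs hx0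
      exact ⟨n, u, hmem.2 ⟨s, hs, hu⟩, u', hmem.2 ⟨s, hs, hu'⟩, h⟩
  obtain ⟨V, -, hV⟩ := zorn_le_nonempty₀ _ hchain V₀ hV₀
  refine ⟨V, hV.prop, fun a ha => ?_⟩
  obtain ⟨V', hV', hle, α, hα, hαa⟩ := IsUnramifiedSubring.exists_extension hV.prop (natCast_mem V p)
    hp0 hpz' hroot a ha
  exact ⟨α, hV.le_of_ge hV' hle hα, hαa⟩

theorem exists_root_of_isAlgClosed {Ω : Type u} [Field Ω] [IsAlgClosed Ω] (W : ValuationSubring Ω)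
    (M : W[X]) (a : ResidueField W) (hM : M.Monic) (ha : (M.map (residue W)).eval a = 0) :
    ∃ α, M.eval α = 0 ∧ residue W α = a := by
  induction h : M.natDegree generalizing M with
  | zero =>
    rw [hM.natDegree_eq_zero.1 h, Polynomial.map_one, eval_one] at ha
    exact absurd ha one_ne_zero
  | succ n ih =>
    obtain ⟨β, hβ⟩ := IsAlgClosed.exists_eval₂_eq_zero_of_injective (algebraMap W Ω)
      (IsFractionRing.injective W Ω) M (by
        rw [degree_eq_natDegree hM.ne_zero, h]; exact_mod_cast Nat.succ_ne_zero n)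
    obtain ⟨β, rfl⟩ := IsIntegrallyClosed.isIntegral_iff.1 (⟨M, hM, hβ⟩ : IsIntegral W β)
    have hβ' : M.IsRoot β := by
      apply IsFractionRing.injective W Ω
      rw [map_zero, ← hβ, eval₂_at_apply]
    by_cases hβa : residue W β = a
    · exact ⟨β, hβ', hβa⟩
    · obtain ⟨q, rfl⟩ := dvd_iff_isRoot.2 hβ'
      have hq : q.Monic := (monic_X_sub_C β).of_mul_monic_left hM
      rw [Polynomial.map_mul, eval_mul, mul_eq_zero] at ha
      obtain ⟨α, h1, h2⟩ := ih q hq (ha.resolve_left (by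
        simpa [sub_eq_zero] using Ne.symm hβa)) (by
        rw [(monic_X_sub_C β).natDegree_mul hq, natDegree_X_sub_C] at h; omega)
      exact ⟨α, by rw [eval_mul, h1, mul_zero], h2⟩

end CohenSubringMaximal

section CohenRing

open IsLocalRing

theorem IsUnramifiedSubring.isNoetherianRing {W : Type u} [CommRing W] [IsDomain W] [IsLocalRing W]
    {p : W} {F : Subfield (ResidueField W)} {V : Subring W} (hV : IsUnramifiedSubring p F V)
    (hpV : p ∈ V) (hp0 : p ≠ 0) (hp : residue W p = 0) : IsNoetherianRing V := by
  have hpu : ¬ IsUnit (⟨p, hpV⟩ : V) := fun h => by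
    have := (h.map V.subtype)
    exact ((residue_ne_zero_iff_isUnit p).2 this) hp
  have key : ∀ x : V, x ≠ 0 → ∃ n : ℕ, Associated ((⟨p, hpV⟩ : V) ^ n) x := by
    intro x hx
    obtain ⟨n, w, hw, w', hw', hww, hx'⟩ := hV.exists_eq x x.2 (fun h => hx (Subtype.ext h))
    refine ⟨n, ⟨⟨w, hw⟩, ⟨w', hw'⟩, Subtype.ext hww, Subtype.ext (by rw [mul_comm] at hww; exact hww)⟩, ?_⟩
    exact Subtype.ext (by simpa using hx'.symm)
  have hpr : Irreducible (⟨p, hpV⟩ : V) := by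
    refine ⟨hpu, fun a b hab => ?_⟩
    have hne : (⟨p, hpV⟩ : V) ≠ 0 := fun h => hp0 (congrArg Subtype.val h)
    have ha : a ≠ 0 := by rintro rfl; exact hne (by simpa using hab)
    have hb : b ≠ 0 := by rintro rfl; exact hne (by simpa using hab)
    obtain ⟨n, hn⟩ := key a ha
    obtain ⟨m, hm⟩ := key b hb
    rcases n with _ | n
    · left; simpa using hn.isUnit (by simp)
    rcases m with _ | m
    · right; simpa using hm.isUnit (by simp)
    exfalso
    obtain ⟨c, hc⟩ : (⟨p, hpV⟩ : V) ∣ a := (dvd_pow_self _ (Nat.succ_ne_zero n)).trans hn.dvd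
    obtain ⟨d, hd⟩ : (⟨p, hpV⟩ : V) ∣ b := (dvd_pow_self _ (Nat.succ_ne_zero m)).trans hm.dvd
    apply hpu
    refine .of_mul_eq_one (c * d) ?_
    refine mul_left_cancel₀ hne ?_
    rw [hc, hd] at hab
    rw [mul_one]
    conv_rhs => rw [hab]
    ring
  have : IsDiscreteValuationRing V :=
    IsDiscreteValuationRing.ofHasUnitMulPowIrreducibleFactorization
      ⟨_, hpr, fun {x} hx => key x hx⟩
  infer_instance

theorem exists_valuationSubring_isAlgClosed (L : Type u) [CommRing L] [IsDomain L]
    [IsLocalRing L] : ∃ (Ω : Type u) (_ : Field Ω) (_ : IsAlgClosed Ω) (W : ValuationSubring Ω)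
      (f : L →+* W), IsLocalHom f ∧ Function.Injective f := by
  let g : L →+* AlgebraicClosure (FractionRing L) :=
    (algebraMap (FractionRing L) _).comp (algebraMap L (FractionRing L))
  obtain ⟨W, hW, hloc⟩ := IsLocalRing.exists_factor_valuationRing g
  refine ⟨_, inferInstance, inferInstance, W, g.codRestrict W.toSubring hW, hloc, ?_⟩
  intro a b hab
  have h1 : g a = g b := congrArg Subtype.val hab
  exact IsFractionRing.injective L (FractionRing L) ((algebraMap (FractionRing L) _).injective h1)

theorem exists_cohenRing (k : Type u) [Field k] (p : ℕ) (hp : p.Prime) [CharP k p] :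
    ∃ (V : Type u) (_ : CommRing V) (_ : IsDomain V) (_ : IsNoetherianRing V) (ρ : V →+* k),
      Function.Surjective ρ ∧ (p : V) ≠ 0 ∧ ∀ v, ρ v = 0 → (p : V) ∣ v := by
  let ρA : MvPolynomial k ℤ →+* k := MvPolynomial.eval₂Hom (Int.castRingHom k) id
  have hρA : Function.Surjective ρA := fun a => ⟨MvPolynomial.X a, by simp [ρA]⟩
  let P : Ideal (MvPolynomial k ℤ) := RingHom.ker ρA
  have hP : P.IsPrime := RingHom.ker_isPrime ρA
  let L := Localization.AtPrime P
  have : IsDomain L := IsLocalization.isDomain_localization P.primeCompl_le_nonZeroDivisors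
  obtain ⟨Ω, _, _, W, f, hf, hfinj⟩ := exists_valuationSubring_isAlgClosed L
  let h : MvPolynomial k ℤ →+* W := f.comp (algebraMap _ L)
  have hinj : Function.Injective h := hfinj.comp
    (IsLocalization.injective L P.primeCompl_le_nonZeroDivisors)
  have hker : ∀ a, ρA a = 0 → residue W (h a) = 0 := by
    intro a ha
    by_contra hc
    have h1 : IsUnit (algebraMap _ L a) :=
      isUnit_of_map_unit f _ ((residue_ne_zero_iff_isUnit _).1 hc)
    exact ((IsLocalization.AtPrime.isUnit_to_map_iff L P a).1 h1) ha
  let i : k →+* ResidueField W := RingHom.liftOfSurjective ρA hρA ⟨(residue W).comp h, hker⟩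
  have hi : ∀ a, i (ρA a) = residue W (h a) := fun a =>
    RingHom.liftOfRightInverse_comp_apply ρA _ _ ⟨(residue W).comp h, hker⟩ a
  have hpW : residue W (p : W) = 0 := by
    have := hi (p : MvPolynomial k ℤ)
    rw [map_natCast, CharP.cast_eq_zero, map_zero, map_natCast] at this
    exact this.symm
  have hz : ∀ n : ℤ, n ≠ 0 → (n : W) ≠ 0 := by
    intro n hn hc
    have : h (n : MvPolynomial k ℤ) = h 0 := by rw [map_intCast, hc, map_zero]
    exact hn (Int.cast_eq_zero.1 (hinj this))
  obtain ⟨V, hV, hFV⟩ := exists_isUnramifiedSubring p hp hpW hz i.fieldRange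
    (fun M a hM ha => exists_root_of_isAlgClosed W M a hM ha)
  have hpV : (p : W) ∈ V := natCast_mem V p
  have hpne : (p : W) ≠ 0 := by
    have := hz p (by exact_mod_cast hp.ne_zero)
    simpa using this
  let e : k ≃+* i.fieldRange := RingEquiv.ofBijective i.rangeRestrictField
    ⟨i.rangeRestrictField.injective, i.rangeRestrictField_bijective.2⟩
  let ρ : V →+* k := e.symm.toRingHom.comp
    (((residue W).comp V.subtype).codRestrict i.fieldRange (fun x => hV.residue_mem x x.2))
  have hρ : ∀ v a, ρ v = a ↔ residue W v = i a := by
    intro v a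
    have : ρ v = a ↔ _ = e a := e.symm_apply_eq
    rw [this, Subtype.ext_iff]
    rfl
  refine ⟨V, inferInstance, inferInstance, hV.isNoetherianRing hpV hpne hpW, ρ, ?_, ?_, ?_⟩
  · intro a
    obtain ⟨v, hv, hva⟩ := hFV (i a) ⟨a, rfl⟩
    exact ⟨⟨v, hv⟩, (hρ _ _).2 hva⟩
  · intro hc
    exact hpne (by simpa using congrArg V.subtype hc)
  · intro v hv
    have := hV.dvd_of_residue_eq_zero v (by rw [(hρ v 0).1 hv, map_zero]) hpV
    have h2 : (⟨(p : W), hpV⟩ : V) = (p : V) := Subtype.ext (by simp)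
    rwa [h2] at this

end CohenRing

section CoefficientField

open Polynomial

theorem exists_subring_injective_extension {Q k : Type*} [CommRing Q] [Field k] (p : ℕ)
    [Fact p.Prime] [CharP Q p] (f : Q →+* k) (hf : Function.Surjective f)
    (S : Subring Q) (hpow : ∀ x, x ^ p ∈ S)
    (hS : ∀ x ∈ S, f x = 0 → x = 0) (b : Q) (hb : ∀ x ∈ S, f x ≠ f b) :
    ∃ T : Subring Q, S ≤ T ∧ b ∈ T ∧ ∀ x ∈ T, f x = 0 → x = 0 := by
  have : CharP k p := (CharP.charP_iff_prime_eq_zero (Fact.out : p.Prime)).2 (by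
    rw [← map_natCast f p, CharP.cast_eq_zero, map_zero])
  let K : Subfield k :=
    { S.map f with
      inv_mem' := by
        rintro _ ⟨x, hx, rfl⟩
        by_cases hx0 : f x = 0
        · rw [hx0, inv_zero]
          exact ⟨0, S.zero_mem, map_zero f⟩
        obtain ⟨y, hy⟩ := hf (f x)⁻¹
        refine ⟨x ^ (p - 1) * y ^ p, S.mul_mem (S.pow_mem hx _) (hpow y), ?_⟩
        obtain ⟨q, hq⟩ := Nat.exists_eq_succ_of_ne_zero (Fact.out : p.Prime).ne_zero
        rw [map_mul, map_pow, map_pow, hy, hq, Nat.succ_sub_one, Nat.succ_eq_add_one, pow_succ,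
          ← mul_assoc, ← mul_pow, mul_inv_cancel₀ hx0, one_pow, one_mul] }
  let g : S →+* K := (f.comp S.subtype).codRestrict K (fun x => ⟨x, x.2, rfl⟩)
  have hg : Function.Injective g := (injective_iff_map_eq_zero g).2 fun x hx =>
    Subtype.ext (hS x x.2 (congrArg Subtype.val hx))
  have : Nontrivial S := g.domain_nontrivial
  let c : S := ⟨b ^ p, hpow b⟩
  have hirr : Irreducible (X ^ p - C (g c) : K[X]) := by
    refine X_pow_sub_C_irreducible_of_prime Fact.out fun y hy => ?_
    obtain ⟨x, hx, hxy⟩ := y.2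
    refine hb x hx (frobenius_inj k p ?_)
    have := congrArg Subtype.val hy
    simp only [frobenius_def, ← map_pow]
    rw [map_pow, hxy]
    exact this
  have hmin : minpoly K (f b) = X ^ p - C (g c) := by
    refine (minpoly.eq_of_irreducible_of_monic hirr ?_
      (monic_X_pow_sub_C _ (Fact.out : p.Prime).ne_zero)).symm
    have : algebraMap K k (g c) = f b ^ p := map_pow f b p
    simp [this]
  refine ⟨(Algebra.adjoin S {b}).toSubring, fun x hx =>
    (Algebra.adjoin S {b}).algebraMap_mem ⟨x, hx⟩, Algebra.self_mem_adjoin_singleton S b, ?_⟩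
  intro x hx hfx
  have hx' : x ∈ Algebra.adjoin S {b} := hx
  rw [Algebra.adjoin_singleton_eq_range_aeval] at hx'
  obtain ⟨P, rfl⟩ := hx'
  have hmon : (X ^ p - C c : S[X]).Monic := monic_X_pow_sub_C _ (Fact.out : p.Prime).ne_zero
  have hroot : aeval b (X ^ p - C c : S[X]) = 0 := by
    have : algebraMap S Q c = b ^ p := rfl
    simp [this]
  have hP := modByMonic_add_div P (X ^ p - C c : S[X])
  set r := P %ₘ (X ^ p - C c : S[X]) with hr
  have hPr : aeval b P = aeval b r := by
    rw [← hP, map_add, map_mul, hroot, zero_mul, add_zero]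
  have hfr : aeval (f b) (r.map g) = 0 := by
    rw [← hfx]
    change _ = f (aeval b P)
    rw [hPr, aeval_def, aeval_def, eval₂_map, hom_eval₂]
    rfl
  have hr0 : r.map g = 0 := by
    refine eq_zero_of_dvd_of_degree_lt (minpoly.dvd K (f b) hfr) ?_
    rw [hmin]
    refine (degree_map_le).trans_lt ?_
    refine (degree_modByMonic_lt P hmon).trans_le ?_
    rw [degree_X_pow_sub_C (Fact.out : p.Prime).pos, degree_X_pow_sub_C (Fact.out : p.Prime).pos]
  have : r = 0 := (Polynomial.map_eq_zero_iff hg).1 hr0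
  change aeval b P = 0
  rw [hPr, this, map_zero]

theorem exists_section_of_charP {Q k : Type*} [CommRing Q] [Field k] (p : ℕ)
    [Fact p.Prime] [CharP Q p] (f : Q →+* k) (hf : Function.Surjective f)
    (hker : ∀ x, f x = 0 → x ^ 2 = 0) :
    ∃ s : k →+* Q, f.comp s = RingHom.id k := by
  have h2 : 2 ≤ p := (Fact.out : p.Prime).two_le
  obtain ⟨S, hle, hmax⟩ := zorn_le_nonempty₀
    {S : Subring Q | (∀ x, x ^ p ∈ S) ∧ ∀ x ∈ S, f x = 0 → x = 0} (by
      intro c hc hchain y hy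
      refine ⟨sSup c, ⟨fun x => ?_, fun x hx => ?_⟩, fun z hz => le_sSup hz⟩
      · exact le_sSup hy ((hc hy).1 x)
      · obtain ⟨S, hS, hxS⟩ := (Subring.mem_sSup_of_directedOn ⟨y, hy⟩ hchain.directedOn).1 hx
        exact (hc hS).2 x hxS) (frobenius Q p).range (by
      refine ⟨fun x => ⟨x, rfl⟩, ?_⟩
      rintro _ ⟨x, rfl⟩ hx
      rw [frobenius_def, map_pow] at hx
      have := hker x (pow_eq_zero_iff (by omega) |>.1 hx)
      exact pow_eq_zero_of_le h2 this)
  have hsurj : Function.Surjective (f.comp S.subtype) := by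
    intro a
    by_contra hc
    obtain ⟨b, rfl⟩ := hf a
    obtain ⟨T, hST, hbT, hT⟩ := exists_subring_injective_extension p f hf S hmax.prop.1 hmax.prop.2 b
      (fun x hx h => hc ⟨⟨x, hx⟩, h⟩)
    have := hmax.le_of_ge ⟨fun x => hST (hmax.prop.1 x), hT⟩ hST
    exact hc ⟨⟨b, this hbT⟩, rfl⟩
  let e : S ≃+* k := RingEquiv.ofBijective (f.comp S.subtype)
    ⟨(injective_iff_map_eq_zero _).2 fun x hx => Subtype.ext (hmax.prop.2 x x.2 hx), hsurj⟩
  exact ⟨S.subtype.comp e.symm.toRingHom, RingHom.ext fun x => e.apply_symm_apply x⟩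

end CoefficientField

section LiftCohen

theorem exists_lift_of_square_zero {V B C k : Type*} [CommRing V] [IsDomain V] [CommRing B]
    [CommRing C] [Field k] (p : ℕ) [Fact p.Prime] [CharP k p] (ρ : V →+* k)
    (hρ : Function.Surjective ρ) (hρp : ∀ v, ρ v = 0 → (p : V) ∣ v) (hp : (p : V) ≠ 0)
    (q : B →+* C) (hq : Function.Surjective q) (hqp : ∀ x, q x = 0 → (p : B) * x = 0)
    (hqq : ∀ x y, q x = 0 → q y = 0 → x * y = 0) (s : V →+* C) :
    ∃ t : V →+* B, q.comp t = s := by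
  let E : Subring (V × B) := (s.comp (RingHom.fst V B)).eqLocus (q.comp (RingHom.snd V B))
  have hE : ∀ e : E, s e.1.1 = q e.1.2 := fun e => e.2
  let π : E →+* V := (RingHom.fst V B).comp E.subtype
  have hπ : ∀ v, ∃ e : E, π e = v := fun v => by
    obtain ⟨b, hb⟩ := hq (s v)
    exact ⟨⟨(v, b), hb.symm⟩, rfl⟩
  let J : Ideal E := Ideal.span {(p : E)}
  have hJ : ∀ e ∈ J, π e = 0 → e = 0 := by
    intro e he h0
    obtain ⟨c, rfl⟩ := Ideal.mem_span_singleton.1 he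
    rw [map_mul, map_natCast] at h0
    have hc : π c = 0 := (mul_eq_zero.1 h0).resolve_left hp
    have hcq : q c.1.2 = 0 := by rw [← hE, show c.1.1 = 0 from hc, map_zero]
    refine Subtype.ext (Prod.ext ?_ ?_)
    · change π (p * c) = 0
      rw [map_mul, hc, mul_zero]
    · have : ((p * c : E) : V × B).2 = (p : B) * c.1.2 := by simp
      rw [this, hqp _ hcq]
      rfl
  let f : E ⧸ J →+* k := Ideal.Quotient.lift J (ρ.comp π) (by
    intro e he
    obtain ⟨c, rfl⟩ := Ideal.mem_span_singleton.1 he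
    rw [map_mul, map_natCast, CharP.cast_eq_zero, zero_mul])
  have hf : Function.Surjective f := by
    intro a
    obtain ⟨v, rfl⟩ := hρ a
    obtain ⟨e, rfl⟩ := hπ v
    exact ⟨Ideal.Quotient.mk J e, rfl⟩
  have hfe : ∀ e, f (Ideal.Quotient.mk J e) = ρ (π e) := fun e => rfl
  have hsub : ∀ e, ρ (π e) = 0 → ∃ e', π e' = 0 ∧
      Ideal.Quotient.mk J e' = Ideal.Quotient.mk J e := by
    intro e he
    obtain ⟨v, hv⟩ := hρp _ he
    obtain ⟨e₁, rfl⟩ := hπ v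
    refine ⟨e - p * e₁, by rw [map_sub, hv, map_mul, map_natCast, sub_self], ?_⟩
    rw [map_sub, sub_eq_self]
    exact Ideal.Quotient.eq_zero_iff_mem.2 (J.mul_mem_right _ (Ideal.mem_span_singleton_self _))
  have hnil : ∀ e : E, π e = 0 → e ^ 2 = 0 := by
    intro e he
    have heq : q e.1.2 = 0 := by rw [← hE, show e.1.1 = 0 from he, map_zero]
    refine Subtype.ext (Prod.ext ?_ ?_)
    · change π (e ^ 2) = 0
      rw [map_pow, he, zero_pow two_ne_zero]
    · have : ((e ^ 2 : E) : V × B).2 = e.1.2 * e.1.2 := by simp [sq]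
      rw [this, hqq _ _ heq heq]
      rfl
  have hker : ∀ x, f x = 0 → x ^ 2 = 0 := by
    intro x hx
    obtain ⟨e, rfl⟩ := Ideal.Quotient.mk_surjective x
    obtain ⟨e', h0, he'⟩ := hsub e hx
    rw [← he', ← map_pow, hnil e' h0, map_zero]
  have : Nontrivial (E ⧸ J) := f.domain_nontrivial
  have : CharP (E ⧸ J) p := (CharP.charP_iff_prime_eq_zero (Fact.out : p.Prime)).2 (by
    rw [← map_natCast (Ideal.Quotient.mk J)]
    exact Ideal.Quotient.eq_zero_iff_mem.2 (Ideal.mem_span_singleton_self _))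
  obtain ⟨σ, hσ⟩ := exists_section_of_charP p f hf hker
  let φ : E →+* V × (E ⧸ J) := π.prod (Ideal.Quotient.mk J)
  have hφ : Function.Injective φ := (injective_iff_map_eq_zero φ).2 fun e he =>
    hJ e (Ideal.Quotient.eq_zero_iff_mem.1 (congrArg Prod.snd he)) (congrArg Prod.fst he)
  let T : V →+* V × (E ⧸ J) := (RingHom.id V).prod (σ.comp ρ)
  have hT : ∀ v, T v ∈ φ.range := by
    intro v
    obtain ⟨e, he⟩ := hπ v
    obtain ⟨d, hd⟩ := Ideal.Quotient.mk_surjective (σ (ρ v))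
    have h1 : ρ (π d) = ρ v := by
      rw [← hfe, hd]; exact RingHom.congr_fun hσ (ρ v)
    obtain ⟨c, hc0, hc⟩ := hsub (d - e) (by rw [map_sub, map_sub, h1, he, sub_self])
    refine ⟨e + c, Prod.ext ?_ ?_⟩
    · change π (e + c) = v
      rw [map_add, he, hc0, add_zero]
    · change Ideal.Quotient.mk J (e + c) = σ (ρ v)
      rw [map_add, hc, map_sub, hd]
      ring
  let ψ : E ≃+* φ.range := RingEquiv.ofBijective φ.rangeRestrict
    ⟨fun a b hab => hφ (congrArg Subtype.val hab), φ.rangeRestrict_surjective⟩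
  let τ : V →+* E := ψ.symm.toRingHom.comp (T.codRestrict φ.range hT)
  have hτ : ∀ v, π (τ v) = v := by
    intro v
    have : ψ (τ v) = ⟨T v, hT v⟩ := ψ.apply_symm_apply _
    exact congrArg (fun z => z.1.1) this
  refine ⟨((RingHom.snd V B).comp E.subtype).comp τ, RingHom.ext fun v => ?_⟩
  have := hE (τ v)
  rw [show (τ v).1.1 = v from hτ v] at this
  exact this.symm

theorem exists_lift_factorPow {R V k : Type*} [CommRing R] [CommRing V] [IsDomain V] [Field k]
    (p : ℕ) [Fact p.Prime] [CharP k p] (ρ : V →+* k) (hρ : Function.Surjective ρ)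
    (hρp : ∀ v, ρ v = 0 → (p : V) ∣ v) (hp : (p : V) ≠ 0) (I : Ideal R) (hpm : (p : R) ∈ I)
    (j : ℕ) (s : V →+* R ⧸ I ^ (j + 1)) :
    ∃ t : V →+* R ⧸ I ^ (j + 1 + 1),
        (Ideal.Quotient.factorPow I (Nat.le_succ (j + 1))).comp t = s := by
  have hmem : ∀ r : R, Ideal.Quotient.factorPow I (Nat.le_succ (j + 1))
      (Ideal.Quotient.mk _ r) = 0 → r ∈ I ^ (j + 1) := fun r hr =>
    Ideal.Quotient.eq_zero_iff_mem.1 hr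
  refine exists_lift_of_square_zero p ρ hρ hρp hp _ ?_ ?_ ?_ s
  · exact Ideal.Quotient.factor_surjective _
  · intro x hx
    obtain ⟨r, rfl⟩ := Ideal.Quotient.mk_surjective x
    rw [← map_natCast (Ideal.Quotient.mk _), ← map_mul]
    refine Ideal.Quotient.eq_zero_iff_mem.2 ?_
    rw [pow_succ']
    exact Ideal.mul_mem_mul hpm (hmem r hx)
  · intro x y hx hy
    obtain ⟨r, rfl⟩ := Ideal.Quotient.mk_surjective x
    obtain ⟨r', rfl⟩ := Ideal.Quotient.mk_surjective y
    rw [← map_mul]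
    refine Ideal.Quotient.eq_zero_iff_mem.2 ?_
    rw [pow_succ]
    exact Ideal.mul_mem_mul (hmem r hx) (Ideal.pow_le_self (Nat.succ_ne_zero j) (hmem r' hy))

open IsLocalRing in
theorem exists_lift_of_isAdicComplete {R V : Type*} [CommRing R] [IsLocalRing R]
    [IsAdicComplete (maximalIdeal R) R] [CommRing V] [IsDomain V] (p : ℕ) [Fact p.Prime]
    [CharP (ResidueField R) p] (ρ : V →+* ResidueField R) (hρ : Function.Surjective ρ)
    (hρp : ∀ v, ρ v = 0 → (p : V) ∣ v) (hp : (p : V) ≠ 0) :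
    ∃ σ : V →+* R, ∀ v, residue R (σ v) = ρ v := by
  have hpm : (p : R) ∈ maximalIdeal R := by
    rw [← residue_eq_zero_iff, map_natCast, CharP.cast_eq_zero]
  have step := exists_lift_factorPow p ρ hρ hρp hp (maximalIdeal R) hpm
  choose next hnext using step
  let e : R ⧸ maximalIdeal R ≃+* R ⧸ maximalIdeal R ^ (0 + 1) :=
    Ideal.quotEquivOfEq (by rw [zero_add, pow_one])
  have he : ∀ r, e (residue R r) = Ideal.Quotient.mk _ r := fun r => rfl
  obtain ⟨G, hG0, hG⟩ : ∃ G : ∀ j, V →+* R ⧸ maximalIdeal R ^ (j + 1),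
      (∀ v, G 0 v = e (ρ v)) ∧ ∀ j, (Ideal.Quotient.factorPow (maximalIdeal R)
        (Nat.le_succ (j + 1))).comp (G (j + 1)) = G j :=
    ⟨fun j => Nat.rec (e.toRingHom.comp ρ) (fun j s => next j s) j, fun v => rfl,
      fun j => hnext j _⟩
  have hGle : ∀ m n (h : m ≤ n), (Ideal.Quotient.factorPow (maximalIdeal R)
      (Nat.add_le_add_right h 1)).comp (G n) = G m := by
    intro m n h
    induction n, h using Nat.le_induction with
    | base =>
      ext v
      obtain ⟨r, hr⟩ := Ideal.Quotient.mk_surjective (G m v)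
      rw [RingHom.comp_apply, ← hr]
      rfl
    | succ n hmn ih =>
      ext v
      rw [← ih, ← hG n]
      obtain ⟨r, hr⟩ := Ideal.Quotient.mk_surjective (G (n + 1) v)
      simp only [RingHom.comp_apply]
      rw [← hr]
      rfl
  let f : ∀ n, V →+* R ⧸ maximalIdeal R ^ n := fun n =>
    (Ideal.Quotient.factorPow (maximalIdeal R) (Nat.le_succ n)).comp (G n)
  have hf : ∀ {m n : ℕ} (hle : m ≤ n),
      (Ideal.Quotient.factorPow (maximalIdeal R) hle).comp (f n) = f m := by
    intro m n hle
    ext v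
    simp only [f, ← hGle m n hle, RingHom.comp_apply]
    obtain ⟨r, hr⟩ := Ideal.Quotient.mk_surjective (G n v)
    rw [← hr]
    rfl
  refine ⟨IsAdicComplete.liftRingHom (maximalIdeal R) f hf, fun v => ?_⟩
  apply e.injective
  rw [he, ← hG0]
  refine (IsAdicComplete.mk_liftRingHom (maximalIdeal R) f hf (0 + 1) v).trans ?_
  exact RingHom.congr_fun (hG 0) v

end LiftCohen

section CoefficientRing

open IsLocalRing

theorem formallySmooth_of_charZero (K L : Type*) [Field K] [CharZero K] [Field L] [Algebra K L] :
    Algebra.FormallySmooth K L := by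
  obtain ⟨s, hs⟩ := exists_isTranscendenceBasis K L
  have : Algebra.IsAlgebraic (IntermediateField.adjoin K (Set.range ((↑) : s → L))) L := by
    have := hs.isAlgebraic_field
    exact this
  exact .of_algebraicIndependent_of_isSeparable hs.1

theorem exists_coefficientField (R : Type u) [CommRing R] [IsLocalRing R]
    [IsAdicComplete (maximalIdeal R) R] [CharZero (ResidueField R)] :
    ∃ σ : ResidueField R →+* R, ∀ v, residue R (σ v) = v := by
  have hunit : ∀ y : nonZeroDivisors ℤ, IsUnit (Int.castRingHom R y) := by
    intro y
    rw [← residue_ne_zero_iff_isUnit, eq_intCast, map_intCast]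
    exact Int.cast_ne_zero.2 (nonZeroDivisors.ne_zero y.2)
  let : Algebra ℚ R := (IsLocalization.lift (S := ℚ) hunit).toAlgebra
  have := formallySmooth_of_charZero ℚ (ResidueField R)
  obtain ⟨g, hg⟩ := Algebra.FormallySmooth.exists_mkₐ_comp_eq_of_isAdicComplete
    (I := maximalIdeal R) 
    (RingHom.toRatAlgHom (show ResidueField R →+* R ⧸ maximalIdeal R from
      RingHom.id (ResidueField R)))
  exact ⟨g.toRingHom, fun v => AlgHom.congr_fun hg v⟩

theorem exists_coefficientRing (R : Type u) [CommRing R] [IsLocalRing R]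
    [IsAdicComplete (maximalIdeal R) R] :
    ∃ (V : Type u) (_ : CommRing V) (_ : IsDomain V) (_ : IsNoetherianRing V) (σ : V →+* R) (π : V),
      π ≠ 0 ∧ (∀ r, ∃ v, r - σ v ∈ maximalIdeal R) ∧
        ∀ v, σ v ∈ maximalIdeal R ↔ ∃ w, π * w = v := by
  obtain ⟨p, hp⟩ := CharP.exists (ResidueField R)
  rcases CharP.char_is_prime_or_zero (ResidueField R) p with hpp | rfl
  · have : Fact p.Prime := ⟨hpp⟩
    obtain ⟨V, _, _, _, ρ, hρ, hp0, hpd⟩ := exists_cohenRing (ResidueField R) p hpp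
    obtain ⟨σ, hσ⟩ := exists_lift_of_isAdicComplete p ρ hρ hpd hp0
    refine ⟨V, inferInstance, inferInstance, inferInstance, σ, p, hp0, fun r => ?_, fun v => ?_⟩
    · obtain ⟨v, hv⟩ := hρ (residue R r)
      exact ⟨v, by rw [← residue_eq_zero_iff, map_sub, hσ, hv, sub_self]⟩
    · rw [← residue_eq_zero_iff, hσ]
      constructor
      · intro h
        obtain ⟨w, hw⟩ := hpd v h
        exact ⟨w, hw.symm⟩
      · rintro ⟨w, rfl⟩
        rw [map_mul, map_natCast, CharP.cast_eq_zero, zero_mul]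
  · have := CharP.charP_to_charZero (ResidueField R)
    obtain ⟨σ, hσ⟩ := exists_coefficientField R
    refine ⟨Polynomial (ResidueField R), inferInstance, inferInstance, inferInstance,
      Polynomial.eval₂RingHom σ 0, Polynomial.X, Polynomial.X_ne_zero, fun r => ?_, fun v => ?_⟩
    · refine ⟨Polynomial.C (residue R r), ?_⟩
      rw [← residue_eq_zero_iff, map_sub]
      simp [hσ]
    · have : residue R (Polynomial.eval₂RingHom σ 0 v) = v.coeff 0 := by
        simp [hσ]
      rw [← residue_eq_zero_iff, this, ← Polynomial.X_dvd_iff]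
      exact ⟨fun ⟨w, hw⟩ => ⟨w, hw.symm⟩, fun ⟨w, hw⟩ => ⟨w, hw.symm⟩⟩

end CoefficientRing

section RegularRigidity

open IsLocalRing RingTheory.Sequence TensorProduct

theorem MatExact.pi {A κ : Type*} [CommRing A] {m n p : Type*} [Fintype n] [Fintype p]
    {M : Matrix m n A} {N : Matrix n p A} (h : MatExact A M N) : MatExact (κ → A) M N := by
  intro v
  constructor
  · intro hv
    have : ∀ j, ∃ w : p → A, smulVec A N w = fun k => v k j := fun j => (h _).1 (by
      ext i
      have := congrFun (congrFun hv i) j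
      simpa [smulVec_apply] using this)
    choose w hw using this
    refine ⟨fun k j => w j k, ?_⟩
    ext i j
    have := congrFun (hw j) i
    simpa [smulVec_apply] using this
  · rintro ⟨w, rfl⟩
    ext i j
    have := congrFun ((h (smulVec A N fun k => w k j)).2 ⟨_, rfl⟩) i
    simpa [smulVec_apply] using this

theorem MatExact.of_isField {A : Type*} [CommRing A] (hA : IsField A) {m n p : Type*} [Fintype n]
    [Fintype p] {M : Matrix m n A} {N : Matrix n p A} (h : MatExact A M N) (X : Type*)
    [AddCommGroup X] [Module A X] [Module.Finite A X] : MatExact X M N := by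
  have : Module.Free A X := by
    let := hA.toField
    exact Module.Free.of_divisionRing A X
  have := hA.nontrivial
  exact h.pi.congr (Module.finBasis A X).equivFun.symm

/-- Prepend a type to a sequence of types. -/
def consIdx (κ : Type) (ι : ℕ → Type) : ℕ → Type
  | 0 => κ
  | j + 1 => ι j

instance {κ : Type} {ι : ℕ → Type} [Fintype κ] [∀ j, Fintype (ι j)] :
    ∀ j, Fintype (consIdx κ ι j)
  | 0 => inferInstanceAs (Fintype κ)
  | j + 1 => inferInstanceAs (Fintype (ι j))

/-- Prepend a matrix to a sequence of matrices. -/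
def consMat {A : Type*} {κ : Type} {ι : ℕ → Type} (d : Matrix κ (ι 0) A)
    (δ : ∀ j, Matrix (ι j) (ι (j + 1)) A) :
    ∀ j, Matrix (consIdx κ ι j) (consIdx κ ι (j + 1)) A
  | 0 => d
  | j + 1 => δ j

theorem exists_matExact_linearMap {R : Type*} [CommRing R] [IsNoetherianRing R] {b : ℕ}
    {Z : Type*} [AddCommGroup Z] [Module R Z] (π : (Fin b → R) →ₗ[R] Z) :
    ∃ (c : ℕ) (d : Matrix (Fin b) (Fin c) R), Function.Exact (smulVec R d) π := by
  obtain ⟨c, s, hs⟩ := Submodule.fg_iff_exists_fin_generating_family.1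
    (IsNoetherian.noetherian (LinearMap.ker π))
  refine ⟨c, Matrix.of fun i j => s j i, ?_⟩
  rw [LinearMap.exact_iff, ← hs]
  ext v
  rw [Submodule.mem_span_range_iff_exists_fun]
  constructor
  · rintro ⟨w, rfl⟩
    refine ⟨w, ?_⟩
    ext i
    simp [smulVec_apply, mul_comm]
  · rintro ⟨w, rfl⟩
    refine ⟨w, ?_⟩
    ext i
    simp [smulVec_apply, mul_comm]

theorem exists_matExact {A : Type*} [CommRing A] [IsNoetherianRing A] {a b : ℕ}
    (d : Matrix (Fin a) (Fin b) A) :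
    ∃ (c : ℕ) (d' : Matrix (Fin b) (Fin c) A), MatExact A d d' :=
  exists_matExact_linearMap (smulVec A d)

/-- A matrix whose columns generate the kernel of the given matrix. -/
noncomputable def syzygyMat {A : Type*} [CommRing A] [IsNoetherianRing A]
    (s : Σ a b : ℕ, Matrix (Fin a) (Fin b) A) : Σ a b : ℕ, Matrix (Fin a) (Fin b) A :=
  ⟨s.2.1, (exists_matExact s.2.2).choose, (exists_matExact s.2.2).choose_spec.choose⟩

/-- Iterated syzygies of a matrix. -/
noncomputable def syzygySeq {A : Type*} [CommRing A] [IsNoetherianRing A]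
    (s : Σ a b : ℕ, Matrix (Fin a) (Fin b) A) : ℕ → Σ a b : ℕ, Matrix (Fin a) (Fin b) A
  | 0 => s
  | j + 1 => syzygyMat (syzygySeq s j)

theorem matExact_of_isAdicComplete {A : Type u} [CommRing A] [IsLocalRing A] [IsNoetherianRing A]
    [IsAdicComplete (maximalIdeal A) A] {g : ℕ} (x : Fin (g + 1) → A)
    (hx : IsWeaklyRegular A (List.ofFn x)) (hxm : Ideal.span (Set.range x) = maximalIdeal A)
    {a b c e : ℕ} (d₀ : Matrix (Fin a) (Fin b) A) (d₁ : Matrix (Fin b) (Fin c) A)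
    (d₂ : Matrix (Fin c) (Fin e) A) (h₁ : MatExact A d₀ d₁) (h₂ : MatExact A d₁ d₂)
    (N : Type u) [AddCommGroup N] [Module A N] [Module.Finite A N] (hN : MatExact N d₀ d₁) :
    MatExact N d₁ d₂ := by
  obtain ⟨V, _, _, _, σ, π, hπ, hσ, hσπ⟩ := exists_coefficientRing A
  let S := syzygySeq (⟨c, e, d₂⟩ : Σ a b : ℕ, Matrix (Fin a) (Fin b) A)
  let δ : ∀ j, Matrix (Fin (S j).1) (Fin (S (j + 1)).1) A := fun j => (S j).2.2
  have hδ : ∀ j, MatExact A (δ j) (δ (j + 1)) := fun j =>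
    (exists_matExact (S j).2.2).choose_spec.choose_spec
  let ι : ℕ → Type := consIdx (Fin 0) (consIdx (Fin a) (consIdx (Fin b) fun j => Fin (S j).1))
  let ε : ∀ j, Matrix (ι j) (ι (j + 1)) A :=
    consMat (0 : Matrix (Fin 0) (Fin a) A) (consMat (ι := consIdx (Fin b) fun j => Fin (S j).1)
      d₀ (consMat (ι := fun j => Fin (S j).1) d₁ δ))
  have hε : ∀ j, MatExact A (ε (j + 1)) (ε (j + 2)) := by
    rintro (_ | _ | j)
    · exact h₁
    · exact h₂
    · exact hδ j
  have hε0 : ∀ j, ε j * ε (j + 1) = 0 := by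
    rintro (_ | j)
    · ext i
      exact Fin.elim0 i
    · exact (hε j).mul_eq_zero
  exact matExact_of_coefficientRing x hx hxm σ hσ π hπ hσπ ε hε0 hε N hN 1

theorem matExact_of_isWeaklyRegular {R : Type u} [CommRing R] [IsLocalRing R] [IsNoetherianRing R]
    (xs : List R) (hx : IsWeaklyRegular R xs) (hxm : Ideal.ofList xs = maximalIdeal R)
    {a b c e : ℕ} (d₀ : Matrix (Fin a) (Fin b) R) (d₁ : Matrix (Fin b) (Fin c) R)
    (d₂ : Matrix (Fin c) (Fin e) R) (h₁ : MatExact R d₀ d₁) (h₂ : MatExact R d₁ d₂)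
    (N : Type u) [AddCommGroup N] [Module R N] [Module.Finite R N] (hN : MatExact N d₀ d₁) :
    MatExact N d₁ d₂ := by
  obtain ⟨g, y, rfl⟩ : ∃ (g : ℕ) (y : Fin g → R), xs = List.ofFn y :=
    ⟨xs.length, xs.get, (List.ofFn_get xs).symm⟩
  rcases g with _ | g
  · rw [List.ofFn_zero, Ideal.ofList_nil, eq_comm, ← isField_iff_maximalIdeal_eq] at hxm
    exact h₂.of_isField hxm N
  let A := AdicCompletion (maximalIdeal R) R
  have hA : IsNoetherianRing A := isNoetherianRing_adicCompletion _
  have hAc : IsAdicComplete (maximalIdeal A) A := inferInstance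
  have hmap : maximalIdeal A = (maximalIdeal R).map (algebraMap R A) :=
    AdicCompletion.maximalIdeal_eq_map
  have hloc : IsLocalHom (algebraMap R A) := by
    refine ((local_hom_TFAE (algebraMap R A)).out 0 2).2 ?_
    rw [hmap]
  have hff : Module.FaithfullyFlat R A := Module.FaithfullyFlat.of_flat_of_isLocalHom
  have hreg : IsWeaklyRegular A (List.ofFn (algebraMap R A ∘ y)) := by
    have := hx.of_flat (S := A)
    rwa [List.map_ofFn] at this
  have hspan : Ideal.span (Set.range (algebraMap R A ∘ y)) = maximalIdeal A := by
    rw [Set.range_comp, ← Ideal.map_span, ← ofList_ofFn, hxm, hmap]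
  rw [← matExact_faithfullyFlat_iff A] at hN ⊢
  have key : ∀ {a b c : ℕ} {d : Matrix (Fin a) (Fin b) R} {d' : Matrix (Fin b) (Fin c) R},
      MatExact R d d' → MatExact A (d.map (algebraMap R A)) (d'.map (algebraMap R A)) :=
    fun h => (h.baseChange A).congr (TensorProduct.AlgebraTensorModule.rid R A A)
  exact matExact_of_isAdicComplete _ hreg hspan _ _ _ (key h₁) (key h₂) (A ⊗[R] N) hN

end RegularRigidity

section FreeResolution

open CategoryTheory

variable {R : Type u} [CommRing R]

theorem constr_comp_smulVec {b c : Type*} [Finite b] [Finite c] [Fintype b] [Fintype c]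
    {X : Type*} [AddCommGroup X] [Module R X] (D : Matrix b c R) (v : b → X) :
    ((Pi.basisFun R b).constr R v) ∘ₗ smulVec R D =
        (Pi.basisFun R c).constr R (smulVec X D.transpose v) := by
  classical
  refine (Pi.basisFun R c).ext fun j => ?_
  simp [smulVec_apply, Module.Basis.constr_apply_fintype, Pi.single_apply]

theorem matExact_transpose_iff {a b c : Type*} [Fintype a] [Fintype b] [Fintype c]
    (X : Type*) [AddCommGroup X] [Module R X] (D : Matrix a b R) (D' : Matrix b c R) :
    MatExact X D'.transpose D.transpose ↔ ∀ f : (b → R) →ₗ[R] X,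
      f ∘ₗ smulVec R D' = 0 ↔ ∃ h : (a → R) →ₗ[R] X, h ∘ₗ smulVec R D = f := by
  have key : ∀ v : b → X, (((Pi.basisFun R b).constr R v) ∘ₗ smulVec R D' = 0 ↔
      ∃ h : (a → R) →ₗ[R] X, h ∘ₗ smulVec R D = (Pi.basisFun R b).constr R v) ↔
      (smulVec X D'.transpose v = 0 ↔ v ∈ Set.range (smulVec X D.transpose)) := by
    intro v
    rw [constr_comp_smulVec, LinearEquiv.map_eq_zero_iff]
    refine iff_congr Iff.rfl ⟨?_, ?_⟩
    · rintro ⟨h, hh⟩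
      obtain ⟨w, rfl⟩ := ((Pi.basisFun R a).constr R).surjective h
      rw [constr_comp_smulVec] at hh
      exact ⟨w, ((Pi.basisFun R b).constr R).injective hh⟩
    · rintro ⟨w, rfl⟩
      exact ⟨(Pi.basisFun R a).constr R w, constr_comp_smulVec D w⟩
  constructor
  · intro h f
    obtain ⟨v, rfl⟩ := ((Pi.basisFun R b).constr R).surjective f
    exact (key v).2 (h v)
  · exact fun h v => (key v).1 (h _)

variable {n : ℕ → ℕ} (D : ∀ i, Matrix (Fin (n i)) (Fin (n (i + 1))) R)

/-- The chain complex of free modules with the given boundary matrices. -/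
noncomputable def matComplex (hD : ∀ i, D i * D (i + 1) = 0) : ChainComplex (ModuleCat.{u} R) ℕ :=
  ChainComplex.of (fun i => ModuleCat.of R (Fin (n i) → R))
    (fun i => ModuleCat.ofHom (smulVec R (D i))) (fun i => by
      refine ModuleCat.hom_ext (LinearMap.ext fun v => ?_)
      change smulVec R (D i) (smulVec R (D (i + 1)) v) = 0
      rw [← smulVec_mul, hD, smulVec_zero])

theorem matComplex_d (hD : ∀ i, D i * D (i + 1) = 0) (i : ℕ) :
    (matComplex D hD).d (i + 1) i = ModuleCat.ofHom (smulVec R (D i)) :=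
  by simp [matComplex]

theorem matComplex_exactAt_succ (hD : ∀ i, MatExact R (D i) (D (i + 1))) (i : ℕ) :
    (matComplex D fun i => (hD i).mul_eq_zero).ExactAt (i + 1) := by
  rw [HomologicalComplex.exactAt_iff' _ (i + 1 + 1) (i + 1) i (by simp) (by simp),
    ShortComplex.ShortExact.moduleCat_exact_iff_function_exact]
  simp only [HomologicalComplex.sc', HomologicalComplex.shortComplexFunctor', matComplex_d]
  exact hD i

/-- A projective resolution from an acyclic complex with augmentation. -/
noncomputable def projectiveResolutionOfExact {C : Type*} [Category C] [Abelian C]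
    (K : ChainComplex C ℕ) (hK : ∀ i, Projective (K.X i)) (he : ∀ i, K.ExactAt (i + 1)) {Z : C}
    (f : K.X 0 ⟶ Z) (w : K.d 1 0 ≫ f = 0) (hf : (ShortComplex.mk _ _ w).Exact) (hf' : Epi f) :
    ProjectiveResolution Z where
  complex := K
  projective := hK
  π := (ChainComplex.toSingle₀Equiv _ _).symm ⟨f, w⟩
  quasiIso := ⟨fun i => by
    cases i
    · rw [ChainComplex.quasiIsoAt₀_iff, ShortComplex.quasiIso_iff_of_zeros']
      · refine (ShortComplex.exact_and_epi_g_iff_of_iso ?_).2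
          ⟨hf, hf'⟩
        exact ShortComplex.isoMk (Iso.refl _) (Iso.refl _) (Iso.refl _)
          ((Category.id_comp _).trans (Category.comp_id _).symm)
          (((Category.id_comp _).trans
            (ChainComplex.toSingle₀Equiv_symm_apply_f_zero f w).symm).trans
              (Category.comp_id _).symm)
      · exact K.shape _ _ (by simp)
      all_goals rfl
    · rw [quasiIsoAt_iff_exactAt']
      · exact he _
      · apply ChainComplex.exactAt_succ_single_obj⟩

theorem linearYonedaObj_exactAt_succ_iff (K : ChainComplex (ModuleCat.{u} R) ℕ)
    (Y : ModuleCat.{u} R) (i : ℕ) :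
    (K.linearYonedaObj R Y).ExactAt (i + 1) ↔ ∀ f : K.X (i + 1) ⟶ Y,
      K.d (i + 1 + 1) (i + 1) ≫ f = 0 ↔ ∃ h : K.X i ⟶ Y, K.d (i + 1) i ≫ h = f := by
  rw [HomologicalComplex.exactAt_iff' _ i (i + 1) (i + 1 + 1) (by simp) (by simp),
    ShortComplex.ShortExact.moduleCat_exact_iff_function_exact]
  exact Iff.rfl

theorem linearYonedaObj_exactAt_zero_iff (K : ChainComplex (ModuleCat.{u} R) ℕ)
    (Y : ModuleCat.{u} R) :
    (K.linearYonedaObj R Y).ExactAt 0 ↔ ∀ f : K.X 0 ⟶ Y, K.d 1 0 ≫ f = 0 ↔ f = 0 := by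
  rw [HomologicalComplex.exactAt_iff' _ 0 0 1 (by simp) (by simp),
    ShortComplex.ShortExact.moduleCat_exact_iff_function_exact]
  have h0 : K.d 0 0 = 0 := K.shape _ _ (by simp)
  refine forall_congr' fun f => iff_congr Iff.rfl ⟨?_, fun h => ⟨0, ?_⟩⟩
  · rintro ⟨h, hh⟩
    exact hh.symm.trans (((congrArg (· ≫ (show K.X 0 ⟶ Y from h)) h0)).trans Limits.zero_comp)
  · exact (Limits.comp_zero (f := K.d 0 0)).trans h.symm

theorem subsingleton_ext_iff_exactAt {Z : ModuleCat.{u} R} (P : ProjectiveResolution Z)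
    (Y : ModuleCat.{u} R) (i : ℕ) :
    Subsingleton (((Ext R (ModuleCat.{u} R) i).obj (Opposite.op Z)).obj Y) ↔
      (P.complex.linearYonedaObj R Y).ExactAt i := by
  rw [HomologicalComplex.exactAt_iff_isZero_homology, ← (P.isoExt (R := R) i Y).isZero_iff,
    ModuleCat.isZero_iff_subsingleton]

end FreeResolution

section ExtMatrices

open CategoryTheory

variable {R : Type u} [CommRing R]

/-- The number of columns of the transposed boundary matrices. -/
def shiftIdx (n : ℕ → ℕ) : ℕ → ℕ
  | 0 => 0
  | i + 1 => n i

/-- The transposed boundary matrices, preceded by an empty matrix. -/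
def coboundary {n : ℕ → ℕ} (D : ∀ i, Matrix (Fin (n i)) (Fin (n (i + 1))) R) :
    ∀ i, Matrix (Fin (shiftIdx n (i + 1))) (Fin (shiftIdx n i)) R
  | 0 => Matrix.of fun _ j => Fin.elim0 j
  | i + 1 => (D i).transpose

theorem exists_freeResolution [IsNoetherianRing R] (M : Type u) [AddCommGroup M] [Module R M]
    [Module.Finite R M] : ∃ (n : ℕ → ℕ) (D : ∀ i, Matrix (Fin (n i)) (Fin (n (i + 1))) R)
      (π : (Fin (n 0) → R) →ₗ[R] M), (∀ i, MatExact R (D i) (D (i + 1))) ∧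
        Function.Exact (smulVec R (D 0)) π ∧ Function.Surjective π := by
  obtain ⟨b, π, hπ⟩ := Module.Finite.exists_fin' R M
  obtain ⟨c, d, hd⟩ := exists_matExact_linearMap π
  let S := syzygySeq (A := R) ⟨b, c, d⟩
  exact ⟨fun i => (S i).1, fun i => (S i).2.2, π,
    fun i => (exists_matExact (S i).2.2).choose_spec.choose_spec, hd, hπ⟩

theorem exists_matExact_iff_subsingleton_ext [IsNoetherianRing R] (M : Type u) [AddCommGroup M]
    [Module R M] [Module.Finite R M] :
    ∃ (m : ℕ → ℕ) (T : ∀ i, Matrix (Fin (m (i + 1))) (Fin (m i)) R), (∀ i, T (i + 1) * T i = 0) ∧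
      ∀ (X : Type u) [AddCommGroup X] [Module R X] (i : ℕ),
        Subsingleton (((Ext R (ModuleCat.{u} R) i).obj
          (Opposite.op (ModuleCat.of R M))).obj (ModuleCat.of R X)) ↔
            MatExact X (T (i + 1)) (T i) := by
  obtain ⟨n, D, π, hD, hπ, hs⟩ := exists_freeResolution (R := R) M
  refine ⟨shiftIdx n, coboundary D, ?_, fun X _ _ i => ?_⟩
  · rintro (_ | i)
    · ext i j
      exact Fin.elim0 j
    · change (D (i + 1)).transpose * (D i).transpose = 0
      rw [← Matrix.transpose_mul, (hD i).mul_eq_zero, Matrix.transpose_zero]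
  · have : Epi (ModuleCat.ofHom π) := (ModuleCat.epi_iff_surjective _).2 hs
    have w : (matComplex D fun i => (hD i).mul_eq_zero).d 1 0 ≫ ModuleCat.ofHom π = 0 := by
      rw [matComplex_d]
      exact ModuleCat.hom_ext (LinearMap.ext fun v => hπ.apply_apply_eq_zero v)
    let P := projectiveResolutionOfExact (matComplex D fun i => (hD i).mul_eq_zero)
      (fun i => ModuleCat.projective_of_free (Pi.basisFun R (Fin (n i))))
      (matComplex_exactAt_succ D hD) (ModuleCat.ofHom π) w (by
        rw [ShortComplex.ShortExact.moduleCat_exact_iff_function_exact]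
        simp only [matComplex_d]
        exact hπ) this
    rw [subsingleton_ext_iff_exactAt P]
    cases i with
    | zero =>
      rw [linearYonedaObj_exactAt_zero_iff]
      change (∀ f : ModuleCat.of R (Fin (n 0) → R) ⟶ ModuleCat.of R X,
        (matComplex D fun i => (hD i).mul_eq_zero).d 1 0 ≫ f = 0 ↔ f = 0) ↔
          ∀ v, smulVec X (D 0).transpose v = 0 ↔
            ∃ w : Fin (shiftIdx n 0) → X, smulVec X (coboundary D 0) w = v
      rw [matComplex_d]
      have : IsEmpty (Fin (shiftIdx n 0)) := inferInstanceAs (IsEmpty (Fin 0))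
      have hz : ∀ v : Fin (n 0) → X,
          (∃ w : Fin (shiftIdx n 0) → X, smulVec X (coboundary D 0) w = v) ↔ v = 0 := fun v =>
        ⟨fun ⟨w, hw⟩ => hw.symm.trans ((congrArg _ (Subsingleton.elim w 0)).trans
          (map_zero (smulVec X (coboundary D 0)))),
          fun h => ⟨0, (map_zero (smulVec X (coboundary D 0))).trans h.symm⟩⟩
      simp only [hz]
      have key : ∀ v : Fin (n 0) → X, (ModuleCat.ofHom (smulVec R (D 0)) ≫
          ModuleCat.ofHom ((Pi.basisFun R (Fin (n 0))).constr R v) = 0 ↔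
            ModuleCat.ofHom ((Pi.basisFun R (Fin (n 0))).constr R v) = 0) ↔
              (smulVec X (D 0).transpose v = 0 ↔ v = 0) := by
        intro v
        rw [← ModuleCat.ofHom_comp, constr_comp_smulVec]
        refine iff_congr ?_ ?_
        · exact ModuleCat.hom_ext_iff.trans (LinearEquiv.map_eq_zero_iff _)
        · exact ModuleCat.hom_ext_iff.trans (LinearEquiv.map_eq_zero_iff _)
      constructor
      · exact fun h v => (key v).1 (h _)
      · intro h f
        obtain ⟨v, hv⟩ := ((Pi.basisFun R (Fin (n 0))).constr R).surjective f.hom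
        obtain rfl : ModuleCat.ofHom ((Pi.basisFun R (Fin (n 0))).constr R v) = f :=
          ModuleCat.hom_ext hv
        exact (key v).2 (h v)
    | succ i =>
      rw [linearYonedaObj_exactAt_succ_iff]
      change _ ↔ MatExact X (D (i + 1)).transpose (D i).transpose
      rw [matExact_transpose_iff]
      change (∀ f : ModuleCat.of R (Fin (n (i + 1)) → R) ⟶ ModuleCat.of R X,
        (matComplex D fun i => (hD i).mul_eq_zero).d (i + 1 + 1) (i + 1) ≫ f = 0 ↔
          ∃ h : ModuleCat.of R (Fin (n i) → R) ⟶ ModuleCat.of R X,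
            (matComplex D fun i => (hD i).mul_eq_zero).d (i + 1) i ≫ h = f) ↔ _
      rw [matComplex_d, matComplex_d]
      constructor
      · intro h f
        refine (ModuleCat.hom_ext_iff.symm.trans (h (ModuleCat.ofHom f))).trans
          ⟨fun ⟨g, hg⟩ => ⟨g.hom, congrArg ModuleCat.Hom.hom hg⟩,
            fun ⟨g, hg⟩ => ⟨ModuleCat.ofHom g, ModuleCat.hom_ext hg⟩⟩
      · intro h f
        refine (ModuleCat.hom_ext_iff.trans (h f.hom)).trans
          ⟨fun ⟨g, hg⟩ => ⟨ModuleCat.ofHom g, ModuleCat.hom_ext hg⟩,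
            fun ⟨g, hg⟩ => ⟨g.hom, congrArg ModuleCat.Hom.hom hg⟩⟩

end ExtMatrices

section Rigidity

open IsLocalRing TensorProduct

/-- The tensor of a vector over a module with the images of the standard basis vectors. -/
noncomputable def tmulVec {A X Q : Type*} [CommRing A] [AddCommGroup X] [Module A X]
    [AddCommGroup Q] [Module A Q] {c : Type*} [Fintype c] [DecidableEq c] (φ : (c → A) →ₗ[A] Q) :
    (c → X) →ₗ[A] Q ⊗[A] X :=
  ∑ j, (TensorProduct.mk A Q X (φ (Pi.single j 1))) ∘ₗ LinearMap.proj j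

theorem tmulVec_apply {A X Q : Type*} [CommRing A] [AddCommGroup X] [Module A X]
    [AddCommGroup Q] [Module A Q] {c : Type*} [Fintype c] [DecidableEq c]
    (φ : (c → A) →ₗ[A] Q) (v : c → X) :
    tmulVec φ v = ∑ j, φ (Pi.single j 1) ⊗ₜ[A] v j := by
  simp [tmulVec]

theorem tmulVec_smul {A X Q : Type*} [CommRing A] [AddCommGroup X] [Module A X]
    [AddCommGroup Q] [Module A Q] {c : Type*} [Fintype c] [DecidableEq c]
    (φ : (c → A) →ₗ[A] Q) (w : c → A) (x : X) :
    tmulVec φ (fun j => w j • x) = φ w ⊗ₜ[A] x := by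
  simp_rw [tmulVec_apply, ← TensorProduct.smul_tmul, ← TensorProduct.sum_tmul, ← map_smul]
  rw [← map_sum]
  congr 2
  ext i
  simp [Pi.single_apply]

theorem tmulVec_smulVec {A X Q : Type*} [CommRing A] [AddCommGroup X] [Module A X]
    [AddCommGroup Q] [Module A Q] {c b : Type*} [Fintype c] [DecidableEq c] [Fintype b]
    (φ : (c → A) →ₗ[A] Q) (C : Matrix c b A) (h : ∀ u, φ (smulVec A C u) = 0) (v : b → X) :
    tmulVec φ (smulVec X C v) = 0 := by
  classical
  have hv : smulVec X C v = ∑ k, fun j => smulVec A C (Pi.single k 1) j • v k := by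
    ext j
    simp [smulVec_apply, Pi.single_apply]
  rw [hv, map_sum]
  exact Finset.sum_eq_zero fun k _ => by rw [tmulVec_smul, h, TensorProduct.zero_tmul]

theorem subsingleton_or_subsingleton_of_tensorProduct {R : Type*} [CommRing R] [IsLocalRing R]
    {Q N : Type*} [AddCommGroup Q] [Module R Q] [Module.Finite R Q] [AddCommGroup N] [Module R N]
    [Module.Finite R N] (h : Subsingleton (Q ⊗[R] N)) : Subsingleton Q ∨ Subsingleton N := by
  let k := ResidueField R
  refine or_iff_not_imp_left.2 fun hQ => ?_
  have hQ' : Nontrivial (k ⊗[R] Q) := by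
    rwa [← not_subsingleton_iff_nontrivial, IsLocalRing.subsingleton_tensorProduct]
  have : Subsingleton ((k ⊗[R] Q) ⊗[k] (k ⊗[R] N)) :=
    (TensorProduct.AlgebraTensorModule.distribBaseChange R k Q N).symm.injective.subsingleton
  exact IsLocalRing.subsingleton_tensorProduct.1
    (Module.FaithfullyFlat.subsingleton_tensorProduct_iff_right k (k ⊗[R] Q) |>.1 this)

theorem matExact_of_matExact_of_mul_eq_zero {R : Type u} [CommRing R] [IsLocalRing R]
    [IsNoetherianRing R] (xs : List R) (hx : RingTheory.Sequence.IsWeaklyRegular R xs)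
    (hxm : Ideal.ofList xs = maximalIdeal R)
    {a b c e : ℕ} (d₀ : Matrix (Fin a) (Fin b) R) (d₁ : Matrix (Fin b) (Fin c) R)
    (d₂ : Matrix (Fin c) (Fin e) R) (h₁ : d₀ * d₁ = 0) (h₂ : MatExact R d₁ d₂)
    (N : Type u) [AddCommGroup N] [Module R N] [Module.Finite R N] (hN : MatExact N d₀ d₁) :
    MatExact N d₁ d₂ := by
  obtain ⟨c', d₁', h₁'⟩ := exists_matExact d₀
  obtain ⟨e', d₂', h₂'⟩ := exists_matExact d₁'
  have hcol : ∀ j, ∃ w, smulVec R d₁' w = fun i => d₁ i j := fun j => (h₁' _).1 (by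
    ext i
    simpa [smulVec_apply, Matrix.mul_apply] using congrFun (congrFun h₁ i) j)
  choose C' hC' using hcol
  let C : Matrix (Fin c') (Fin c) R := Matrix.of fun i j => C' j i
  have hC : d₁ = d₁' * C := by
    ext i j
    simpa [smulVec_apply, Matrix.mul_apply, C] using (congrFun (hC' j) i).symm
  have hN' : MatExact N d₀ d₁' := by
    rw [matExact_iff h₁'.mul_eq_zero]
    intro v hv
    obtain ⟨w, rfl⟩ := (hN v).1 hv
    exact ⟨smulVec N C w, by rw [hC, smulVec_mul]⟩
  have hN₂ : MatExact N d₁' d₂' :=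
    matExact_of_isWeaklyRegular xs hx hxm d₀ d₁' d₂' h₁' h₂' N hN'
  let L : Submodule R (Fin c' → R) :=
    LinearMap.range (smulVec R C) ⊔ LinearMap.range (smulVec R d₂')
  have hC0 : ∀ u, L.mkQ (smulVec R C u) = 0 := fun u =>
    (Submodule.Quotient.mk_eq_zero _).2 (Submodule.mem_sup_left ⟨u, rfl⟩)
  have hd0 : ∀ u, L.mkQ (smulVec R d₂' u) = 0 := fun u =>
    (Submodule.Quotient.mk_eq_zero _).2 (Submodule.mem_sup_right ⟨u, rfl⟩)
  have hQN : Subsingleton (((Fin c' → R) ⧸ L) ⊗[R] N) := by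
    refine subsingleton_of_forall_eq 0 fun z => ?_
    induction z with
    | zero => rfl
    | add x y hx hy => rw [hx, hy, add_zero]
    | tmul q x =>
      obtain ⟨w, rfl⟩ := L.mkQ_surjective q
      rw [← tmulVec_smul]
      obtain ⟨u, hu⟩ := (hN (smulVec N d₁' fun j => w j • x)).1 (by
        rw [← smulVec_mul, h₁'.mul_eq_zero, smulVec_zero])
      rw [hC, smulVec_mul, ← sub_eq_zero, ← map_sub] at hu
      obtain ⟨t, ht⟩ := (hN₂ _).1 hu
      have hz := tmulVec_smulVec L.mkQ d₂' hd0 t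
      rwa [ht, map_sub, tmulVec_smulVec L.mkQ C hC0 u, zero_sub, neg_eq_zero] at hz
  rcases subsingleton_or_subsingleton_of_tensorProduct hQN with hQ | hN0
  · have hL : L = ⊤ := Submodule.Quotient.subsingleton_iff.1 hQ
    refine matExact_of_isWeaklyRegular xs hx hxm d₀ d₁ d₂ ?_ h₂ N hN
    rw [matExact_iff h₁]
    intro v hv
    obtain ⟨w, rfl⟩ := (h₁' v).1 hv
    have hw : w ∈ L := hL ▸ Submodule.mem_top
    obtain ⟨_, ⟨u, rfl⟩, _, ⟨t, rfl⟩, rfl⟩ := Submodule.mem_sup.1 hw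
    refine ⟨u, ?_⟩
    rw [map_add, ← smulVec_mul _ d₂', h₂'.mul_eq_zero, smulVec_zero, add_zero, hC, smulVec_mul]
  · exact matExact_of_subsingleton _ _

end Rigidity

/-- (Jothilingam) Over a regular local ring `R`, if `M`, `N` are finitely generated with
`M ≠ 0` and `Ext_R^n(M, N) = 0` for some `1 ≤ n ≤ grade M`, then
`Ext_R^{n−1}(M, R) ⊗_R N ≅ Ext_R^{n−1}(M, N)`; in particular, since
`Ext_R^{n−1}(M, R) = 0` (as `n − 1 < grade M`), also `Ext_R^{n−1}(M, N) = 0`. -/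
theorem ext_tensor_iso_of_ext_vanish
    (R : Type u) [CommRing R] [IsLocalRing R] [IsNoetherianRing R]
    (hreg : IsRegularLocal R)
    (M : Type u) [AddCommGroup M] [Module R M] [Module.Finite R M] (hM : Nontrivial M)
    (N : Type u) [AddCommGroup N] [Module R N] [Module.Finite R N]
    (n : ℕ) (hn1 : 1 ≤ n) (hn2 : n ≤ moduleGrade R M)
    (hvanish : Subsingleton (extMod R n M N)) :
    Nonempty ((TensorProduct R (extMod R (n - 1) M R) N) ≃ₗ[R] extMod R (n - 1) M N) ∧
      Subsingleton (extMod R (n - 1) M N) := by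
  obtain ⟨-, s, hs, hcard⟩ := hreg
  have hxm : Ideal.ofList s.toList = maximalIdeal R := by
    rw [← hs, Ideal.ofList]
    congr 1
    ext x
    simp
  have hx := (isDomain_and_isWeaklyRegular_of_le_ringKrullDim s.card R s.toList
    s.length_toList hxm hcard.le).2
  obtain ⟨n, rfl⟩ : ∃ k, n = k + 1 := ⟨n - 1, (Nat.sub_add_cancel hn1).symm⟩
  rw [Nat.add_sub_cancel]
  obtain ⟨m, T, hT, hext⟩ := exists_matExact_iff_subsingleton_ext (R := R) M
  have hR : Subsingleton (extMod R n M R) := by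
    by_contra h
    exact Nat.notMem_of_lt_sInf (Nat.lt_of_succ_le hn2) h
  have hN : Subsingleton (extMod R n M N) := (hext N n).2
    (matExact_of_matExact_of_mul_eq_zero s.toList hx hxm _ _ _ (hT (n + 1)) ((hext R n).1 hR) N
      ((hext N (n + 1)).1 hvanish))
  have : Subsingleton (TensorProduct R (extMod R n M R) N) :=
    subsingleton_of_forall_eq 0 fun z => by
      induction z with
      | zero => rfl
      | add x y hx hy => rw [hx, hy, add_zero]
      | tmul q x => rw [Subsingleton.elim q 0, TensorProduct.zero_tmul]
  exact ⟨⟨0, 0, fun _ => Subsingleton.elim _ _, fun _ => Subsingleton.elim _ _⟩, hN⟩
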